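/- Let J ⊂ ℂ be a quasicircle, i.e., a Jordan curve for which there exists a constant M such that for all a, b ∈ J the subarc of J between a and b of smaller diameter satisfies diam J(a,b) ≤ M|a−b|, and let G be the quasidisk bounded by J (the bounded connected component of ℂ∖J). Then the Cauchy transform maps B₂(G) onto B₂¹(ℂ∖cl(G)): for every γ ∈ B₂¹(ℂ∖cl(G)) there exists g ∈ B₂(G) with γ(ζ) = (1/π)∬_G conj(g(z))/(z−ζ) dx dy for all ζ ∈ ℂ∖cl(G), and conversely Kg ∈ B₂¹(ℂ∖cl(G)) for every g ∈ B₂(G). Thus K(B₂*(G)) = B₂¹(ℂ∖cl(G)). -/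

import Mathlib

open Complex MeasureTheory Metric Set Filter Bornology

/-- A Jordan curve: the image of an injective continuous map of the unit circle into `ℂ`. -/
def IsJordanCurve (J : Set ℂ) : Prop :=
  ∃ f : ℂ → ℂ, ContinuousOn f (Metric.sphere 0 1) ∧
    Set.InjOn f (Metric.sphere 0 1) ∧ J = f '' Metric.sphere 0 1

/-- A quasicircle: a Jordan curve `J` such that for some constant `M`, any two points
`a, b ∈ J` are joined by a subarc (a connected subset of `J` containing `a` and `b`)
of diameter at most `M * |a - b|`.  This is equivalent to the usual condition
`diam J(a,b) ≤ M |a-b|` for the subarc `J(a,b)` of smaller diameter. -/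
def IsQuasicircle (J : Set ℂ) : Prop :=
  IsJordanCurve J ∧ ∃ M : ℝ, ∀ a ∈ J, ∀ b ∈ J,
    ∃ A : Set ℂ, A ⊆ J ∧ IsPreconnected A ∧ a ∈ A ∧ b ∈ A ∧
      Metric.diam A ≤ M * dist a b

/-- Membership in the Bergman space `B₂(G)`: holomorphic with square-integrable modulus. -/
def MemB2 (G : Set ℂ) (g : ℂ → ℂ) : Prop :=
  DifferentiableOn ℂ g G ∧ IntegrableOn (fun z => ‖g z‖ ^ 2) G volume

/-- Membership in `B₂¹(Ω)`: holomorphic, vanishing at infinity, with square-integrable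
derivative on `Ω`. -/
def MemB21 (Ω : Set ℂ) (γ : ℂ → ℂ) : Prop :=
  DifferentiableOn ℂ γ Ω ∧ Tendsto γ (cobounded ℂ) (nhds 0) ∧
    IntegrableOn (fun ζ => ‖deriv γ ζ‖ ^ 2) Ω volume

/-- The Cauchy transform `(Kg)(ζ) = (1/π) ∬_G conj (g z) / (z - ζ) dx dy`. -/
noncomputable def cauchyTransform (G : Set ℂ) (g : ℂ → ℂ) (ζ : ℂ) : ℂ :=
  (1 / Real.pi : ℂ) * ∫ z in G, (starRingEnd ℂ) (g z) / (z - ζ) ∂volume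

/-! ### Continuous logarithms -/

theorem exists_continuous_log {A : Type*} [TopologicalSpace A] [SimplyConnectedSpace A]
    [LocallyPathConnectedSpace A] {φ : A → ℂ} (hc : Continuous φ) (h0 : ∀ a, φ a ≠ 0) :
    ∃ Λ : A → ℂ, Continuous Λ ∧ ∀ a, Complex.exp (Λ a) = φ a := by
  obtain ⟨a₀⟩ : Nonempty A := inferInstance
  obtain ⟨F, ⟨-, hF⟩, -⟩ := isCoveringMapOn_exp.existsUnique_continuousMap_lifts
    ⟨φ, hc⟩ (exp_log (h0 a₀)) (fun a => h0 a)
  exact ⟨F, F.continuous, fun a => congrFun hF a⟩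

theorem IsPreconnected.eq_of_exp_eq {X : Type*} [TopologicalSpace X] {s : Set X}
    (hs : IsPreconnected s) {f : X → ℂ} (hf : ContinuousOn f s)
    (h : ∀ x ∈ s, ∀ y ∈ s, Complex.exp (f x) = Complex.exp (f y)) {x y : X} (hx : x ∈ s)
    (hy : y ∈ s) : f x = f y := by
  have hd : IsDiscrete ((AddSubgroup.zmultiples (2 * Real.pi * I) : AddSubgroup ℂ) : Set ℂ) :=
    ⟨NormedSpace.discreteTopology_zmultiples (2 * Real.pi * I)⟩
  have hm : MapsTo (fun z => f z - f y) s
      ((AddSubgroup.zmultiples (2 * Real.pi * I) : AddSubgroup ℂ) : Set ℂ) := by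
    intro z hz
    obtain ⟨n, hn⟩ := Complex.exp_eq_exp_iff_exists_int.1 (h z hz y hy)
    refine AddSubgroup.mem_zmultiples_iff.2 ⟨n, ?_⟩
    simp [hn]
  have := hs.constant_of_mapsTo hd (hf.sub continuousOn_const) hm hx hy
  simpa [sub_eq_zero] using this

/-- A nonzero power of `z - z₀` has no continuous logarithm on a circle centred at `z₀`. -/
theorem not_exists_log_pow_sphere {z₀ : ℂ} {R : ℝ} (hR : 0 < R) {l : ℕ} (hl : l ≠ 0)
    {Λ : ℂ → ℂ} (hc : ContinuousOn Λ (sphere z₀ R))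
    (he : ∀ z ∈ sphere z₀ R, Complex.exp (Λ z) = (z - z₀) ^ l) : False := by
  let p : ℝ → ℂ := fun t => z₀ + R * Complex.exp (t * I)
  have hp : ∀ t, p t ∈ sphere z₀ R := fun t => by
    simp [p, abs_of_pos hR, Complex.norm_exp_ofReal_mul_I]
  have hpc : Continuous p := by fun_prop
  let g : ℝ → ℂ := fun t => Λ (p t) - l * (t * I)
  have hg : Continuous g := by
    refine Continuous.sub ?_ (by fun_prop)
    exact hc.comp_continuous hpc hp
  have hge : ∀ t, Complex.exp (g t) = (R : ℂ) ^ l := fun t => by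
    have h1 : Complex.exp (t * I) ≠ 0 := Complex.exp_ne_zero _
    simp only [g]
    rw [Complex.exp_sub, he _ (hp t), Complex.exp_nat_mul]
    simp only [p, add_sub_cancel_left, mul_pow]
    field_simp
  have h := isPreconnected_univ.eq_of_exp_eq hg.continuousOn
    (fun x _ y _ => (hge x).trans (hge y).symm) (mem_univ (2 * Real.pi)) (mem_univ 0)
  have hpp : p (2 * Real.pi) = p 0 := by simp [p]
  simp only [g, hpp] at h
  have : (l : ℂ) * (2 * Real.pi * I) = 0 := by
    have := h; push_cast at this; linear_combination -this
  simp [hl, Real.pi_ne_zero] at this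

/-- The extension argument behind the Jordan curve theorem. -/
theorem not_exists_log_frontier {U : Set ℂ} (hUb : IsBounded U) {z₀ : ℂ}
    (hz₀ : z₀ ∈ U) {l : ℕ} (hl : l ≠ 0) {ψ : ℂ → ℂ} (hψ : ContinuousOn ψ (closure U))
    (hψ0 : ∀ z ∈ closure U, ψ z ≠ 0) {L : ℂ → ℂ} (hL : ContinuousOn L (frontier U))
    (h : ∀ z ∈ frontier U, (z - z₀) ^ l = Complex.exp (L z) * ψ z) : False := by
  classical
  obtain ⟨L', hL'⟩ := ContinuousMap.exists_restrict_eq isClosed_frontier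
    (⟨(frontier U).domRestrict L, continuousOn_iff_continuous_domRestrict.1 hL⟩ : C(frontier U, ℂ))
  have hLL : ∀ z ∈ frontier U, L' z = L z := fun z hz => by
    have := DFunLike.congr_fun hL' ⟨z, hz⟩
    simpa using this
  let φ : ℂ → ℂ := (closure U).piecewise (fun z => Complex.exp (L' z) * ψ z) (fun z => (z - z₀) ^ l)
  have hφc : Continuous φ := by
    apply continuous_piecewise
    · intro a ha
      have ha' : a ∈ frontier U := frontier_closure_subset ha
      rw [h a ha', hLL a ha']
    · rw [closure_closure]
      exact (Complex.continuous_exp.comp L'.continuous).continuousOn.mul hψ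
    · fun_prop
  have hφ0 : ∀ z, φ z ≠ 0 := by
    intro z
    by_cases hz : z ∈ closure U
    · simp only [φ, piecewise_eq_of_mem _ _ _ hz]
      exact mul_ne_zero (Complex.exp_ne_zero _) (hψ0 z hz)
    · simp only [φ, piecewise_eq_of_notMem _ _ _ hz]
      refine pow_ne_zero _ (sub_ne_zero.2 ?_)
      rintro rfl
      exact hz (subset_closure hz₀)
  obtain ⟨Λ, hΛ, hΛe⟩ := exists_continuous_log hφc hφ0
  obtain ⟨R, hR, hUR⟩ := hUb.closure.subset_ball_lt 0 z₀
  refine not_exists_log_pow_sphere hR hl hΛ.continuousOn (z₀ := z₀) fun z hz => ?_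
  rw [hΛe]
  refine piecewise_eq_of_notMem _ _ _ fun hz' => ?_
  have h1 := mem_ball.1 (hUR hz')
  have h2 := mem_sphere.1 hz
  linarith

/-! ### Jordan curves -/

theorem exists_continuousOn_leftInverse {f : ℂ → ℂ} (hc : ContinuousOn f (sphere 0 1))
    (hi : InjOn f (sphere 0 1)) :
    ∃ u : ℂ → ℂ, ContinuousOn u (f '' sphere 0 1) ∧ (∀ z ∈ sphere (0 : ℂ) 1, u (f z) = z) := by
  refine ⟨Function.invFunOn f (sphere 0 1), ?_, fun z hz => hi.leftInvOn_invFunOn hz⟩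
  rw [continuousOn_iff_isClosed]
  intro t ht
  refine ⟨f '' (t ∩ sphere 0 1), ?_, ?_⟩
  · have : IsCompact (t ∩ sphere (0 : ℂ) 1) := (isCompact_sphere 0 1).inter_left ht
    exact (this.image_of_continuousOn (hc.mono inter_subset_right)).isClosed
  · ext z
    constructor
    · rintro ⟨hz, w, hw, rfl⟩
      refine ⟨⟨w, ⟨?_, hw⟩, rfl⟩, ⟨w, hw, rfl⟩⟩
      simpa [hi.leftInvOn_invFunOn hw] using hz
    · rintro ⟨⟨w, ⟨hwt, hw⟩, rfl⟩, hz⟩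
      exact ⟨by simpa [hi.leftInvOn_invFunOn hw] using hwt, hz⟩

theorem exp_arg_mul_I {u : ℂ} (hu : u ∈ sphere (0 : ℂ) 1) : Complex.exp (arg u * I) = u := by
  have h := norm_mul_exp_arg_mul_I u
  have h1 : ‖u‖ = 1 := by simpa using hu
  simpa [h1] using h

theorem exp_mul_I_mem_sphere (t : ℝ) : Complex.exp (t * I) ∈ sphere (0 : ℂ) 1 := by
  simp [Complex.norm_exp_ofReal_mul_I]

theorem eq_neg_one_of_notMem_slitPlane {v : ℂ} (hv : ‖v‖ = 1) (h : v ∉ slitPlane) : v = -1 := by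
  rw [mem_slitPlane_iff, not_or, not_lt, not_not] at h
  have h1 : v.re * v.re + v.im * v.im = 1 := by
    rw [← normSq_apply, normSq_eq_norm_sq, hv, one_pow]
  rw [h.2] at h1
  have h2 : v.re = -1 := by nlinarith [h.1]
  apply Complex.ext <;> simp [h2, h.2]

/-- A nonvanishing function on a Jordan curve minus one point has a continuous logarithm. -/
theorem exists_log_jordan_diff_singleton {J : Set ℂ} (hJ : IsJordanCurve J) {a : ℂ} (ha : a ∈ J)
    {φ : ℂ → ℂ} (hφ : ContinuousOn φ J) (h0 : ∀ z ∈ J, φ z ≠ 0) :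
    ∃ L : ℂ → ℂ, ContinuousOn L (J \ {a}) ∧ ∀ z ∈ J \ {a}, Complex.exp (L z) = φ z := by
  obtain ⟨f, hf, hfi, rfl⟩ := hJ
  obtain ⟨u, hu, huf⟩ := exists_continuousOn_leftInverse hf hfi
  obtain ⟨u₀, hu₀, rfl⟩ := ha
  have hn : ‖u₀‖ = 1 := by simpa using hu₀
  have hu₀0 : u₀ ≠ 0 := by rintro rfl; simp at hn
  have hp : ∀ t : ℝ, -u₀ * Complex.exp (t * I) ∈ sphere (0 : ℂ) 1 := fun t => by
    simp [hn, Complex.norm_exp_ofReal_mul_I]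
  have hc : Continuous fun t : ℝ => φ (f (-u₀ * Complex.exp (t * I))) := by
    refine hφ.comp_continuous (hf.comp_continuous (by fun_prop) hp) fun t => ⟨_, hp t, rfl⟩
  obtain ⟨Λ, hΛ, hΛe⟩ := exists_continuous_log hc fun t => h0 _ ⟨_, hp t, rfl⟩
  refine ⟨fun z => Λ (arg (-(u z / u₀))), ?_, ?_⟩
  · refine hΛ.comp_continuousOn ?_
    intro z hz
    obtain ⟨⟨v, hv, rfl⟩, hva⟩ := hz
    have hne : v ≠ u₀ := fun h => hva (by simp [h])
    have hsl : -(u (f v) / u₀) ∈ slitPlane := by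
      rw [huf v hv]
      by_contra hle
      have h1 := eq_neg_one_of_notMem_slitPlane
        (by have : ‖v‖ = 1 := by simpa using hv
            simp [this, hn]) hle
      have h3 : v / u₀ = 1 := by simpa using h1
      exact hne ((div_eq_one_iff_eq hu₀0).1 h3)
    have h4 : ContinuousWithinAt (fun z => -(u z / u₀)) (f '' sphere 0 1 \ {f u₀}) (f v) :=
      (((hu _ ⟨v, hv, rfl⟩).mono sdiff_subset).div_const u₀).neg
    exact ContinuousAt.comp_continuousWithinAt (f := fun z => -(u z / u₀))
      (continuousAt_arg hsl) h4
  · rintro z ⟨⟨v, hv, rfl⟩, hva⟩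
    have hv1 : ‖v‖ = 1 := by simpa using hv
    simp only [hΛe, huf v hv]
    rw [exp_arg_mul_I (by simp [hv1, hn])]
    congr 2
    field_simp

/-- A nonvanishing function on a Jordan curve is a power of the inverse parametrisation times
an exponential. -/
theorem exists_zpow_log_jordan {f : ℂ → ℂ} (hf : ContinuousOn f (sphere 0 1))
    {u : ℂ → ℂ} (hu : ContinuousOn u (f '' sphere 0 1))
    (huf : ∀ z ∈ sphere (0 : ℂ) 1, u (f z) = z)
    {φ : ℂ → ℂ} (hφ : ContinuousOn φ (f '' sphere 0 1)) (h0 : ∀ z ∈ f '' sphere 0 1, φ z ≠ 0) :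
    ∃ (k : ℤ) (L : ℂ → ℂ), ContinuousOn L (f '' sphere 0 1) ∧
      ∀ z ∈ f '' sphere 0 1, φ z = u z ^ k * Complex.exp (L z) := by
  have hc : Continuous fun t : ℝ => φ (f (Complex.exp (t * I))) := by
    refine hφ.comp_continuous (hf.comp_continuous (by fun_prop) exp_mul_I_mem_sphere)
      fun t => ⟨_, exp_mul_I_mem_sphere t, rfl⟩
  obtain ⟨Λ, hΛ, hΛe⟩ := exists_continuous_log hc
    fun t => h0 _ ⟨_, exp_mul_I_mem_sphere t, rfl⟩
  have hper : ∀ t : ℝ, Complex.exp (((t + 2 * Real.pi : ℝ) : ℂ) * I) = Complex.exp (t * I) := by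
    intro t
    push_cast
    rw [add_mul, Complex.exp_add, Complex.exp_two_pi_mul_I, mul_one]
  obtain ⟨k, hk⟩ : ∃ k : ℤ, Λ (0 + 2 * Real.pi) = Λ 0 + k * (2 * Real.pi * I) :=
    Complex.exp_eq_exp_iff_exists_int.1 (by rw [hΛe, hΛe, hper])
  have hk' : ∀ t, Λ (t + 2 * Real.pi) = Λ t + k * (2 * Real.pi * I) := by
    intro t
    have h := isPreconnected_univ.eq_of_exp_eq
      (f := fun t => Λ (t + 2 * Real.pi) - Λ t) (by fun_prop)
      (fun x _ y _ => by
        simp only [Complex.exp_sub, hΛe, hper]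
        rw [div_self, div_self] <;> exact h0 _ ⟨_, exp_mul_I_mem_sphere _, rfl⟩)
      (mem_univ t) (mem_univ 0)
    simp only [hk] at h
    linear_combination h
  let P : ℝ → ℂ := fun t => Λ t - k * (t * I)
  have hP : Continuous P := by fun_prop
  have hPper : Function.Periodic P (2 * Real.pi) := fun t => by
    simp only [P, hk']; push_cast; ring
  have key : ∀ v ∈ sphere (0 : ℂ) 1, P (arg v) = P (arg (-v) + Real.pi) := by
    intro v hv
    have h1 : Complex.exp (((arg (-v) + Real.pi : ℝ) : ℂ) * I) = Complex.exp (arg v * I) := by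
      push_cast
      rw [add_mul, Complex.exp_add, exp_arg_mul_I hv, exp_arg_mul_I (by simpa using hv),
        Complex.exp_pi_mul_I]
      ring
    obtain ⟨n, hn⟩ := Complex.exp_eq_exp_iff_exists_int.1 h1
    have h2 : arg (-v) + Real.pi = arg v + n * (2 * Real.pi) := by
      have : (((arg (-v) + Real.pi : ℝ) : ℂ) - (arg v + n * (2 * Real.pi))) * I = 0 := by
        linear_combination hn
      have h3 := (mul_eq_zero.1 this).resolve_right I_ne_zero
      have h4 := sub_eq_zero.1 h3
      exact_mod_cast h4
    rw [h2]
    exact (hPper.int_mul n _).symm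
  have hS : ContinuousOn (fun v => P (arg v)) (sphere (0 : ℂ) 1) := by
    intro v hv
    have hv1 : ‖v‖ = 1 := by simpa using hv
    by_cases hs : v ∈ slitPlane
    · exact (hP.continuousAt.comp (continuousAt_arg hs)).continuousWithinAt
    · have hs' : -v ∈ slitPlane := by
        rw [eq_neg_one_of_notMem_slitPlane hv1 hs]
        simp
      have hcont : ContinuousAt (fun v => P (arg (-v) + Real.pi)) v :=
        hP.continuousAt.comp (((continuousAt_arg hs').comp continuousAt_neg).add continuousAt_const)
      exact hcont.continuousWithinAt.congr (fun w hw => key w hw) (key v hv)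
  refine ⟨k, fun z => P (arg (u z)), ?_, ?_⟩
  · refine hS.comp hu ?_
    rintro _ ⟨v, hv, rfl⟩
    rwa [huf v hv]
  · rintro _ ⟨v, hv, rfl⟩
    simp only [huf v hv, P, Complex.exp_sub, hΛe, exp_arg_mul_I hv]
    rw [Complex.exp_int_mul, exp_arg_mul_I hv]
    have : v ^ k ≠ 0 := zpow_ne_zero _ (by rintro rfl; simp at hv)
    field_simp

/-- Two points split a Jordan curve into two arcs. -/
theorem IsJordanCurve.exists_arcs {J : Set ℂ} (hJ : IsJordanCurve J) {a b : ℂ} (ha : a ∈ J)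
    (hb : b ∈ J) (hab : a ≠ b) :
    ∃ J₁ J₂ : Set ℂ, IsClosed J₁ ∧ IsClosed J₂ ∧ IsPreconnected J₁ ∧ IsPreconnected J₂ ∧
      J₁ ∪ J₂ = J ∧ J₁ ∩ J₂ ⊆ {a, b} ∧ a ∈ J₁ ∧ b ∈ J₁ ∧ a ∈ J₂ ∧ b ∈ J₂ := by
  obtain ⟨f, hf, hfi, rfl⟩ := hJ
  obtain ⟨u, hu, rfl⟩ := ha
  obtain ⟨v, hv, rfl⟩ := hb
  wlog huv : arg u < arg v generalizing u v
  · have hne : arg u ≠ arg v := by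
      intro h
      apply hab
      rw [← exp_arg_mul_I hu, ← exp_arg_mul_I hv, h]
    obtain ⟨J₁, J₂, h1, h2, h3, h4, h5, h6, h7, h8, h9, h10⟩ :=
      this v hv u hu hab.symm (lt_of_le_of_ne (not_lt.1 huv) hne.symm)
    exact ⟨J₁, J₂, h1, h2, h3, h4, h5, by rwa [pair_comm], h8, h7, h10, h9⟩
  let p : ℝ → ℂ := fun t => f (Complex.exp (t * I))
  have hp : Continuous p := hf.comp_continuous (by fun_prop) exp_mul_I_mem_sphere
  have hpa : p (arg u) = f u := by simp only [p, exp_arg_mul_I hu]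
  have hpb : p (arg v) = f v := by simp only [p, exp_arg_mul_I hv]
  have hpa' : p (arg u + 2 * Real.pi) = f u := by
    simp only [p]
    push_cast
    rw [add_mul, Complex.exp_add, Complex.exp_two_pi_mul_I, mul_one, exp_arg_mul_I hu]
  have hlt : arg v < arg u + 2 * Real.pi := by
    linarith [arg_le_pi v, neg_pi_lt_arg u]
  refine ⟨p '' Icc (arg u) (arg v), p '' Icc (arg v) (arg u + 2 * Real.pi),
    (isCompact_Icc.image hp).isClosed, (isCompact_Icc.image hp).isClosed,
    isPreconnected_Icc.image _ hp.continuousOn, isPreconnected_Icc.image _ hp.continuousOn,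
    ?_, ?_, ⟨_, left_mem_Icc.2 huv.le, hpa⟩, ⟨_, right_mem_Icc.2 huv.le, hpb⟩,
    ⟨_, right_mem_Icc.2 hlt.le, hpa'⟩, ⟨_, left_mem_Icc.2 hlt.le, hpb⟩⟩
  · rw [← image_union, Icc_union_Icc_eq_Icc huv.le hlt.le]
    apply Subset.antisymm
    · rintro _ ⟨t, -, rfl⟩
      exact ⟨_, exp_mul_I_mem_sphere t, rfl⟩
    · rintro _ ⟨w, hw, rfl⟩
      by_cases h : arg u ≤ arg w
      · exact ⟨arg w, ⟨h, by linarith [arg_le_pi w, neg_pi_lt_arg u]⟩,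
          by simp only [p, exp_arg_mul_I hw]⟩
      · refine ⟨arg w + 2 * Real.pi, ⟨by linarith [arg_le_pi u, neg_pi_lt_arg w], by linarith⟩, ?_⟩
        simp only [p]
        push_cast
        rw [add_mul, Complex.exp_add, Complex.exp_two_pi_mul_I, mul_one, exp_arg_mul_I hw]
  · rintro z ⟨⟨s, hs, rfl⟩, ⟨t, ht, hst⟩⟩
    have h1 := hfi (exp_mul_I_mem_sphere t) (exp_mul_I_mem_sphere s) hst
    obtain ⟨n, hn⟩ := Complex.exp_eq_exp_iff_exists_int.1 h1
    have h2 : t = s + n * (2 * Real.pi) := by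
      have : ((t : ℂ) - (s + n * (2 * Real.pi))) * I = 0 := by linear_combination hn
      have h4 := sub_eq_zero.1 ((mul_eq_zero.1 this).resolve_right I_ne_zero)
      exact_mod_cast h4
    have hpi := Real.pi_pos
    have hn0 : 0 ≤ n := by
      by_contra hneg
      have : (n : ℝ) ≤ -1 := by exact_mod_cast (by omega : n ≤ -1)
      nlinarith [hs.1, hs.2, ht.1, ht.2]
    have hn1 : n ≤ 1 := by
      by_contra hneg
      have : (2 : ℝ) ≤ n := by exact_mod_cast (by omega : 2 ≤ n)
      nlinarith [hs.1, hs.2, ht.1, ht.2]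
    obtain rfl | rfl : n = 0 ∨ n = 1 := by omega
    · right
      have : s = arg v := by
        simp only [Int.cast_zero, zero_mul, add_zero] at h2
        linarith [hs.2, ht.1]
      rw [this, hpb]; rfl
    · left
      have : s = arg u := by
        simp only [Int.cast_one, one_mul] at h2
        linarith [hs.1, ht.2]
      rw [this, hpa]

theorem IsJordanCurve.isCompact {J : Set ℂ} (hJ : IsJordanCurve J) : IsCompact J := by
  obtain ⟨f, hc, -, rfl⟩ := hJ
  exact (isCompact_sphere _ _).image_of_continuousOn hc

theorem IsJordanCurve.nonempty {J : Set ℂ} (hJ : IsJordanCurve J) : J.Nonempty := by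
  obtain ⟨f, -, -, rfl⟩ := hJ
  exact ((NormedSpace.sphere_nonempty (x := (0 : ℂ))).2 zero_le_one).image f

theorem frontier_connectedComponentIn_subset {X : Type*} [TopologicalSpace X]
    [LocallyConnectedSpace X] {F : Set X} (hF : IsOpen F) (x : X) :
    frontier (connectedComponentIn F x) ⊆ Fᶜ := by
  intro y hy hyF
  have ho := (hF.connectedComponentIn (x := y))
  obtain ⟨z, hz, hz'⟩ := mem_closure_iff.1 hy.1 _ ho (mem_connectedComponentIn hyF)
  have h1 := connectedComponentIn_eq hz
  have h2 := connectedComponentIn_eq hz'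
  have : y ∈ connectedComponentIn F x := by
    rw [h2, ← h1]; exact mem_connectedComponentIn hyF
  rw [frontier, (hF.connectedComponentIn (x := x)).interior_eq] at hy
  exact hy.2 this

theorem isPreconnected_norm_gt {R : ℝ} (hR : 0 < R) : IsPreconnected {w : ℂ | R < ‖w‖} := by
  have : {w : ℂ | R < ‖w‖} = Complex.exp '' {z : ℂ | Real.log R < z.re} := by
    ext w
    simp only [mem_ofPred_eq, mem_image]
    constructor
    · intro h
      have hw : w ≠ 0 := by rintro rfl; simp at h; linarith
      refine ⟨Complex.log w, ?_, Complex.exp_log hw⟩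
      rw [Complex.log_re]
      exact Real.log_lt_log hR h
    · rintro ⟨z, hz, rfl⟩
      rw [Complex.norm_exp]
      exact (Real.log_lt_iff_lt_exp hR).1 hz
  rw [this]
  refine IsPreconnected.image ?_ _ Complex.continuous_exp.continuousOn
  exact (convex_halfSpace_re_gt _).isPreconnected

theorem IsJordanCurve.not_frontier_subset_diff {J : Set ℂ} (hJ : IsJordanCurve J) {a : ℂ}
    (ha : a ∈ J) {z₀ : ℂ} (hz₀ : z₀ ∉ J) {U : Set ℂ} (hU : IsBounded U) (hzU : z₀ ∈ U) :
    ¬ frontier U ⊆ J \ {a} := by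
  intro hf
  obtain ⟨L, hL, hL'⟩ := exists_log_jordan_diff_singleton hJ ha (φ := fun z => z - z₀)
    (by fun_prop) (fun z hz => sub_ne_zero.2 (by rintro rfl; exact hz₀ hz))
  refine not_exists_log_frontier hU hzU one_ne_zero (ψ := fun _ => 1) continuousOn_const
    (by simp) (hL.mono hf) (fun z hz => ?_)
  rw [hL' z (hf hz)]; simp

section JordanDomain
variable {J : Set ℂ} {z₀ : ℂ}

theorem IsJordanCurve.isOpen_connectedComponentIn (hJ : IsJordanCurve J) :
    IsOpen (connectedComponentIn Jᶜ z₀) :=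
  hJ.isCompact.isClosed.isOpen_compl.connectedComponentIn

theorem IsJordanCurve.frontier_component_subset (hJ : IsJordanCurve J) :
    frontier (connectedComponentIn Jᶜ z₀) ⊆ J := by
  simpa using frontier_connectedComponentIn_subset hJ.isCompact.isClosed.isOpen_compl z₀

theorem IsJordanCurve.frontier_component (hJ : IsJordanCurve J) (hz₀ : z₀ ∈ Jᶜ)
    (hb : IsBounded (connectedComponentIn Jᶜ z₀)) :
    frontier (connectedComponentIn Jᶜ z₀) = J := by
  refine hJ.frontier_component_subset.antisymm fun a ha => ?_
  by_contra h
  exact hJ.not_frontier_subset_diff ha hz₀ hb (mem_connectedComponentIn hz₀)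
    fun z hz => ⟨hJ.frontier_component_subset hz, by rintro rfl; exact h hz⟩

theorem IsJordanCurve.closure_component (hJ : IsJordanCurve J) (hz₀ : z₀ ∈ Jᶜ)
    (hb : IsBounded (connectedComponentIn Jᶜ z₀)) :
    closure (connectedComponentIn Jᶜ z₀) = connectedComponentIn Jᶜ z₀ ∪ J := by
  rw [closure_eq_self_union_frontier, hJ.frontier_component hz₀ hb]

theorem IsJordanCurve.subset_closure_compl (hJ : IsJordanCurve J) (hz₀ : z₀ ∈ Jᶜ)
    (hb : IsBounded (connectedComponentIn Jᶜ z₀)) :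
    J ⊆ closure (closure (connectedComponentIn Jᶜ z₀))ᶜ := by
  intro a ha
  rw [closure_compl]
  intro h
  refine hJ.not_frontier_subset_diff ha hz₀ (hb.closure.subset interior_subset)
    (interior_maximal subset_closure hJ.isOpen_connectedComponentIn
      (mem_connectedComponentIn hz₀)) fun z hz => ⟨?_, ?_⟩
  · exact hJ.frontier_component_subset (frontier_closure_subset (frontier_interior_subset hz))
  · rintro rfl
    rw [frontier, isOpen_interior.interior_eq] at hz
    exact hz.2 h

theorem IsJordanCurve.eq_of_isBounded_component (hJ : IsJordanCurve J) (hz₀ : z₀ ∈ Jᶜ)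
    (hb : IsBounded (connectedComponentIn Jᶜ z₀)) {w : ℂ} (hw : w ∈ Jᶜ)
    (hwb : IsBounded (connectedComponentIn Jᶜ w)) : w ∈ connectedComponentIn Jᶜ z₀ := by
  by_contra hwG
  have hwK : w ∉ closure (connectedComponentIn Jᶜ z₀) := by
    rw [hJ.closure_component hz₀ hb]; exact fun h => h.elim hwG hw
  have hG := hJ.frontier_component_subset (z₀ := z₀)
  have hC := hJ.frontier_component_subset (z₀ := w)
  obtain ⟨f, hf, hinj, rfl⟩ := id hJ
  obtain ⟨u, hu, huf⟩ := exists_continuousOn_leftInverse hf hinj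
  obtain ⟨k, L₁, hL₁, h₁⟩ := exists_zpow_log_jordan hf hu huf (φ := fun z => z - z₀)
    (by fun_prop) (fun z hz => sub_ne_zero.2 (by rintro rfl; exact hz₀ hz))
  obtain ⟨l, L₂, hL₂, h₂⟩ := exists_zpow_log_jordan hf hu huf (φ := fun z => z - w)
    (by fun_prop) (fun z hz => sub_ne_zero.2 (by rintro rfl; exact hw hz))
  have hun : ∀ z ∈ f '' sphere 0 1, u z ≠ 0 := by
    rintro _ ⟨z, hz, rfl⟩ h0
    rw [huf z hz] at h0
    simp [h0] at hz
  have key : ∀ z ∈ f '' sphere 0 1,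
      (z - z₀) ^ l = Complex.exp (l * L₁ z - k * L₂ z) * (z - w) ^ k := by
    intro z hz
    have e1 : z - z₀ = _ := h₁ z hz
    have e2 : z - w = _ := h₂ z hz
    rw [e1, e2, mul_zpow, mul_zpow, ← zpow_mul, ← zpow_mul, mul_comm l k, Complex.exp_sub,
      Complex.exp_int_mul, Complex.exp_int_mul]
    have : Complex.exp (L₂ z) ^ k ≠ 0 := zpow_ne_zero _ (Complex.exp_ne_zero _)
    field_simp
  have hne : ∀ z ∈ closure (connectedComponentIn (f '' sphere 0 1)ᶜ z₀), z - w ≠ 0 :=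
    fun z hz => sub_ne_zero.2 (by rintro rfl; exact hwK hz)
  have hcont : ∀ m : ℤ, ContinuousOn (fun z => (z - w) ^ m)
      (closure (connectedComponentIn (f '' sphere 0 1)ᶜ z₀)) := fun m =>
    ContinuousOn.zpow₀ (by fun_prop) m fun z hz => Or.inl (hne z hz)
  obtain ⟨n, rfl | rfl⟩ := l.eq_nat_or_neg
  · rcases eq_or_ne n 0 with rfl | hn
    · refine not_exists_log_frontier hwb (mem_connectedComponentIn hw) one_ne_zero
        (ψ := fun _ => 1) continuousOn_const (by simp) (hL₂.mono hC) (fun z hz => ?_)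
      simpa using h₂ z (hC hz)
    · refine not_exists_log_frontier hb (mem_connectedComponentIn hz₀) hn (hcont k)
        (fun z hz => zpow_ne_zero _ (hne z hz))
        (L := fun z => (n : ℤ) * L₁ z - k * L₂ z) (ContinuousOn.mono (by fun_prop) hG)
        (fun z hz => ?_)
      simpa using key z (hG hz)
  · rcases eq_or_ne n 0 with rfl | hn
    · refine not_exists_log_frontier hwb (mem_connectedComponentIn hw) one_ne_zero
        (ψ := fun _ => 1) continuousOn_const (by simp) (hL₂.mono hC) (fun z hz => ?_)
      simpa using h₂ z (hC hz)
    · refine not_exists_log_frontier hb (mem_connectedComponentIn hz₀) hn (hcont (-k))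
        (fun z hz => zpow_ne_zero _ (hne z hz))
        (L := fun z => -((-(n : ℤ) : ℤ) * L₁ z - k * L₂ z)) (ContinuousOn.mono (by fun_prop) hG)
        (fun z hz => ?_)
      have := congrArg (·⁻¹) (key z (hG hz))
      simp only [zpow_neg, inv_inv, zpow_natCast, mul_inv, ← Complex.exp_neg] at this
      rw [this, zpow_neg]

theorem IsJordanCurve.isPreconnected_compl_closure (hJ : IsJordanCurve J) (hz₀ : z₀ ∈ Jᶜ)
    (hb : IsBounded (connectedComponentIn Jᶜ z₀)) :
    IsPreconnected (closure (connectedComponentIn Jᶜ z₀))ᶜ := by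
  obtain ⟨R, hR, hJR⟩ := hJ.isCompact.isBounded.exists_pos_norm_le
  have hE : {w : ℂ | R < ‖w‖} ⊆ Jᶜ := fun w hw hwJ => absurd (hJR w hwJ) (not_le.2 hw)
  have hp : ((R + 1 : ℝ) : ℂ) ∈ {w : ℂ | R < ‖w‖} := by
    simp only [mem_ofPred_eq, Complex.norm_real, Real.norm_eq_abs]
    rw [abs_of_pos] <;> linarith
  set p : ℂ := ((R + 1 : ℝ) : ℂ)
  have hEp : {w : ℂ | R < ‖w‖} ⊆ connectedComponentIn Jᶜ p :=
    (isPreconnected_norm_gt hR).subset_connectedComponentIn hp hE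
  have : (closure (connectedComponentIn Jᶜ z₀))ᶜ = connectedComponentIn Jᶜ p := by
    rw [hJ.closure_component hz₀ hb]
    ext w
    rw [compl_union]
    constructor
    · rintro ⟨h1, h2⟩
      have : ¬ IsBounded (connectedComponentIn Jᶜ w) :=
        fun h => h1 (hJ.eq_of_isBounded_component hz₀ hb h2 h)
      have : ∃ q ∈ connectedComponentIn Jᶜ w, R < ‖q‖ := by
        by_contra! h
        exact this (isBounded_iff_forall_norm_le.2 ⟨R, h⟩)
      obtain ⟨q, hq, hqR⟩ := this
      rw [connectedComponentIn_eq (hEp hqR), ← connectedComponentIn_eq hq]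
      exact mem_connectedComponentIn h2
    · intro h
      refine ⟨fun h' => ?_, connectedComponentIn_subset _ _ h⟩
      have := hEp
      rw [connectedComponentIn_eq h, ← connectedComponentIn_eq h'] at this
      obtain ⟨C, hC⟩ := isBounded_iff_forall_norm_le.1 (hb.subset this)
      have h3 := hC ((max C R + 1 : ℝ) : ℂ) (by
        simp only [mem_ofPred_eq, Complex.norm_real, Real.norm_eq_abs]
        exact lt_of_lt_of_le (by linarith [le_max_right C R]) (le_abs_self _))
      rw [Complex.norm_real, Real.norm_eq_abs] at h3
      linarith [le_abs_self (max C R + 1), le_max_left C R]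
  rw [this]
  exact isPreconnected_connectedComponentIn

theorem IsJordanCurve.exists_log_compl_closure (hJ : IsJordanCurve J) (hz₀ : z₀ ∈ Jᶜ)
    (hb : IsBounded (connectedComponentIn Jᶜ z₀)) {w : ℂ}
    (hw : w ∉ closure (connectedComponentIn Jᶜ z₀)) :
    ∃ L : ℂ → ℂ, ContinuousOn L (closure (connectedComponentIn Jᶜ z₀)) ∧
      ∀ z ∈ closure (connectedComponentIn Jᶜ z₀), Complex.exp (L z) = z - w := by
  set K := closure (connectedComponentIn Jᶜ z₀) with hK
  have hKb : IsBounded K := hb.closure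
  obtain ⟨R, hR, hKR⟩ := hKb.exists_pos_norm_le
  let Q : ℂ → Prop := fun w => ∃ L : ℂ → ℂ, ContinuousOn L K ∧ ∀ z ∈ K, Complex.exp (L z) = z - w
  have step : ∀ w w' : ℂ, (∀ z ∈ K, ‖w - w'‖ < ‖z - w‖) → Q w → Q w' := by
    rintro w w' h ⟨L, hL, hL'⟩
    have hre : ∀ z ∈ K, 1 + (w - w') / (z - w) ∈ slitPlane := by
      intro z hz
      left
      have h1 : ‖(w - w') / (z - w)‖ < 1 := by
        rw [norm_div, div_lt_one ((norm_nonneg _).trans_lt (h z hz))]; exact h z hz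
      have := Complex.abs_re_le_norm ((w - w') / (z - w))
      have := neg_abs_le ((w - w') / (z - w)).re
      simp only [add_re, one_re]; linarith
    have hne : ∀ z ∈ K, z - w ≠ 0 := fun z hz => norm_pos_iff.1 ((norm_nonneg _).trans_lt (h z hz))
    refine ⟨fun z => L z + Complex.log (1 + (w - w') / (z - w)), ?_, fun z hz => ?_⟩
    · refine hL.add (ContinuousOn.clog ?_ hre)
      exact continuousOn_const.add (continuousOn_const.div (by fun_prop) hne)
    · rw [Complex.exp_add, Complex.exp_log (slitPlane_ne_zero (hre z hz)), hL' z hz]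
      have := hne z hz
      field_simp
      ring
  have hpre := hJ.isPreconnected_compl_closure hz₀ hb
  have hfar : ((R + 1 : ℝ) : ℂ) ∉ K := by
    intro h
    have := hKR _ h
    rw [Complex.norm_real, Real.norm_eq_abs] at this
    linarith [le_abs_self (R + 1)]
  have hQfar : Q ((R + 1 : ℝ) : ℂ) := by
    set p : ℂ := ((R + 1 : ℝ) : ℂ)
    have hp : p ≠ 0 := by
      intro h
      have : (R + 1 : ℝ) = 0 := Complex.ofReal_eq_zero.1 h
      linarith
    have hpn : ‖p‖ = R + 1 := by
      rw [Complex.norm_real, Real.norm_eq_abs, abs_of_pos]; linarith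
    have hre : ∀ z ∈ K, 1 - z / p ∈ slitPlane := by
      intro z hz
      left
      have h1 : ‖z / p‖ < 1 := by
        rw [norm_div, hpn, div_lt_one (by linarith)]; linarith [hKR z hz]
      have := Complex.re_le_norm (z / p)
      simp only [sub_re, one_re]; linarith
    refine ⟨fun z => Complex.log (-p) + Complex.log (1 - z / p), ?_, fun z hz => ?_⟩
    · exact continuousOn_const.add (ContinuousOn.clog (by fun_prop) hre)
    · rw [Complex.exp_add, Complex.exp_log (neg_ne_zero.2 hp),
        Complex.exp_log (slitPlane_ne_zero (hre z hz))]
      field_simp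
      ring
  refine (hpre.induction₂ (fun x y => Q x ↔ Q y) (fun x hx => ?_) (fun x y z _ _ _ h h' => h.trans h')
    (fun x y _ _ h => h.symm) hfar hw).1 hQfar
  obtain ⟨ε, hε, hball⟩ := Metric.isOpen_iff.1 isClosed_closure.isOpen_compl x hx
  filter_upwards [mem_nhdsWithin_of_mem_nhds (ball_mem_nhds x (half_pos hε))] with y hy
  rw [mem_ball, dist_eq_norm] at hy
  have hd : ∀ z ∈ K, ε ≤ ‖z - x‖ := by
    intro z hz
    by_contra! h
    exact hball (by rwa [mem_ball, dist_eq_norm]) hz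
  constructor
  · exact step x y fun z hz => by rw [norm_sub_rev]; linarith [hd z hz]
  · refine step y x fun z hz => ?_
    have : ‖z - x‖ ≤ ‖z - y‖ + ‖y - x‖ := norm_sub_le_norm_sub_add_norm_sub _ _ _
    linarith [hd z hz]

end JordanDomain

/-- The topological and metric facts about a closed quasidisk `K` with boundary `J` used in
the construction of the extension. -/
structure IsClosedQuasidisk (J K : Set ℂ) (M : ℝ) : Prop where
  jordan : IsJordanCurve J
  one_le : 1 ≤ M
  arc : ∀ a ∈ J, ∀ b ∈ J, ∃ A : Set ℂ, A ⊆ J ∧ IsPreconnected A ∧ a ∈ A ∧ b ∈ A ∧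
      Metric.diam A ≤ M * dist a b
  isCompact : IsCompact K
  subset : J ⊆ K
  frontier_subset : frontier K ⊆ J
  exists_log : ∀ w ∉ K, ∃ L : ℂ → ℂ, ContinuousOn L K ∧ ∀ z ∈ K, Complex.exp (L z) = z - w
  dense : J ⊆ closure Kᶜ

theorem IsQuasicircle.exists_isClosedQuasidisk {J : Set ℂ} (hJ : IsQuasicircle J) {z₀ : ℂ}
    (hz₀ : z₀ ∈ Jᶜ) (hb : IsBounded (connectedComponentIn Jᶜ z₀)) :
    ∃ M, IsClosedQuasidisk J (closure (connectedComponentIn Jᶜ z₀)) M := by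
  obtain ⟨hJ, M, hM⟩ := hJ
  refine ⟨max M 1, hJ, le_max_right _ _, fun a ha b hb => ?_, hb.isCompact_closure, ?_, ?_,
    fun w hw => hJ.exists_log_compl_closure hz₀ hb hw, hJ.subset_closure_compl hz₀ hb⟩
  · obtain ⟨A, h1, h2, h3, h4, h5⟩ := hM a ha b hb
    exact ⟨A, h1, h2, h3, h4, h5.trans (by gcongr; exact le_max_left _ _)⟩
  · rw [hJ.closure_component hz₀ hb]; exact subset_union_right
  · exact frontier_closure_subset.trans hJ.frontier_component_subset

theorem re_one_add_pos {u : ℂ} (hu : ‖u‖ < 1) : 0 < (1 + u).re := by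
  have := Complex.abs_re_le_norm u
  have := neg_abs_le u.re
  simp only [add_re, one_re]; linarith

theorem abs_im_log_lt {u : ℂ} (hu : ‖u‖ < 1) : |(Complex.log (1 + u)).im| < Real.pi / 2 := by
  rw [Complex.log_im]
  exact Complex.abs_arg_lt_pi_div_two_iff.2 (Or.inl (re_one_add_pos hu))

theorem div_sub_eq_one_add {x j w : ℂ} (h : j - w ≠ 0) :
    (x - w) / (j - w) = 1 + (x - j) / (j - w) := by
  field_simp; ring

/-- The imaginary part of a logarithm of `z - w` varies by less than a quarter turn on a connected
set which is small compared with its distance to `w`. -/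
theorem abs_im_sub_lt_of_diam_lt {A : Set ℂ} (hA : IsPreconnected A) (hAb : IsBounded A)
    {L : ℂ → ℂ} (hL : ContinuousOn L A) {w : ℂ} (he : ∀ z ∈ A, Complex.exp (L z) = z - w)
    {j z : ℂ} (hj : j ∈ A) (hz : z ∈ A) (hd : diam A < ‖j - w‖) :
    |(L z - L j).im| < Real.pi / 2 := by
  have hjw : j - w ≠ 0 := norm_pos_iff.1 (diam_nonneg.trans_lt hd)
  have hcos : ∀ y ∈ A, 0 < Real.cos (L y - L j).im := by
    intro y hy
    have h1 : Complex.exp (L y - L j) = 1 + (y - j) / (j - w) := by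
      rw [Complex.exp_sub, he y hy, he j hj, div_sub_eq_one_add hjw]
    have h2 : 0 < (Complex.exp (L y - L j)).re := by
      rw [h1]
      apply re_one_add_pos
      rw [norm_div, div_lt_one (norm_pos_iff.2 hjw), ← dist_eq_norm]
      exact (dist_le_diam_of_mem hAb hy hj).trans_lt hd
    rw [Complex.exp_re] at h2
    exact (pos_iff_pos_of_mul_pos h2).1 (Real.exp_pos _)
  by_contra! hc
  have hf : ContinuousOn (fun y => |(L y - L j).im|) A :=
    (Complex.continuous_im.comp_continuousOn (hL.sub continuousOn_const)).abs
  obtain ⟨y, hy, hy'⟩ := hA.intermediate_value hj hz hf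
    (show Real.pi / 2 ∈ Icc _ _ from ⟨by simp; positivity, hc⟩)
  have := hcos y hy
  simp only at hy'
  rw [← Real.cos_abs, hy', Real.cos_pi_div_two] at this
  exact this.false

theorem exp_eq_exp_of_abs_im_lt {a b : ℂ} (h : Complex.exp a = Complex.exp b)
    (hab : |(a - b).im| < 2 * Real.pi) : a = b := by
  obtain ⟨n, hn⟩ := Complex.exp_eq_exp_iff_exists_int.1 h
  have h1 : (a - b).im = n * (2 * Real.pi) := by rw [hn]; simp
  rw [h1, abs_mul, abs_of_pos Real.two_pi_pos] at hab
  have h2 : |(n : ℝ)| < 1 := by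
    by_contra! h
    nlinarith [Real.two_pi_pos]
  have : n = 0 := by
    rw [← Int.cast_abs] at h2
    exact Int.abs_lt_one_iff.1 (by exact_mod_cast h2)
  rw [hn, this]; simp

theorem continuousWithinAt_of_exp {Y : Set ℂ} {L : ℂ → ℂ} {w x₀ : ℂ} (hx₀ : x₀ ∈ Y)
    (he : ∀ x ∈ Y, Complex.exp (L x) = x - w)
    (h : ∀ᶠ x in nhdsWithin x₀ Y, |(L x - L x₀).im| < 3 * Real.pi / 2) :
    ContinuousWithinAt L Y x₀ := by
  have hne : x₀ - w ≠ 0 := by rw [← he x₀ hx₀]; exact Complex.exp_ne_zero _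
  let ψ : ℂ → ℂ := fun x => L x₀ + Complex.log ((x - w) / (x₀ - w))
  have hψ : ContinuousAt ψ x₀ := by
    refine continuousAt_const.add (ContinuousAt.clog (by fun_prop) ?_)
    rw [div_self hne]; exact one_mem_slitPlane
  have hψ0 : ψ x₀ = L x₀ := by simp [ψ, div_self hne]
  have hev : ∀ᶠ x in nhdsWithin x₀ Y, L x = ψ x := by
    have h1 : ∀ᶠ x in nhds x₀, |(ψ x - L x₀).im| < Real.pi / 2 := by
      have : ContinuousAt (fun x => |(ψ x - L x₀).im|) x₀ :=
        (Complex.continuous_im.continuousAt.comp (hψ.sub continuousAt_const)).abs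
      refine this.eventually_lt continuousAt_const ?_
      simp [hψ0, Real.pi_pos]
    have h2 : ∀ᶠ x in nhdsWithin x₀ Y, x ∈ Y := self_mem_nhdsWithin
    filter_upwards [h, mem_nhdsWithin_of_mem_nhds h1, h2] with x hx hx' hxY
    have hxw : x - w ≠ 0 := by rw [← he x hxY]; exact Complex.exp_ne_zero _
    refine exp_eq_exp_of_abs_im_lt ?_ ?_
    · rw [he x hxY, Complex.exp_add, he x₀ hx₀, Complex.exp_log (div_ne_zero hxw hne)]
      field_simp
    · have : (L x - ψ x).im = (L x - L x₀).im - (ψ x - L x₀).im := by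
        simp only [sub_im]; ring
      rw [this]
      refine (abs_sub _ _).trans_lt ?_
      linarith
  exact hψ.continuousWithinAt.congr_of_eventuallyEq hev hψ0.symm

namespace IsClosedQuasidisk

variable {J K : Set ℂ} {M : ℝ}

theorem nonempty (h : IsClosedQuasidisk J K M) : K.Nonempty := h.jordan.nonempty.mono h.subset

theorem infDist_pos (h : IsClosedQuasidisk J K M) {w : ℂ} (hw : w ∉ K) : 0 < infDist w K :=
  (h.isCompact.isClosed.notMem_iff_infDist_pos h.nonempty).1 hw

theorem exists_nearest (h : IsClosedQuasidisk J K M) : ∃ j : ℂ → ℂ, ∀ x, j x ∈ K ∧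
    dist x (j x) = infDist x K ∧ (x ∉ K → j x ∈ J) := by
  have : ∀ x, ∃ y ∈ K, dist x y = infDist x K ∧ (x ∉ K → y ∈ J) := by
    intro x
    obtain ⟨y, hy, hxy⟩ := h.isCompact.exists_infDist_eq_dist h.nonempty x
    refine ⟨y, hy, hxy.symm, fun hx => h.frontier_subset ⟨subset_closure hy, fun hi => ?_⟩⟩
    obtain ⟨ε, hε, hb⟩ := Metric.isOpen_iff.1 isOpen_interior y hi
    have hd := h.infDist_pos hx
    rw [hxy, dist_eq_norm] at hd
    set τ : ℝ := min (1 / 2) (ε / (2 * ‖x - y‖)) with hτ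
    have hτ0 : 0 < τ := by positivity
    have hz : y + τ • (x - y) ∈ K := by
      refine interior_subset (hb ?_)
      rw [mem_ball, dist_eq_norm, add_sub_cancel_left, norm_smul, Real.norm_of_nonneg hτ0.le]
      calc τ * ‖x - y‖ ≤ ε / (2 * ‖x - y‖) * ‖x - y‖ := by gcongr; exact min_le_right _ _
        _ = ε / 2 := by field_simp
        _ < ε := half_lt_self hε
    have h1 := infDist_le_dist_of_mem hz (x := x)
    rw [hxy, dist_eq_norm, dist_eq_norm] at h1
    have h2 : x - (y + τ • (x - y)) = (1 - τ) • (x - y) := by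
      rw [sub_smul, one_smul]; abel
    have h3 : τ ≤ 1 / 2 := min_le_left _ _
    rw [h2, norm_smul, Real.norm_of_nonneg (by linarith)] at h1
    nlinarith
  choose j hj using this
  exact ⟨j, hj⟩

/-- Extension of a logarithm of `z - w` to a neighbourhood of `K` which is conical at `w`. -/
theorem exists_log_extension (h : IsClosedQuasidisk J K M) {j : ℂ → ℂ}
    (hj : ∀ x, j x ∈ K ∧ dist x (j x) = infDist x K ∧ (x ∉ K → j x ∈ J)) {w : ℂ} (hw : w ∉ K)
    {L : ℂ → ℂ} (hL : ContinuousOn L K) (he : ∀ z ∈ K, Complex.exp (L z) = z - w) :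
    ∃ L' : ℂ → ℂ, ContinuousOn L' {x | infDist x K ≤ 1 / (8 * M) * ‖x - w‖} ∧
      (∀ x ∈ {x | infDist x K ≤ 1 / (8 * M) * ‖x - w‖}, Complex.exp (L' x) = x - w) ∧
      ∀ x ∈ {x | infDist x K ≤ 1 / (8 * M) * ‖x - w‖}, |(L' x - L (j x)).im| < Real.pi / 2 := by
  have hM := h.one_le
  set η := 1 / (8 * M) with hη
  have hMη : M * η = 1 / 8 := by rw [hη]; field_simp
  have hη0 : 0 < η := by positivity
  have hη1 : η ≤ 1 / 8 := by nlinarith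
  have hKw : ∀ z ∈ K, z - w ≠ 0 := fun z hz => sub_ne_zero.2 (by rintro rfl; exact hw hz)
  let L' : ℂ → ℂ := fun x => L (j x) + Complex.log (1 + (x - j x) / (j x - w))
  have hjw : ∀ x, infDist x K ≤ η * ‖x - w‖ → (1 - η) * ‖x - w‖ ≤ ‖j x - w‖ := by
    intro x hx
    have h1 := (hj x).2.1
    rw [dist_eq_norm] at h1
    have := norm_sub_le_norm_sub_add_norm_sub x (j x) w
    linarith
  have hsmall : ∀ x, infDist x K ≤ η * ‖x - w‖ → ‖(x - j x) / (j x - w)‖ < 1 := by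
    intro x hx
    have hp := norm_pos_iff.2 (hKw _ (hj x).1)
    rw [norm_div, div_lt_one hp, ← dist_eq_norm, (hj x).2.1]
    have := hjw x hx
    by_contra! hc
    have : 0 < ‖x - w‖ := by
      rw [norm_pos_iff, sub_ne_zero]
      rintro rfl
      simp at hx
      exact (h.infDist_pos hw).not_ge hx
    nlinarith
  have he' : ∀ x, infDist x K ≤ η * ‖x - w‖ → Complex.exp (L' x) = x - w := by
    intro x hx
    have hne : (1 + (x - j x) / (j x - w)) ≠ 0 := fun h0 => by
      have := re_one_add_pos (hsmall x hx)
      rw [h0] at this; simp at this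
    simp only [L']
    rw [Complex.exp_add, he _ (hj x).1, Complex.exp_log hne, ← div_sub_eq_one_add (hKw _ (hj x).1)]
    have := hKw _ (hj x).1
    field_simp
  have him : ∀ x, infDist x K ≤ η * ‖x - w‖ → |(L' x - L (j x)).im| < Real.pi / 2 := by
    intro x hx
    simp only [L', add_sub_cancel_left]
    exact abs_im_log_lt (hsmall x hx)
  refine ⟨L', fun x₀ hx₀ => ?_, he', him⟩
  refine continuousWithinAt_of_exp hx₀ he' ?_
  suffices hs : ∀ᶠ x in nhdsWithin x₀ {x | infDist x K ≤ η * ‖x - w‖},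
      |(L (j x) - L (j x₀)).im| < Real.pi / 2 by
    have h2 : ∀ᶠ x in nhdsWithin x₀ {x | infDist x K ≤ η * ‖x - w‖},
      infDist x K ≤ η * ‖x - w‖ := self_mem_nhdsWithin
    filter_upwards [hs, h2] with x hx hxY
    have : (L' x - L' x₀).im = (L' x - L (j x)).im + (L (j x) - L (j x₀)).im
      - (L' x₀ - L (j x₀)).im := by simp only [sub_im]; ring
    rw [this]
    have h1 := abs_lt.1 (him x hxY)
    have h2 := abs_lt.1 (him x₀ hx₀)
    have h3 := abs_lt.1 hx
    rw [abs_lt]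
    constructor <;> linarith
  by_cases hxK : x₀ ∈ K
  · have hj0 : j x₀ = x₀ := by
      have := (hj x₀).2.1
      rw [infDist_zero_of_mem hxK, dist_eq_zero] at this
      exact this.symm
    have hlim : Tendsto j (nhds x₀) (nhdsWithin x₀ K) := by
      refine tendsto_nhdsWithin_iff.2 ⟨?_, Eventually.of_forall fun x => (hj x).1⟩
      rw [tendsto_iff_dist_tendsto_zero]
      refine squeeze_zero (g := fun x => 2 * dist x x₀) (fun _ => dist_nonneg) (fun x => ?_) ?_
      · have h1 := infDist_le_dist_of_mem hxK (x := x)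
        have h2 := dist_triangle_left (j x) x₀ x
        rw [(hj x).2.1] at h2
        linarith
      · have : ContinuousAt (fun x => 2 * dist x x₀) x₀ := by fun_prop
        simpa [ContinuousAt] using this
    have hLt : Tendsto (fun x => |(L (j x) - L x₀).im|) (nhds x₀) (nhds |(L x₀ - L x₀).im|) :=
      ((Complex.continuous_im.tendsto _).comp
        (((hL x₀ hxK).tendsto.comp hlim).sub_const _)).abs
    rw [hj0]
    refine mem_nhdsWithin_of_mem_nhds (hLt.eventually_lt_const ?_)
    simp [Real.pi_pos]
  · have hd := h.infDist_pos hxK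
    have hpos : 0 < ‖x₀ - w‖ := by
      have : infDist x₀ K ≤ η * ‖x₀ - w‖ := hx₀
      by_contra! hc
      nlinarith
    have h1 : ∀ᶠ x in nhds x₀, x ∉ K := h.isCompact.isClosed.isOpen_compl.mem_nhds hxK
    have h2 : ∀ᶠ x in nhds x₀, x ∈ ball x₀ (η * ‖x₀ - w‖) := ball_mem_nhds _ (by positivity)
    refine mem_nhdsWithin_of_mem_nhds ?_
    filter_upwards [h1, h2] with x hxK' hx
    obtain ⟨A, hAJ, hA, ha, hb, hdiam⟩ := h.arc _ ((hj x₀).2.2 hxK) _ ((hj x).2.2 hxK')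
    refine abs_im_sub_lt_of_diam_lt hA (h.jordan.isCompact.isBounded.subset hAJ)
      (hL.mono (hAJ.trans h.subset)) (fun z hz => he z (h.subset (hAJ hz))) ha hb ?_
    have e1 := hjw x₀ hx₀
    have e2 : infDist x K ≤ infDist x₀ K + dist x x₀ := infDist_le_infDist_add_dist
    have e3 : infDist x₀ K ≤ η * ‖x₀ - w‖ := hx₀
    have e4 : dist (j x₀) (j x) ≤ dist x₀ (j x₀) + dist x x₀ + dist x (j x) := by
      have := dist_triangle4 (j x₀) x₀ x (j x)
      rw [dist_comm (j x₀) x₀, dist_comm x₀ x] at this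
      exact this
    rw [(hj x).2.1, (hj x₀).2.1] at e4
    rw [mem_ball] at hx
    have e5 : dist (j x₀) (j x) ≤ 4 * (η * ‖x₀ - w‖) := by linarith
    have e6 : M * dist (j x₀) (j x) ≤ M * (4 * (η * ‖x₀ - w‖)) := by gcongr
    have e7 : M * (4 * (η * ‖x₀ - w‖)) = 4 * (M * η) * ‖x₀ - w‖ := by ring
    rw [e7, hMη] at e6
    nlinarith

/-- Corkscrew condition: spheres centred on the curve contain points far from `K`. -/
theorem exists_mem_sphere (h : IsClosedQuasidisk J K M) {a : ℂ} (ha : a ∈ J) {r : ℝ}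
    (hr : 0 < r) : ∃ x, ‖x - a‖ = r ∧ 1 / (16 * M) * r ≤ infDist x K := by
  by_contra! hc
  have hM := h.one_le
  obtain ⟨w, hw, hwa⟩ := Metric.mem_closure_iff.1 (h.dense ha) (r / 4) (by positivity)
  obtain ⟨j, hj⟩ := h.exists_nearest
  obtain ⟨L, hL, he⟩ := h.exists_log w hw
  obtain ⟨L', hL', he', -⟩ := h.exists_log_extension hj hw hL he
  have hsub : frontier (ball a r) ⊆ {x | infDist x K ≤ 1 / (8 * M) * ‖x - w‖} := by
    intro x hx
    rw [frontier_ball a hr.ne', mem_sphere, dist_eq_norm] at hx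
    have h1 := hc x hx
    have h2 := norm_sub_le_norm_sub_add_norm_sub x w a
    rw [dist_comm, dist_eq_norm] at hwa
    have h3 : 1 / (16 * M) * r = 1 / (8 * M) * (r / 2) := by field_simp; norm_num
    have h4 : 1 / (8 * M) * (r / 2) ≤ 1 / (8 * M) * ‖x - w‖ := by gcongr; linarith
    exact (h1.le.trans h3.le).trans h4
  refine not_exists_log_frontier isBounded_ball (U := ball a r) (z₀ := w) ?_ one_ne_zero
    (ψ := fun _ => 1) continuousOn_const (by simp) (hL'.mono hsub) fun z hz => ?_
  · rw [mem_ball, dist_comm]; linarith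
  · rw [he' z (hsub hz)]; simp

/-- Two points of a Jordan curve far from `w` are joined, within the curve, away from `w`. -/
theorem exists_arc_far (h : IsClosedQuasidisk J K M) {w a b : ℂ} (ha : a ∈ J) (hb : b ∈ J)
    {ρ : ℝ} (hρ : 0 < ρ) (haw : (1 + 2 * M) * ρ ≤ ‖a - w‖) (hbw : (1 + 2 * M) * ρ ≤ ‖b - w‖) :
    ∃ A ⊆ J, IsPreconnected A ∧ a ∈ A ∧ b ∈ A ∧ ∀ z ∈ A, ρ ≤ ‖z - w‖ := by
  have hM := h.one_le
  rcases eq_or_ne a b with rfl | hab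
  · refine ⟨{a}, by simpa using ha, isPreconnected_singleton, rfl, rfl, ?_⟩
    rintro z rfl
    nlinarith
  obtain ⟨J₁, J₂, hc₁, hc₂, hp₁, hp₂, hu, hi, ha₁, hb₁, ha₂, hb₂⟩ := h.jordan.exists_arcs ha hb hab
  by_cases h1 : ∀ z ∈ J₁, ρ ≤ ‖z - w‖
  · exact ⟨J₁, hu ▸ subset_union_left, hp₁, ha₁, hb₁, h1⟩
  by_cases h2 : ∀ z ∈ J₂, ρ ≤ ‖z - w‖
  · exact ⟨J₂, hu ▸ subset_union_right, hp₂, ha₂, hb₂, h2⟩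
  exfalso
  push Not at h1 h2
  obtain ⟨p, hp, hpw⟩ := h1
  obtain ⟨q, hq, hqw⟩ := h2
  obtain ⟨A, hAJ, hA, hpA, hqA, hd⟩ := h.arc p (hu ▸ Or.inl hp) q (hu ▸ Or.inr hq)
  obtain ⟨c, hcA, hc⟩ := isPreconnected_closed_iff.1 hA J₁ J₂ hc₁ hc₂ (hu ▸ hAJ)
    ⟨p, hpA, hp⟩ ⟨q, hqA, hq⟩
  have hpq : dist p q ≤ 2 * ρ := by
    have := dist_triangle_right p q w
    rw [dist_eq_norm p w, dist_eq_norm q w] at this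
    linarith
  have hcp : dist c p ≤ M * (2 * ρ) :=
    (dist_le_diam_of_mem (h.jordan.isCompact.isBounded.subset hAJ) hcA hpA).trans
      (hd.trans (by gcongr))
  have hcw : ‖c - w‖ < (1 + 2 * M) * ρ := by
    have := norm_sub_le_norm_sub_add_norm_sub c p w
    rw [← dist_eq_norm c p] at this
    linarith
  rcases hi hc with rfl | rfl
  · exact absurd hcw haw.not_gt
  · exact absurd hcw hbw.not_gt

/-- Points of the complement of `K` can be joined without coming too close to `K` or going too far
away. -/
theorem exists_link (h : IsClosedQuasidisk J K M) {w w' : ℂ} {t R : ℝ} (ht : 0 < t) (hR : 0 < R)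
    (hw : t ≤ infDist w K) (hw' : t ≤ infDist w' K) (hww : ‖w - w'‖ ≤ R) :
    ∃ U : Set ℂ, IsPreconnected U ∧ w ∈ U ∧ w' ∈ U ∧
      ∀ x ∈ U, 1 / (16 * M) * t ≤ infDist x K ∧ ‖x - w‖ ≤ (1 + 2 * M) * (3 * R) + t := by
  have hM := h.one_le
  set η := 1 / (16 * M) with hη
  have hη2 : 1 / (8 * M) = 2 * η := by rw [hη]; field_simp; norm_num
  have hMη : M * η = 1 / 16 := by rw [hη]; field_simp
  have hη0 : 0 < η := by positivity
  have hη1 : η ≤ 1 / 16 := by nlinarith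
  set ρ := (1 + 2 * M) * (3 * R) + t with hρ
  have hρR : 9 * R ≤ ρ := by nlinarith
  have hwK : w ∉ K := fun hh => by rw [infDist_zero_of_mem hh] at hw; linarith
  have hwK' : w' ∉ K := fun hh => by rw [infDist_zero_of_mem hh] at hw'; linarith
  have hcd : Continuous fun x => infDist x K := continuous_infDist_pt K
  set O : Set ℂ := {x | η * t < infDist x K} ∩ ball w ρ with hO
  have hOo : IsOpen O := (isOpen_lt continuous_const hcd).inter isOpen_ball
  have hwO : w ∈ O := ⟨by simp only [mem_ofPred_eq]; nlinarith, mem_ball_self (by positivity)⟩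
  have hwO' : w' ∈ O := by
    refine ⟨by simp only [mem_ofPred_eq]; nlinarith, ?_⟩
    rw [mem_ball, dist_comm, dist_eq_norm]; linarith
  refine ⟨connectedComponentIn O w, isPreconnected_connectedComponentIn,
    mem_connectedComponentIn hwO, ?_, fun x hx => ?_⟩
  swap
  · obtain ⟨h1, h2⟩ := connectedComponentIn_subset _ _ hx
    rw [mem_ball, dist_eq_norm] at h2
    exact ⟨h1.le, h2.le⟩
  by_contra hU
  have hfr := frontier_connectedComponentIn_subset hOo w
  set U := connectedComponentIn O w with hUdef
  have hUcl : closure U ⊆ {x | η * t ≤ infDist x K ∧ ‖x - w‖ ≤ ρ} := by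
    refine closure_minimal (fun x hx => ?_) ((isClosed_le continuous_const hcd).inter
      (isClosed_le (f := fun x => ‖x - w‖) (by fun_prop) continuous_const))
    obtain ⟨h1, h2⟩ := connectedComponentIn_subset _ _ hx
    rw [mem_ball, dist_eq_norm] at h2
    exact ⟨h1.le, h2.le⟩
  have hwcl : w' ∉ closure U := by
    rw [closure_eq_self_union_frontier]
    rintro (h1 | h1)
    exacts [hU h1, hfr h1 hwO']
  have hUb : IsBounded U := isBounded_ball.subset ((connectedComponentIn_subset O w).trans
    inter_subset_right)
  obtain ⟨j, hj⟩ := h.exists_nearest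
  obtain ⟨L, hL, he⟩ := h.exists_log w hwK
  obtain ⟨L', hL', he', hi⟩ := h.exists_log_extension hj hwK hL he
  obtain ⟨L₂, hL₂, he₂⟩ := h.exists_log w' hwK'
  obtain ⟨L₂', hL₂', he₂', hi₂⟩ := h.exists_log_extension hj hwK' hL₂ he₂
  set Y := {x | infDist x K ≤ 1 / (8 * M) * ‖x - w‖} with hY
  set Y' := {x | infDist x K ≤ 1 / (8 * M) * ‖x - w'‖} with hY'
  set F₁ := frontier U ∩ {x | infDist x K ≤ η * t} with hF₁
  set F₂ := frontier U ∩ {x | ρ ≤ ‖x - w‖} with hF₂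
  have hF : frontier U ⊆ F₁ ∪ F₂ := by
    intro x hx
    by_cases h1 : infDist x K ≤ η * t
    · exact Or.inl ⟨hx, h1⟩
    · refine Or.inr ⟨hx, ?_⟩
      by_contra h2
      refine hfr hx ⟨not_le.1 h1, ?_⟩
      rw [mem_ball, dist_eq_norm]; exact not_le.1 h2
  have hF₁c : IsClosed F₁ := isClosed_frontier.inter (isClosed_le hcd continuous_const)
  have hF₂c : IsClosed F₂ := isClosed_frontier.inter
    (isClosed_le continuous_const (by fun_prop))
  have hcone : ∀ v, t ≤ infDist v K → F₁ ⊆ {x | infDist x K ≤ 1 / (8 * M) * ‖x - v‖} := by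
    rintro v hv x ⟨-, hx⟩
    have h1 : infDist v K ≤ infDist x K + dist v x := infDist_le_infDist_add_dist
    rw [dist_comm, dist_eq_norm] at h1
    have h2 : infDist x K ≤ η * t := hx
    rw [mem_ofPred_eq, hη2]
    have : t ≤ 2 * ‖x - v‖ := by nlinarith
    nlinarith
  have hF₁Y : F₁ ⊆ Y := hcone w hw
  have hF₁Y' : F₁ ⊆ Y' := hcone w' hw'
  have hfar : ∀ z, 3 * R ≤ ‖z - w‖ → R < ‖z - w'‖ := by
    intro z hz
    have := norm_sub_le_norm_sub_add_norm_sub z w' w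
    rw [norm_sub_rev w'] at this
    linarith
  have hsm : ∀ z, 3 * R ≤ ‖z - w‖ → ‖(w' - w) / (z - w')‖ < 1 := by
    intro z hz
    have := hfar z hz
    rw [norm_div, div_lt_one (hR.trans this), norm_sub_rev]
    linarith
  have hne : ∀ z, 3 * R ≤ ‖z - w‖ → z - w' ≠ 0 := fun z hz =>
    norm_pos_iff.1 (hR.trans (hfar z hz))
  let ℓ : ℂ → ℂ := fun z => Complex.log (1 + (w' - w) / (z - w'))
  have hℓe : ∀ z, 3 * R ≤ ‖z - w‖ → Complex.exp (ℓ z) * (z - w') = z - w := by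
    intro z hz
    simp only [ℓ]
    have h0 : 1 + (w' - w) / (z - w') ≠ 0 := fun h0 => by
      have := re_one_add_pos (hsm z hz)
      rw [h0] at this; simp at this
    rw [Complex.exp_log h0]
    have := hne z hz
    field_simp
    ring
  have hℓc : ContinuousOn ℓ {z | 3 * R ≤ ‖z - w‖} := by
    refine ContinuousOn.clog ?_ fun z hz => Or.inl (re_one_add_pos (hsm z hz))
    exact continuousOn_const.add (continuousOn_const.div (by fun_prop) fun z hz => hne z hz)
  have hKne : ∀ z ∈ K, z - w' ≠ 0 := fun z hz => sub_ne_zero.2 (by rintro rfl; exact hwK' hz)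
  have hE1 : ∀ z ∈ J, 3 * R ≤ ‖z - w‖ → Complex.exp (L z - L₂ z - ℓ z) = 1 := by
    intro z hz hzR
    rw [Complex.exp_sub, Complex.exp_sub, he z (h.subset hz), he₂ z (h.subset hz),
      ← hℓe z hzR]
    have := hKne z (h.subset hz)
    have := Complex.exp_ne_zero (ℓ z)
    field_simp
  obtain ⟨E, hEexp, hE⟩ : ∃ E : ℂ, Complex.exp E = 1 ∧
      ∀ z ∈ J, (1 + 2 * M) * (3 * R) ≤ ‖z - w‖ → L z - L₂ z - ℓ z = E := by
    by_cases hex : ∃ z ∈ J, (1 + 2 * M) * (3 * R) ≤ ‖z - w‖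
    · obtain ⟨b, hb, hbw⟩ := hex
      refine ⟨_, hE1 b hb (by nlinarith), fun z hz hzw => ?_⟩
      obtain ⟨A, hAJ, hA, hzA, hbA, hAf⟩ := h.exists_arc_far hz hb (by positivity) hzw hbw
      refine hA.eq_of_exp_eq (f := fun z => L z - L₂ z - ℓ z) ?_ ?_ hzA hbA
      · exact ((hL.mono (hAJ.trans h.subset)).sub (hL₂.mono (hAJ.trans h.subset))).sub
          (hℓc.mono hAf)
      · intro x hx y hy
        rw [hE1 x (hAJ hx) (hAf x hx), hE1 y (hAJ hy) (hAf y hy)]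
    · push Not at hex
      exact ⟨0, by simp, fun z hz hz' => absurd hz' (hex z hz).not_ge⟩
  have hF₂R : ∀ x ∈ F₂, 3 * R ≤ ‖x - w‖ := fun x hx => by
    have : ρ ≤ ‖x - w‖ := hx.2
    linarith
  have hoverlap : ∀ x ∈ F₁, x ∈ F₂ → L' x - L₂' x - E = ℓ x := by
    intro x hx hx'
    have hxd : infDist x K ≤ η * t := hx.2
    have hxK : x ∉ K := fun hxK => by
      have := (hUcl (frontier_subset_closure hx.1)).1
      rw [infDist_zero_of_mem hxK] at this
      nlinarith
    have hxρ : ρ ≤ ‖x - w‖ := hx'.2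
    have hjJ := (hj x).2.2 hxK
    have hjd := (hj x).2.1
    have hjw : (1 + 2 * M) * (3 * R) ≤ ‖j x - w‖ := by
      have := norm_sub_le_norm_sub_add_norm_sub x (j x) w
      rw [← dist_eq_norm x (j x), hjd] at this
      nlinarith
    have hjR : 3 * R ≤ ‖j x - w‖ := by nlinarith
    have hEj := hE _ hjJ hjw
    refine exp_eq_exp_of_abs_im_lt ?_ ?_
    · have h0 : x - w' ≠ 0 := hne x (hF₂R x hx')
      have e1 := hℓe x (hF₂R x hx')
      rw [Complex.exp_sub, Complex.exp_sub, hEexp, he' x (hF₁Y hx), he₂' x (hF₁Y' hx), div_one,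
        ← e1, mul_div_cancel_right₀ _ h0]
    · have : (L' x - L₂' x - E - ℓ x).im = (L' x - L (j x)).im - (L₂' x - L₂ (j x)).im
          + (ℓ (j x)).im - (ℓ x).im := by
        rw [← hEj]; simp only [sub_im]; ring
      rw [this]
      have h1 := abs_lt.1 (hi x (hF₁Y hx))
      have h2 := abs_lt.1 (hi₂ x (hF₁Y' hx))
      have h3 := abs_lt.1 (abs_im_log_lt (hsm _ (hF₂R x hx')))
      have h4 := abs_lt.1 (abs_im_log_lt (hsm _ hjR))
      rw [abs_lt]
      constructor <;> simp only [ℓ] <;> linarith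
  classical
  let Λ : ℂ → ℂ := fun x => if infDist x K ≤ η * t then L' x - L₂' x - E else ℓ x
  have hΛ₁ : ∀ x ∈ F₁, Λ x = L' x - L₂' x - E := fun x hx => if_pos hx.2
  have hΛ₂ : ∀ x ∈ F₂, Λ x = ℓ x := by
    intro x hx
    by_cases h1 : infDist x K ≤ η * t
    · rw [hΛ₁ x ⟨hx.1, h1⟩]
      exact hoverlap x ⟨hx.1, h1⟩ hx
    · exact if_neg h1
  have hΛc : ContinuousOn Λ (F₁ ∪ F₂) := by
    refine ContinuousOn.union_of_isClosed ?_ ?_ hF₁c hF₂c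
    · exact (((hL'.mono hF₁Y).sub (hL₂'.mono hF₁Y')).sub continuousOn_const).congr hΛ₁
    · exact (hℓc.mono hF₂R).congr hΛ₂
  refine not_exists_log_frontier hUb (mem_connectedComponentIn hwO) one_ne_zero
    (ψ := fun z => z - w') (by fun_prop) (fun z hz => sub_ne_zero.2 (by rintro rfl; exact hwcl hz))
    (hΛc.mono hF) fun z hz => ?_
  rw [pow_one]
  rcases hF hz with hz | hz
  · have : z - w' ≠ 0 := by rw [← he₂' z (hF₁Y' hz)]; exact Complex.exp_ne_zero _
    rw [hΛ₁ z hz, Complex.exp_sub, Complex.exp_sub, hEexp, he' z (hF₁Y hz), he₂' z (hF₁Y' hz)]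
    field_simp
  · rw [hΛ₂ z hz, hℓe z (hF₂R z hz)]

end IsClosedQuasidisk

theorem volume_ball_eq_ofReal (a : ℂ) {r : ℝ} (hr : 0 ≤ r) :
    volume (ball a r) = ENNReal.ofReal (Real.pi * r ^ 2) := by
  rw [Complex.volume_ball, mul_comm Real.pi, ENNReal.ofReal_mul (by positivity),
    ENNReal.ofReal_pow hr, ENNReal.ofReal_eq_coe_nnreal Real.pi_pos.le]
  rfl

theorem volume_closedBall_eq_ofReal (a : ℂ) {r : ℝ} (hr : 0 ≤ r) :
    volume (closedBall a r) = ENNReal.ofReal (Real.pi * r ^ 2) := by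
  rw [← volume_ball_eq_ofReal a hr, Complex.volume_closedBall, Complex.volume_ball]

theorem IsClosedQuasidisk.volume_eq_zero {J K : Set ℂ} {M : ℝ} (h : IsClosedQuasidisk J K M) :
    volume J = 0 := by
  have hM := h.one_le
  have hJm : MeasurableSet J := h.jordan.isCompact.isClosed.measurableSet
  have key : ∀ᵐ x ∂(volume : Measure ℂ).restrict J, False := by
    filter_upwards [Besicovitch.ae_tendsto_measure_inter_div (volume : Measure ℂ) J,
      ae_restrict_mem hJm] with a hlim ha
    set η := 1 / (16 * M) with hη
    have hη0 : 0 < η := by positivity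
    have hMη : M * η = 1 / 16 := by rw [hη]; field_simp
    have hη1 : η ≤ 1 / 16 := by nlinarith
    have hle : ∀ r : ℝ, 0 < r → volume (J ∩ closedBall a r) / volume (closedBall a r) ≤
        ENNReal.ofReal (1 - (η / 2) ^ 2) := by
      intro r hr
      obtain ⟨x, hx, hd⟩ := h.exists_mem_sphere ha (half_pos hr)
      rw [← hη] at hd
      have hsub : ball x (η * (r / 2)) ⊆ closedBall a r := by
        intro y hy
        rw [mem_ball, dist_eq_norm] at hy
        rw [mem_closedBall, dist_eq_norm]
        have := norm_sub_le_norm_sub_add_norm_sub y x a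
        nlinarith
      have hdis : Disjoint (J ∩ closedBall a r) (ball x (η * (r / 2))) := by
        rw [Set.disjoint_left]
        rintro y ⟨hy, -⟩ hy'
        rw [mem_ball, dist_comm] at hy'
        have := infDist_le_dist_of_mem (h.subset hy) (x := x)
        linarith
      have h1 : volume (J ∩ closedBall a r) + volume (ball x (η * (r / 2))) ≤
          volume (closedBall a r) := by
        rw [← measure_union hdis measurableSet_ball]
        exact measure_mono (union_subset inter_subset_right hsub)
      have hfin : volume (J ∩ closedBall a r) ≠ ⊤ :=
        ((measure_mono inter_subset_right).trans_lt measure_closedBall_lt_top).ne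
      have hc := volume_closedBall_eq_ofReal a hr.le
      have hb := volume_ball_eq_ofReal x (r := η * (r / 2)) (by positivity)
      rw [hb, hc, ← ENNReal.ofReal_toReal hfin, ← ENNReal.ofReal_add ENNReal.toReal_nonneg
        (by positivity), ENNReal.ofReal_le_ofReal_iff (by positivity)] at h1
      rw [hc, ← ENNReal.ofReal_toReal hfin, ← ENNReal.ofReal_div_of_pos (by positivity)]
      apply ENNReal.ofReal_le_ofReal
      rw [div_le_iff₀ (by positivity)]
      linarith
    have h1 : (1 : ENNReal) ≤ ENNReal.ofReal (1 - (η / 2) ^ 2) :=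
      le_of_tendsto hlim (by filter_upwards [self_mem_nhdsWithin] with r hr using hle r hr)
    have h2 := ENNReal.one_le_ofReal.1 h1
    nlinarith [sq_pos_of_pos (half_pos hη0)]
  rw [Filter.eventually_false_iff_eq_bot, ae_eq_bot, Measure.restrict_eq_zero] at key
  exact key

theorem integrable_of_bound_of_compact {E : Type*} [NormedAddCommGroup E] {h : ℂ → E} {S : Set ℂ}
    {B : ℝ} (hm : AEStronglyMeasurable h volume) (hS : IsCompact S) (hB : ∀ x ∈ S, ‖h x‖ ≤ B)
    (h0 : ∀ x ∉ S, h x = 0) : Integrable h := by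
  rw [← integrableOn_iff_integrable_of_support_subset (s := S)
    (fun x hx => by by_contra hc; exact hx (h0 x hc))]
  exact IntegrableOn.of_bound hS.measure_lt_top hm.restrict B
    ((ae_restrict_iff' hS.isClosed.measurableSet).2 (Eventually.of_forall hB))

/-- The derivative of a complex-valued function in a real direction, computed componentwise. -/
noncomputable def dirDeriv (F : ℂ → ℂ) (v z : ℂ) : ℂ :=
  lineDeriv ℝ (fun x => (F x).re) z v + I * lineDeriv ℝ (fun x => (F x).im) z v

/-- The Wirtinger derivative `∂F/∂z̄`. -/
noncomputable def dbar (F : ℂ → ℂ) (z : ℂ) : ℂ := (dirDeriv F 1 z + I * dirDeriv F I z) / 2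

theorem dirDeriv_congr {F F' : ℂ → ℂ} {z : ℂ} (h : F =ᶠ[nhds z] F') (v : ℂ) :
    dirDeriv F v z = dirDeriv F' v z := by
  have h1 : (fun x => (F x).re) =ᶠ[nhds z] fun x => (F' x).re := h.fun_comp re
  have h2 : (fun x => (F x).im) =ᶠ[nhds z] fun x => (F' x).im := h.fun_comp im
  simp only [dirDeriv, h1.lineDeriv_eq, h2.lineDeriv_eq]

theorem dbar_congr {F F' : ℂ → ℂ} {z : ℂ} (h : F =ᶠ[nhds z] F') : dbar F z = dbar F' z := by
  simp only [dbar, dirDeriv_congr h]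

theorem dirDeriv_of_hasLineDerivAt {F : ℂ → ℂ} {z v F' : ℂ} (h : HasLineDerivAt ℝ F F' z v) :
    dirDeriv F v z = F' := by
  have h1 : HasLineDerivAt ℝ (fun x => (F x).re) F'.re z v :=
    reCLM.hasFDerivAt.comp_hasDerivAt (0 : ℝ) h
  have h2 : HasLineDerivAt ℝ (fun x => (F x).im) F'.im z v :=
    imCLM.hasFDerivAt.comp_hasDerivAt (0 : ℝ) h
  rw [dirDeriv, h1.lineDeriv, h2.lineDeriv, mul_comm, re_add_im]

theorem dbar_eq_zero_of_differentiableAt {F : ℂ → ℂ} {z : ℂ} (h : DifferentiableAt ℂ F z) :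
    dbar F z = 0 := by
  have h1 : ∀ v, dirDeriv F v z = deriv F z * v := fun v => by
    refine dirDeriv_of_hasLineDerivAt ?_
    have := (h.hasDerivAt.hasFDerivAt.restrictScalars ℝ).hasLineDerivAt v
    simpa [mul_comm] using this
  rw [dbar, h1, h1]
  linear_combination (deriv F z / 2) * I_mul_I

theorem norm_dirDeriv_le {F : ℂ → ℂ} {z : ℂ} {B : ℝ} (hB : 0 ≤ B)
    (h : ∀ᶠ x in nhds z, ‖F x - F z‖ ≤ B * ‖x - z‖) (v : ℂ) :
    ‖dirDeriv F v z‖ ≤ 2 * B * ‖v‖ := by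
  have h1 : ‖lineDeriv ℝ (fun x => (F x).re) z v‖ ≤ B * ‖v‖ :=
    norm_lineDeriv_le_of_lip' ℝ hB (h.mono fun x hx => by
      rw [← sub_re]; exact (Complex.abs_re_le_norm _).trans hx)
  have h2 : ‖lineDeriv ℝ (fun x => (F x).im) z v‖ ≤ B * ‖v‖ :=
    norm_lineDeriv_le_of_lip' ℝ hB (h.mono fun x hx => by
      rw [← sub_im]; exact (Complex.abs_im_le_norm _).trans hx)
  refine (norm_add_le _ _).trans ?_
  rw [norm_mul, norm_I, one_mul, Complex.norm_real, Complex.norm_real]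
  linarith

theorem norm_dbar_le {F : ℂ → ℂ} {z : ℂ} {B : ℝ} (hB : 0 ≤ B)
    (h : ∀ᶠ x in nhds z, ‖F x - F z‖ ≤ B * ‖x - z‖) : ‖dbar F z‖ ≤ 2 * B := by
  have h1 := norm_dirDeriv_le hB h 1
  have h2 := norm_dirDeriv_le hB h I
  simp only [norm_one, norm_I, mul_one] at h1 h2
  rw [dbar, norm_div, Complex.norm_ofNat, div_le_iff₀ two_pos]
  refine (norm_add_le _ _).trans ?_
  rw [norm_mul, norm_I, one_mul]
  linarith

theorem LipschitzWith.re_comp {F : ℂ → ℂ} {C : NNReal} (h : LipschitzWith C F) :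
    LipschitzWith C fun x => (F x).re :=
  LipschitzWith.of_dist_le_mul fun x y => by
    refine le_trans ?_ (h.dist_le_mul x y)
    rw [Real.dist_eq, dist_eq_norm, ← sub_re]; exact Complex.abs_re_le_norm _

theorem LipschitzWith.im_comp {F : ℂ → ℂ} {C : NNReal} (h : LipschitzWith C F) :
    LipschitzWith C fun x => (F x).im :=
  LipschitzWith.of_dist_le_mul fun x y => by
    refine le_trans ?_ (h.dist_le_mul x y)
    rw [Real.dist_eq, dist_eq_norm, ← sub_im]; exact Complex.abs_im_le_norm _

theorem measurable_dirDeriv {F : ℂ → ℂ} (h : Continuous F) (v : ℂ) :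
    Measurable (dirDeriv F v) := by
  have h1 := measurable_lineDeriv (𝕜 := ℝ) (v := v) (Complex.continuous_re.comp h)
  have h2 := measurable_lineDeriv (𝕜 := ℝ) (v := v) (Complex.continuous_im.comp h)
  exact (Complex.measurable_ofReal.comp h1).add
    (measurable_const.mul (Complex.measurable_ofReal.comp h2))

theorem measurable_dbar {F : ℂ → ℂ} (h : Continuous F) : Measurable (dbar F) :=
  ((measurable_dirDeriv h 1).add (measurable_const.mul (measurable_dirDeriv h I))).div_const _

theorem norm_dbar_le_of_lipschitz {F : ℂ → ℂ} {C : NNReal} (h : LipschitzWith C F) (z : ℂ) :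
    ‖dbar F z‖ ≤ 2 * C :=
  norm_dbar_le C.2 (Eventually.of_forall fun x => by
    rw [← dist_eq_norm, ← dist_eq_norm]; exact h.dist_le_mul x z)

theorem dbar_eq_zero_of_notMem_tsupport {F : ℂ → ℂ} {z : ℂ} (h : z ∉ tsupport F) :
    dbar F z = 0 := by
  rw [dbar_congr (notMem_tsupport_iff_eventuallyEq.1 h)]
  exact dbar_eq_zero_of_differentiableAt (differentiableAt_const 0)

theorem integral_lineDeriv_mul_eq_neg {f g : ℂ → ℝ} {C D : NNReal} (hf : LipschitzWith C f)
    (hg : LipschitzWith D g) (hc : HasCompactSupport g) (v : ℂ) :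
    Integrable (fun x => lineDeriv ℝ g x v * f x) ∧ Integrable (fun x => g x * lineDeriv ℝ f x v) ∧
      ∫ x, lineDeriv ℝ g x v * f x = -∫ x, g x * lineDeriv ℝ f x v := by
  refine ⟨?_, ?_, ?_⟩
  · obtain ⟨B, hB⟩ := hc.isCompact.exists_bound_of_continuousOn hf.continuous.continuousOn
    refine integrable_of_bound_of_compact (B := D * ‖v‖ * B) (S := tsupport g)
      ((measurable_lineDeriv hg.continuous).mul hf.continuous.measurable).aestronglyMeasurable
      hc.isCompact (fun x hx => ?_) fun x hx => ?_
    · rw [norm_mul]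
      exact mul_le_mul (norm_lineDeriv_le_of_lipschitz ℝ hg) (hB x hx) (norm_nonneg _)
        (by positivity)
    · rw [(notMem_tsupport_iff_eventuallyEq.1 hx).lineDeriv_eq]
      have : lineDeriv ℝ (0 : ℂ → ℝ) x v = 0 := by simp [lineDeriv]
      rw [this, zero_mul]
  · obtain ⟨B, hB⟩ := hc.isCompact.exists_bound_of_continuousOn hg.continuous.continuousOn
    refine integrable_of_bound_of_compact (B := B * (C * ‖v‖)) (S := tsupport g)
      (hg.continuous.measurable.mul (measurable_lineDeriv hf.continuous)).aestronglyMeasurable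
      hc.isCompact (fun x hx => ?_) fun x hx => ?_
    · rw [norm_mul]
      exact mul_le_mul (hB x hx) (norm_lineDeriv_le_of_lipschitz ℝ hf) (norm_nonneg _)
        ((norm_nonneg _).trans (hB x hx))
    · rw [image_eq_zero_of_notMem_tsupport hx, zero_mul]
  · have := LipschitzWith.integral_lineDeriv_mul_eq (μ := volume) hf hg hc v
    simp only [lineDeriv_neg, neg_mul, integral_neg] at this
    rw [← neg_eq_iff_eq_neg, ← this]
    simp only [mul_comm]

theorem integral_complex_comb {p q r s : ℂ → ℝ} (hp : Integrable p) (hq : Integrable q)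
    (hr : Integrable r) (hs : Integrable s) :
    Integrable (fun x => (((p x : ℝ) : ℂ) - (q x : ℝ)) + I * (((r x : ℝ) : ℂ) + (s x : ℝ))) ∧
      ∫ x, ((((p x : ℝ) : ℂ) - (q x : ℝ)) + I * (((r x : ℝ) : ℂ) + (s x : ℝ))) =
      (((∫ x, p x : ℝ) : ℂ) - (∫ x, q x : ℝ)) + I * (((∫ x, r x : ℝ) : ℂ) + (∫ x, s x : ℝ)) := by
  have h1 : Integrable (fun x => ((p x : ℝ) : ℂ) - (q x : ℝ)) := hp.ofReal.sub hq.ofReal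
  have h2 : Integrable (fun x => I * (((r x : ℝ) : ℂ) + (s x : ℝ))) :=
    (hr.ofReal.add hs.ofReal).const_mul I
  refine ⟨h1.add h2, ?_⟩
  rw [integral_add h1 h2, integral_const_mul, integral_sub hp.ofReal hq.ofReal,
    integral_add hr.ofReal hs.ofReal]
  simp only [integral_complex_ofReal]

theorem integral_dirDeriv_mul {F k : ℂ → ℂ} {C D : NNReal} (hF : LipschitzWith C F)
    (hc : HasCompactSupport F) (hk : LipschitzWith D k) (v : ℂ) :
    Integrable (fun x => dirDeriv F v x * k x) ∧ Integrable (fun x => F x * dirDeriv k v x) ∧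
      ∫ x, dirDeriv F v x * k x = -∫ x, F x * dirDeriv k v x := by
  have hcr : HasCompactSupport fun x => (F x).re := hc.comp_left (g := re) rfl
  have hci : HasCompactSupport fun x => (F x).im := hc.comp_left (g := im) rfl
  obtain ⟨a1, a2, a3⟩ := integral_lineDeriv_mul_eq_neg hk.re_comp hF.re_comp hcr v
  obtain ⟨b1, b2, b3⟩ := integral_lineDeriv_mul_eq_neg hk.im_comp hF.re_comp hcr v
  obtain ⟨c1, c2, c3⟩ := integral_lineDeriv_mul_eq_neg hk.re_comp hF.im_comp hci v
  obtain ⟨d1, d2, d3⟩ := integral_lineDeriv_mul_eq_neg hk.im_comp hF.im_comp hci v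
  have e1 : (fun x => dirDeriv F v x * k x) = fun x =>
      (((lineDeriv ℝ (fun x => (F x).re) x v * (k x).re : ℝ) : ℂ)
        - ((lineDeriv ℝ (fun x => (F x).im) x v * (k x).im : ℝ) : ℂ))
      + I * (((lineDeriv ℝ (fun x => (F x).re) x v * (k x).im : ℝ) : ℂ)
        + ((lineDeriv ℝ (fun x => (F x).im) x v * (k x).re : ℝ) : ℂ)) := by
    funext x
    conv_lhs => rw [← re_add_im (k x), dirDeriv]
    push_cast
    linear_combination (((lineDeriv ℝ (fun x => (F x).im) x v : ℝ) : ℂ) * (k x).im) * I_mul_I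
  have e2 : (fun x => F x * dirDeriv k v x) = fun x =>
      ((((F x).re * lineDeriv ℝ (fun x => (k x).re) x v : ℝ) : ℂ)
        - (((F x).im * lineDeriv ℝ (fun x => (k x).im) x v : ℝ) : ℂ))
      + I * ((((F x).re * lineDeriv ℝ (fun x => (k x).im) x v : ℝ) : ℂ)
        + (((F x).im * lineDeriv ℝ (fun x => (k x).re) x v : ℝ) : ℂ)) := by
    funext x
    conv_lhs => rw [← re_add_im (F x), dirDeriv]
    push_cast
    linear_combination (((lineDeriv ℝ (fun x => (k x).im) x v : ℝ) : ℂ) * (F x).im) * I_mul_I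
  refine ⟨?_, ?_, ?_⟩
  · rw [e1]; exact (integral_complex_comb a1 d1 b1 c1).1
  · rw [e2]; exact (integral_complex_comb a2 d2 b2 c2).1
  · rw [e1, e2, (integral_complex_comb a1 d1 b1 c1).2, (integral_complex_comb a2 d2 b2 c2).2,
      a3, b3, c3, d3]
    push_cast
    ring

theorem integral_dbar_mul {F k : ℂ → ℂ} {C D : NNReal} (hF : LipschitzWith C F)
    (hc : HasCompactSupport F) (hk : LipschitzWith D k) :
    ∫ x, dbar F x * k x = -∫ x, F x * dbar k x := by
  obtain ⟨a1, a2, a3⟩ := integral_dirDeriv_mul hF hc hk 1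
  obtain ⟨b1, b2, b3⟩ := integral_dirDeriv_mul hF hc hk I
  have e1 : (fun x => dbar F x * k x) = fun x => (1 / 2 : ℂ) * (dirDeriv F 1 x * k x)
      + (I / 2) * (dirDeriv F I x * k x) := by funext x; rw [dbar]; ring
  have e2 : (fun x => F x * dbar k x) = fun x => (1 / 2 : ℂ) * (F x * dirDeriv k 1 x)
      + (I / 2) * (F x * dirDeriv k I x) := by funext x; rw [dbar]; ring
  rw [e1, e2, integral_add (a1.const_mul _) (b1.const_mul _),
    integral_add (a2.const_mul _) (b2.const_mul _)]
  simp only [integral_const_mul]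
  rw [a3, b3]
  ring

/-- A Lipschitz regularisation of the Cauchy kernel `1 / z`. -/
noncomputable def regKer (c : ℝ) (z : ℂ) : ℂ :=
  (c ^ 2 : ℝ) * (starRingEnd ℂ) z / ((c ^ 2 * ‖z‖ ^ 2 + 1 : ℝ) : ℂ)

/-- The `∂̄`-derivative of `regKer c`. -/
noncomputable def bumpKer (c : ℝ) (z : ℂ) : ℝ := c ^ 2 / (c ^ 2 * ‖z‖ ^ 2 + 1) ^ 2

theorem regKer_den_pos (c : ℝ) (z : ℂ) : 0 < c ^ 2 * ‖z‖ ^ 2 + 1 := by positivity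

theorem bumpKer_nonneg (c : ℝ) (z : ℂ) : 0 ≤ bumpKer c z := by unfold bumpKer; positivity

theorem integrable_bumpKer_one : Integrable (bumpKer 1) := by
  have h := integrable_rpow_neg_one_add_norm_sq (E := ℂ) (r := 4) (μ := volume)
    (by rw [Complex.finrank_real_complex]; norm_num)
  refine h.congr (Eventually.of_forall fun z => ?_)
  have : (-4 / 2 : ℝ) = -((2 : ℕ) : ℝ) := by norm_num
  simp only [bumpKer]
  rw [this, Real.rpow_neg (by positivity), Real.rpow_natCast]
  rw [one_pow, one_mul, one_div, add_comm]

theorem integral_bumpKer_one_pos : 0 < ∫ z, bumpKer 1 z := by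
  rw [integral_pos_iff_support_of_nonneg (bumpKer_nonneg 1) integrable_bumpKer_one]
  have : Function.support (bumpKer 1) = univ := by
    ext z
    simp only [Function.mem_support, mem_univ, iff_true]
    have := regKer_den_pos 1 z
    unfold bumpKer
    positivity
  rw [this]
  simp

theorem hasLineDerivAt_regKer (c : ℝ) (z v : ℂ) :
    HasLineDerivAt ℝ (regKer c) ((c ^ 2 : ℝ) * ((starRingEnd ℂ) v -
      (c ^ 2 : ℝ) * (starRingEnd ℂ) z ^ 2 * v) / ((c ^ 2 * ‖z‖ ^ 2 + 1 : ℝ) : ℂ) ^ 2) z v := by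
  have hn : ∀ x : ℂ, ((c ^ 2 * ‖x‖ ^ 2 + 1 : ℝ) : ℂ)
      = (c ^ 2 : ℝ) * (x * (starRingEnd ℂ) x) + 1 := by
    intro x; rw [Complex.mul_conj, Complex.normSq_eq_norm_sq]; push_cast; ring
  have h1 : HasDerivAt (fun t : ℝ => z + t • v) v 0 := by
    simpa using ((hasDerivAt_id (0 : ℝ)).smul_const v).const_add z
  have h2 : HasDerivAt (fun t : ℝ => (starRingEnd ℂ) (z + t • v)) ((starRingEnd ℂ) v) 0 :=
    conjCLE.toContinuousLinearMap.hasFDerivAt.comp_hasDerivAt (0 : ℝ) h1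
  have h3 := (((h1.mul h2).const_mul ((c ^ 2 : ℝ) : ℂ)).add_const 1)
  have hne : ((c ^ 2 : ℝ) : ℂ) * ((z + (0 : ℝ) • v) * (starRingEnd ℂ) (z + (0 : ℝ) • v)) + 1 ≠ 0 := by
    rw [← hn]; exact ofReal_ne_zero.2 (regKer_den_pos c _).ne'
  have h4 := (h2.const_mul ((c ^ 2 : ℝ) : ℂ)).div h3 hne
  have h5 : (fun t : ℝ => regKer c (z + t • v)) = fun t : ℝ =>
      (c ^ 2 : ℝ) * (starRingEnd ℂ) (z + t • v) /
      (((c ^ 2 : ℝ) : ℂ) * ((z + t • v) * (starRingEnd ℂ) (z + t • v)) + 1) := by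
    funext t; rw [regKer, hn]
  rw [HasLineDerivAt, h5]
  refine h4.congr_deriv ?_
  rw [hn]
  simp only [zero_smul, add_zero]
  congr 1 <;> simp only [Pi.mul_apply, zero_smul, add_zero]
  ring

theorem dbar_regKer (c : ℝ) (z : ℂ) : dbar (regKer c) z = bumpKer c z := by
  rw [dbar, dirDeriv_of_hasLineDerivAt (hasLineDerivAt_regKer c z 1),
    dirDeriv_of_hasLineDerivAt (hasLineDerivAt_regKer c z I), bumpKer]
  have : ((c ^ 2 * ‖z‖ ^ 2 + 1 : ℝ) : ℂ) ≠ 0 := ofReal_ne_zero.2 (regKer_den_pos c z).ne'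
  rw [ofReal_div, ofReal_pow (c ^ 2 * ‖z‖ ^ 2 + 1)]
  simp only [map_one, conj_I]
  field_simp
  linear_combination -((c ^ 2 : ℝ) * (1 + (c ^ 2 : ℝ) * (starRingEnd ℂ) z ^ 2)) * I_sq

theorem lipschitzWith_regKer (c : ℝ) : LipschitzWith (Real.toNNReal (c ^ 2)) (regKer c) := by
  refine LipschitzWith.of_dist_le_mul fun z w => ?_
  rw [Real.coe_toNNReal _ (sq_nonneg c), dist_eq_norm, dist_eq_norm]
  have hz := regKer_den_pos c z
  have hw := regKer_den_pos c w
  have hz' : ((c ^ 2 * ‖z‖ ^ 2 + 1 : ℝ) : ℂ) ≠ 0 := ofReal_ne_zero.2 hz.ne'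
  have hw' : ((c ^ 2 * ‖w‖ ^ 2 + 1 : ℝ) : ℂ) ≠ 0 := ofReal_ne_zero.2 hw.ne'
  have hn : ∀ x : ℂ, ((c ^ 2 * ‖x‖ ^ 2 + 1 : ℝ) : ℂ)
      = (c ^ 2 : ℝ) * (x * (starRingEnd ℂ) x) + 1 := by
    intro x; rw [Complex.mul_conj, Complex.normSq_eq_norm_sq]; push_cast; ring
  have e : regKer c z - regKer c w = (c ^ 2 : ℝ) * ((starRingEnd ℂ) (z - w) +
      (c ^ 2 : ℝ) * ((starRingEnd ℂ) z * (starRingEnd ℂ) w * (w - z))) /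
      (((c ^ 2 * ‖z‖ ^ 2 + 1 : ℝ) : ℂ) * ((c ^ 2 * ‖w‖ ^ 2 + 1 : ℝ) : ℂ)) := by
    rw [regKer, regKer, div_sub_div _ _ hz' hw', hn, hn, map_sub]
    congr 1
    ring
  rw [e, norm_div, norm_mul, norm_mul, Complex.norm_real, Complex.norm_real, Complex.norm_real,
    Real.norm_of_nonneg (sq_nonneg c), Real.norm_of_nonneg hz.le, Real.norm_of_nonneg hw.le,
    div_le_iff₀ (by positivity)]
  have h1 : ‖(starRingEnd ℂ) (z - w) + (c ^ 2 : ℝ) * ((starRingEnd ℂ) z * (starRingEnd ℂ) w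
      * (w - z))‖ ≤ ‖z - w‖ * (1 + c ^ 2 * (‖z‖ * ‖w‖)) := by
    refine (norm_add_le _ _).trans ?_
    rw [norm_mul, norm_mul, norm_mul, Complex.norm_real, Real.norm_of_nonneg (sq_nonneg c),
      RCLike.norm_conj, RCLike.norm_conj, RCLike.norm_conj, norm_sub_rev w z]
    linarith
  have h2 : 1 + c ^ 2 * (‖z‖ * ‖w‖) ≤ (c ^ 2 * ‖z‖ ^ 2 + 1) * (c ^ 2 * ‖w‖ ^ 2 + 1) := by
    have : 0 ≤ c ^ 2 * (‖z‖ - ‖w‖) ^ 2 := by positivity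
    have : 0 ≤ c ^ 2 * (‖z‖ * ‖w‖) := by positivity
    have : 0 ≤ (c ^ 2 * (‖z‖ * ‖w‖)) ^ 2 := by positivity
    nlinarith
  calc c ^ 2 * ‖_‖ ≤ c ^ 2 * (‖z - w‖ * (1 + c ^ 2 * (‖z‖ * ‖w‖))) := by gcongr
    _ ≤ c ^ 2 * (‖z - w‖ * ((c ^ 2 * ‖z‖ ^ 2 + 1) * (c ^ 2 * ‖w‖ ^ 2 + 1))) := by gcongr
    _ = _ := by ring

theorem norm_regKer_le (c : ℝ) (z : ℂ) : ‖regKer c z‖ ≤ ‖z‖⁻¹ := by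
  rcases eq_or_ne z 0 with rfl | hz
  · simp [regKer]
  have h := regKer_den_pos c z
  rw [regKer, norm_div, norm_mul, Complex.norm_real, Complex.norm_real, RCLike.norm_conj,
    Real.norm_of_nonneg (sq_nonneg c), Real.norm_of_nonneg h.le, div_le_iff₀ h]
  have : 0 < ‖z‖ := norm_pos_iff.2 hz
  have : ‖z‖⁻¹ * (c ^ 2 * ‖z‖ ^ 2 + 1) = c ^ 2 * ‖z‖ + ‖z‖⁻¹ := by field_simp
  rw [this]
  have : 0 < ‖z‖⁻¹ := by positivity
  linarith

theorem tendsto_den {r : ℝ} (hr : 0 < r) :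
    Tendsto (fun c : ℝ => c ^ 2 / (c ^ 2 * r + 1)) atTop (nhds r⁻¹) := by
  have h1 : Tendsto (fun c : ℝ => (r + (c ^ 2)⁻¹)⁻¹) atTop (nhds (r + 0)⁻¹) :=
    ((tendsto_inv_atTop_zero.comp (tendsto_pow_atTop two_ne_zero)).const_add r).inv₀
      (by simpa using hr.ne')
  rw [add_zero] at h1
  refine h1.congr' ?_
  filter_upwards [eventually_gt_atTop 0] with c hc
  field_simp

theorem tendsto_regKer {z : ℂ} (hz : z ≠ 0) :
    Tendsto (fun c : ℝ => regKer c z) atTop (nhds z⁻¹) := by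
  have h1 := (Complex.continuous_ofReal.tendsto _).comp
    (tendsto_den (r := ‖z‖ ^ 2) (by positivity))
  have h2 := h1.mul_const ((starRingEnd ℂ) z)
  have e : (((‖z‖ ^ 2)⁻¹ : ℝ) : ℂ) * (starRingEnd ℂ) z = z⁻¹ := by
    rw [Complex.inv_def, Complex.normSq_eq_norm_sq, mul_comm]
  rw [e] at h2
  refine h2.congr fun c => ?_
  simp only [Function.comp, regKer]
  push_cast
  ring

theorem dirDeriv_comp_sub (F : ℂ → ℂ) (ζ v z : ℂ) :
    dirDeriv (fun x => F (x - ζ)) v z = dirDeriv F v (z - ζ) := by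
  simp only [dirDeriv, lineDeriv, add_sub_right_comm]

theorem dbar_comp_sub (F : ℂ → ℂ) (ζ z : ℂ) :
    dbar (fun x => F (x - ζ)) z = dbar F (z - ζ) := by
  simp only [dbar, dirDeriv_comp_sub]

theorem bumpKer_eq (c : ℝ) (z : ℂ) : bumpKer c z = c ^ 2 * bumpKer 1 (c • z) := by
  rw [bumpKer, bumpKer, norm_smul, Real.norm_eq_abs, mul_pow, sq_abs]
  ring

theorem tendsto_sq_mul_bumpKer (k : ℝ) :
    Tendsto (fun x : ℂ => ‖x‖ ^ 2 * (k * bumpKer 1 x)) (cobounded ℂ) (nhds 0) := by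
  have a : Tendsto (fun x : ℂ => ‖x‖ ^ 2) (cobounded ℂ) atTop :=
    (tendsto_pow_atTop two_ne_zero).comp tendsto_norm_cobounded_atTop
  have b : Tendsto (fun x : ℂ => (‖x‖ ^ 2)⁻¹) (cobounded ℂ) (nhds 0) :=
    tendsto_inv_atTop_zero.comp a
  have h1 : Tendsto (fun x : ℂ => |k| * (‖x‖ ^ 2)⁻¹) (cobounded ℂ) (nhds 0) := by
    simpa using b.const_mul |k|
  refine squeeze_zero_norm (fun x => ?_) h1
  rcases eq_or_ne x 0 with rfl | hx
  · simp
  have hx' : 0 < ‖x‖ := norm_pos_iff.2 hx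
  have h2 : ‖x‖ ^ 2 * bumpKer 1 x ≤ (‖x‖ ^ 2)⁻¹ := by
    rw [bumpKer, one_pow, one_mul, ← mul_div_assoc, mul_one, div_le_iff₀ (by positivity)]
    have h3 : (‖x‖ ^ 2)⁻¹ * (‖x‖ ^ 2 + 1) ^ 2 = ‖x‖ ^ 2 + 2 + (‖x‖ ^ 2)⁻¹ := by
      field_simp; ring
    rw [h3]
    have : 0 < (‖x‖ ^ 2)⁻¹ := by positivity
    linarith
  have h4 := bumpKer_nonneg 1 x
  calc ‖‖x‖ ^ 2 * (k * bumpKer 1 x)‖ = |k| * (‖x‖ ^ 2 * bumpKer 1 x) := by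
        rw [Real.norm_eq_abs, abs_mul, abs_mul, abs_of_nonneg h4, abs_of_nonneg (sq_nonneg _)]
        ring
    _ ≤ _ := by gcongr

theorem tendsto_integral_bumpKer {F : ℂ → ℂ} (hF : Integrable F) {ζ : ℂ} (hζ : ContinuousAt F ζ) :
    Tendsto (fun c : ℝ => ∫ x, F x * (bumpKer c (x - ζ) : ℂ)) atTop
      (nhds ((∫ z, bumpKer 1 z : ℝ) * F ζ)) := by
  generalize hκ : ∫ z, bumpKer 1 z = κ
  have hκ0 : 0 < κ := hκ ▸ integral_bumpKer_one_pos
  have hlim : Tendsto (fun x : ℂ => ‖x‖ ^ Module.finrank ℝ ℂ * (κ⁻¹ * bumpKer 1 x))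
      (cobounded ℂ) (nhds 0) := by
    rw [Complex.finrank_real_complex]
    exact tendsto_sq_mul_bumpKer _
  have h := tendsto_integral_comp_smul_smul_of_integrable' (μ := volume)
    (φ := fun x => κ⁻¹ * bumpKer 1 x)
    (fun x => mul_nonneg (inv_nonneg.2 hκ0.le) (bumpKer_nonneg 1 x))
    (by rw [integral_const_mul, hκ]; exact inv_mul_cancel₀ hκ0.ne') hlim hF hζ
  refine (h.const_mul (κ : ℂ)).congr fun c => ?_
  rw [← integral_const_mul]
  congr 1
  funext x
  rw [Complex.finrank_real_complex, Complex.real_smul, bumpKer_eq c, ← neg_sub ζ x, smul_neg]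
  have : bumpKer 1 (-(c • (ζ - x))) = bumpKer 1 (c • (ζ - x)) := by
    rw [bumpKer, bumpKer, norm_neg]
  rw [this]
  have : (κ : ℂ) ≠ 0 := ofReal_ne_zero.2 hκ0.ne'
  push_cast
  field_simp

/-- The Cauchy-Pompeiu formula for a compactly supported Lipschitz function which is holomorphic
near the point of evaluation. -/
theorem cauchy_pompeiu {F : ℂ → ℂ} {C : NNReal} (hF : LipschitzWith C F)
    (hc : HasCompactSupport F) {ζ : ℂ} (h0 : ∀ᶠ z in nhds ζ, dbar F z = 0) :
    ((∫ z, bumpKer 1 z : ℝ) : ℂ) * F ζ = -∫ z, dbar F z / (z - ζ) := by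
  have h1 := tendsto_integral_bumpKer (hF.continuous.integrable_of_hasCompactSupport hc)
    hF.continuous.continuousAt (ζ := ζ)
  have h2 : ∀ c : ℝ, ∫ x, F x * (bumpKer c (x - ζ) : ℂ)
      = -∫ x, dbar F x * regKer c (x - ζ) := by
    intro c
    have hl : LipschitzWith (Real.toNNReal (c ^ 2)) fun x => regKer c (x - ζ) :=
      LipschitzWith.of_dist_le_mul fun x y => by
        simpa using (lipschitzWith_regKer c).dist_le_mul (x - ζ) (y - ζ)
    rw [integral_dbar_mul hF hc hl, neg_neg]
    simp only [dbar_comp_sub, dbar_regKer]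
  obtain ⟨r, hr, hb⟩ := Metric.eventually_nhds_iff_ball.1 h0
  have hdm := measurable_dbar hF.continuous
  have hbound : ∀ (c : ℝ) x, ‖dbar F x * regKer c (x - ζ)‖ ≤ ‖dbar F x‖ * r⁻¹ := by
    intro c x
    by_cases hx : x ∈ ball ζ r
    · rw [hb x hx]; simp
    · rw [norm_mul]
      gcongr
      refine (norm_regKer_le c _).trans ?_
      rw [mem_ball, dist_eq_norm, not_lt] at hx
      gcongr
  have hInt : Integrable (fun x => ‖dbar F x‖ * r⁻¹) := by
    refine Integrable.mul_const (Integrable.norm ?_) _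
    exact integrable_of_bound_of_compact hdm.aestronglyMeasurable hc.isCompact
      (fun x _ => norm_dbar_le_of_lipschitz hF x) fun x hx => dbar_eq_zero_of_notMem_tsupport hx
  have h3 : Tendsto (fun c : ℝ => ∫ x, dbar F x * regKer c (x - ζ)) atTop
      (nhds (∫ x, dbar F x / (x - ζ))) := by
    refine tendsto_integral_filter_of_dominated_convergence _ (Eventually.of_forall fun c => ?_)
      (Eventually.of_forall fun c => Eventually.of_forall (hbound c)) hInt
      (Eventually.of_forall fun x => ?_)
    · exact hdm.aestronglyMeasurable.mul
        ((lipschitzWith_regKer c).continuous.comp (by fun_prop)).aestronglyMeasurable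
    · rcases eq_or_ne x ζ with rfl | hx
      · rw [hb x (mem_ball_self hr)]; simp
      · rw [div_eq_mul_inv]
        exact (tendsto_regKer (sub_ne_zero.2 hx)).const_mul _
  simp only [h2] at h1
  exact tendsto_nhds_unique h1 h3.neg

theorem enorm_sq_mul_le_lintegral_circle {g : ℂ → ℂ} {p : ℂ} {ρ r : ℝ}
    (hg : DifferentiableOn ℂ g (ball p ρ)) (hr : 0 < r) (hrρ : r < ρ) :
    ENNReal.ofReal (2 * Real.pi) * ‖g p‖ₑ ^ 2 ≤
      ∫⁻ θ in Ioo (-Real.pi) Real.pi, ‖g (circleMap p r θ)‖ₑ ^ 2 := by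
  have hd : DiffContOnCl ℂ (fun z => g z ^ 2) (ball p |r|) := by
    rw [abs_of_pos hr]
    refine DifferentiableOn.diffContOnCl ?_
    rw [closure_ball p hr.ne']
    exact (hg.mono (closedBall_subset_ball hrρ)).pow 2
  have h := hd.circleAverage
  rw [Real.circleAverage_def, inv_smul_eq_iff₀ (by positivity)] at h
  have hper : Function.Periodic (fun θ => g (circleMap p r θ) ^ 2) (2 * Real.pi) := fun θ => by
    simp only [periodic_circleMap p r θ]
  have h2 := hper.intervalIntegral_add_eq 0 (-Real.pi)
  rw [zero_add, h, show -Real.pi + 2 * Real.pi = Real.pi by ring,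
    intervalIntegral.integral_of_le (by linarith [Real.pi_pos]), integral_Ioc_eq_integral_Ioo] at h2
  have h3 : ENNReal.ofReal (2 * Real.pi) * ‖g p‖ₑ ^ 2 = ‖(2 * Real.pi) • g p ^ 2‖ₑ := by
    rw [enorm_smul, enorm_pow, Real.enorm_of_nonneg (by positivity)]
  rw [h3, h2]
  refine (enorm_integral_le_lintegral_enorm _).trans (le_of_eq ?_)
  simp only [enorm_pow]

theorem lintegral_ball_eq_polar (p : ℂ) (ρ : ℝ) (f : ℂ → ENNReal) (hf : ContinuousOn f (ball p ρ)) :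
    ∫⁻ z in ball p ρ, f z = ∫⁻ r in Ioi (0 : ℝ), ∫⁻ θ in Ioo (-Real.pi) Real.pi,
      ENNReal.ofReal r * (ball p ρ).indicator f (circleMap p r θ) := by
  have hm : Measurable ((ball p ρ).indicator f) := by
    classical
    rw [← Set.piecewise_eq_indicator]
    exact hf.measurable_piecewise continuousOn_const measurableSet_ball
  rw [← lintegral_indicator measurableSet_ball, ← lintegral_add_left_eq_self _ p,
    ← Complex.lintegral_comp_polarCoord_symm, show polarCoord.target = Ioi (0 : ℝ) ×ˢ Ioo (-Real.pi) Real.pi from rfl,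
    Measure.volume_eq_prod,
    ← Measure.prod_restrict]
  have e : ∀ x : ℝ × ℝ, p + Complex.polarCoord.symm x = circleMap p x.1 x.2 := by
    intro x
    rw [Complex.polarCoord_symm_apply, circleMap, Complex.exp_mul_I]
    push_cast; rfl
  simp only [e, smul_eq_mul]
  rw [lintegral_prod]
  refine Measurable.aemeasurable (Measurable.mul (by fun_prop) (hm.comp ?_))
  unfold circleMap
  fun_prop

/-- The mean value inequality for square-integrable holomorphic functions. -/
theorem enorm_sq_mul_volume_ball_le {g : ℂ → ℂ} {p : ℂ} {ρ : ℝ}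
    (hg : DifferentiableOn ℂ g (ball p ρ)) :
    ‖g p‖ₑ ^ 2 * volume (ball p ρ) ≤ ∫⁻ z in ball p ρ, ‖g z‖ₑ ^ 2 := by
  rw [← setLIntegral_const, lintegral_ball_eq_polar p ρ _ continuousOn_const,
    lintegral_ball_eq_polar p ρ (fun z => ‖g z‖ₑ ^ 2) ((ENNReal.continuous_pow 2).comp_continuousOn
      (continuous_enorm.comp_continuousOn hg.continuousOn))]
  refine setLIntegral_mono_ae' measurableSet_Ioi (Eventually.of_forall fun r hr => ?_)
  rw [mem_Ioi] at hr
  have hmem : ∀ θ, circleMap p r θ ∈ ball p ρ ↔ r < ρ := fun θ => by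
    rw [mem_ball, dist_eq_norm, circleMap_sub_center, norm_circleMap_zero, abs_of_pos hr]
  by_cases hrρ : r < ρ
  · simp only [indicator_of_mem ((hmem _).2 hrρ)]
    rw [lintegral_const_mul' _ _ ENNReal.ofReal_ne_top, lintegral_const_mul' _ _ ENNReal.ofReal_ne_top]
    refine mul_le_mul_right ?_ _
    refine le_trans (le_of_eq ?_) (enorm_sq_mul_le_lintegral_circle hg hr hrρ)
    rw [setLIntegral_const, Real.volume_Ioo, mul_comm]
    congr 2
    ring
  · simp only [indicator_of_notMem fun h => hrρ ((hmem _).1 h)]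
    exact le_rfl

theorem norm_le_of_lintegral {g : ℂ → ℂ} {p : ℂ} {ρ V : ℝ} (hρ : 0 < ρ) (hV : 0 ≤ V)
    (hg : DifferentiableOn ℂ g (ball p ρ))
    (h : ∫⁻ z in ball p ρ, ‖g z‖ₑ ^ 2 ≤ ENNReal.ofReal (V ^ 2)) : ‖g p‖ * ρ ≤ V := by
  have h1 := (enorm_sq_mul_volume_ball_le hg).trans h
  rw [volume_ball_eq_ofReal p hρ.le, ← ofReal_norm, ← ENNReal.ofReal_pow (norm_nonneg _),
    ← ENNReal.ofReal_mul (by positivity), ENNReal.ofReal_le_ofReal_iff (by positivity)] at h1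
  refine abs_le_of_sq_le_sq' ?_ hV |>.2
  have := Real.pi_gt_three
  have : 0 ≤ ‖g p‖ ^ 2 * ρ ^ 2 := by positivity
  nlinarith

theorem norm_sub_le_card_mul {ι : Type*} {U : Set ℂ} (hU : IsPreconnected U) {γ : ℂ → ℂ}
    (hγ : ContinuousOn γ U) (t : Finset ι) (B : ι → Set ℂ) (hB : U ⊆ ⋃ c ∈ t, B c) {W : ℝ}
    (hW0 : 0 ≤ W) (hW : ∀ c ∈ t, ∀ x ∈ U ∩ B c, ∀ y ∈ U ∩ B c, ‖γ x - γ y‖ ≤ W)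
    {x y : ℂ} (hx : x ∈ U) (hy : y ∈ U) : ‖γ y - γ x‖ ≤ t.card * W := by
  set φ : ℂ → ℝ := fun w => ‖γ w - γ x‖ with hφ
  have hφc : ContinuousOn φ U := (hγ.sub continuousOn_const).norm
  have hord := (hU.image φ hφc).ordConnected
  have hsub : Icc 0 (φ y) ⊆ φ '' U :=
    hord.out ⟨x, hx, by simp [hφ]⟩ ⟨y, hy, rfl⟩
  have hcov : Icc 0 (φ y) ⊆ ⋃ c ∈ t, φ '' (U ∩ B c) := by
    intro s hs
    obtain ⟨w, hw, rfl⟩ := hsub hs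
    obtain ⟨c, hc, hwc⟩ := mem_iUnion₂.1 (hB hw)
    exact mem_iUnion₂.2 ⟨c, hc, w, ⟨hw, hwc⟩, rfl⟩
  have h1 : ENNReal.ofReal (φ y) ≤ ∑ c ∈ t, ENNReal.ofReal W := by
    calc ENNReal.ofReal (φ y) = volume (Icc 0 (φ y)) := by rw [Real.volume_Icc, sub_zero]
      _ ≤ volume (⋃ c ∈ t, φ '' (U ∩ B c)) := measure_mono hcov
      _ ≤ ∑ c ∈ t, volume (φ '' (U ∩ B c)) := measure_biUnion_finset_le _ _
      _ ≤ _ := by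
        refine Finset.sum_le_sum fun c hc => (Real.volume_le_diam _).trans ?_
        refine ediam_le ?_
        rintro _ ⟨p, hp, rfl⟩ _ ⟨q, hq, rfl⟩
        rw [edist_dist, Real.dist_eq]
        refine ENNReal.ofReal_le_ofReal ((abs_norm_sub_norm_le _ _).trans ?_)
        rw [sub_sub_sub_cancel_right]
        exact hW c hc p hp q hq
  rw [Finset.sum_const, nsmul_eq_mul, ← ENNReal.ofReal_natCast, ← ENNReal.ofReal_mul (by positivity),
    ENNReal.ofReal_le_ofReal_iff (by positivity)] at h1
  exact h1

theorem exists_cover_scaled {R ρ : ℝ} (hρ : 0 < ρ) : ∃ t : Finset ℂ, ∀ (z : ℂ) (s : ℝ), 0 < s →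
    closedBall z (R * s) ⊆ ⋃ c ∈ t, ball (z + s * c) (ρ * s) := by
  obtain ⟨t, -, ht⟩ := (isCompact_closedBall (0 : ℂ) R).elim_finite_subcover_image
    (b := univ) (c := fun c => ball c ρ) (fun _ _ => isOpen_ball)
    (fun x _ => mem_iUnion₂.2 ⟨x, mem_univ _, mem_ball_self hρ⟩)
  obtain ⟨hf, ht⟩ := ht
  refine ⟨hf.toFinset, fun z s hs x hx => ?_⟩
  have hs' : (s : ℂ) ≠ 0 := ofReal_ne_zero.2 hs.ne'
  have hx' : (x - z) / s ∈ closedBall (0 : ℂ) R := by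
    rw [mem_closedBall_zero_iff, norm_div, Complex.norm_real, Real.norm_of_nonneg hs.le,
      div_le_iff₀ hs]
    rwa [mem_closedBall, dist_eq_norm] at hx
  obtain ⟨c, hc, hxc⟩ := mem_iUnion₂.1 (ht hx')
  refine mem_iUnion₂.2 ⟨c, hf.mem_toFinset.2 hc, ?_⟩
  rw [mem_ball, dist_eq_norm] at hxc ⊢
  have e : x - (z + s * c) = s * ((x - z) / s - c) := by field_simp; ring
  rw [e, norm_mul, Complex.norm_real, Real.norm_of_nonneg hs.le, mul_comm]
  gcongr

namespace IsClosedQuasidisk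

variable {J K : Set ℂ} {M : ℝ}

theorem exists_norm_sub_le (h : IsClosedQuasidisk J K M) : ∃ C : ℝ, 0 < C ∧
    ∀ (γ : ℂ → ℂ) (z : ℂ) (s V : ℝ), DifferentiableOn ℂ γ Kᶜ → 0 < s → 0 ≤ V →
    (∀ x, ‖x - z‖ ≤ 97 * M * s → (1 / (16 * M)) ^ 2 / 16 * s ≤ infDist x K →
      ‖deriv γ x‖ * s ≤ V) →
    ∀ w w', ‖w - z‖ ≤ 5 * s → ‖w' - z‖ ≤ 5 * s → 1 / (16 * M) / 8 * s ≤ infDist w K →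
      1 / (16 * M) / 8 * s ≤ infDist w' K → ‖γ w - γ w'‖ ≤ C * V := by
  have hM := h.one_le
  set η := 1 / (16 * M) with hη
  have hη0 : 0 < η := by positivity
  have hMη : M * η = 1 / 16 := by rw [hη]; field_simp
  have hη1 : η ≤ 1 / 16 := by nlinarith
  have hη2 : η ^ 2 ≤ 1 / 256 := by nlinarith
  obtain ⟨t, ht⟩ := exists_cover_scaled (R := 96 * M) (ρ := η ^ 2 / 32) (by positivity)
  refine ⟨t.card + 1, by positivity, fun γ z s V hγ hs hV hb w w' hw hw' hwd hwd' => ?_⟩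
  have hww : ‖w' - w‖ ≤ 10 * s := by
    calc ‖w' - w‖ = ‖(w' - z) - (w - z)‖ := by ring_nf
      _ ≤ _ := norm_sub_le _ _
      _ ≤ _ := by linarith
  obtain ⟨U, hU, hw'U, hwU, hUb⟩ := h.exists_link (t := η / 8 * s) (R := 10 * s) (by positivity)
    (by positivity) hwd' hwd hww
  rw [← hη] at hUb
  have hUd : ∀ x ∈ U, η ^ 2 / 8 * s ≤ infDist x K := fun x hx => by
    have := (hUb x hx).1
    nlinarith
  have hUz : ∀ x ∈ U, ‖x - z‖ ≤ 96 * M * s := fun x hx => by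
    have h1 := (hUb x hx).2
    have h2 : ‖x - z‖ ≤ ‖x - w'‖ + ‖w' - z‖ := norm_sub_le_norm_sub_add_norm_sub _ _ _
    have h3 : η * s ≤ 1 * s := by gcongr; linarith
    have h4 : 1 * s ≤ M * s := by gcongr
    nlinarith
  have hUK : ∀ x, 0 < infDist x K → x ∈ Kᶜ := fun x hx hxK => by
    rw [infDist_zero_of_mem hxK] at hx; exact lt_irrefl _ hx
  have hUsub : U ⊆ Kᶜ := fun x hx => hUK x (lt_of_lt_of_le (by positivity) (hUd x hx))
  have hfin := norm_sub_le_card_mul hU (hγ.continuousOn.mono hUsub) t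
    (fun c => ball (z + s * c) (η ^ 2 / 32 * s)) (fun x hx => ht z s hs (by
      rw [mem_closedBall, dist_eq_norm]; exact hUz x hx)) hV ?_ hw'U hwU
  · refine hfin.trans ?_
    nlinarith
  · rintro c - x ⟨hxU, hxc⟩ y ⟨hyU, hyc⟩
    have hxy : ‖y - x‖ < η ^ 2 / 16 * s := by
      rw [mem_ball] at hxc hyc
      rw [← dist_eq_norm]
      have := dist_triangle_right y x (z + s * c)
      linarith
    have hseg : ∀ p ∈ ball x (η ^ 2 / 16 * s), ‖p - z‖ ≤ 97 * M * s ∧ η ^ 2 / 16 * s ≤ infDist p K := by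
      intro p hp
      rw [mem_ball, dist_eq_norm] at hp
      constructor
      · have h2 : ‖p - z‖ ≤ ‖p - x‖ + ‖x - z‖ := norm_sub_le_norm_sub_add_norm_sub _ _ _
        have h3 := hUz x hxU
        have h5 : η ^ 2 / 16 * s ≤ 1 * s := by gcongr; linarith
        have h4 : 1 * s ≤ M * s := by gcongr
        linarith
      · have h2 : infDist x K ≤ infDist p K + dist x p := infDist_le_infDist_add_dist
        have h3 := hUd x hxU
        rw [dist_eq_norm, norm_sub_rev] at h2
        linarith
    have hconv := (convex_ball x (η ^ 2 / 16 * s)).norm_image_sub_le_of_norm_deriv_le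
      (𝕜 := ℂ) (f := γ) (C := V / s) (fun p hp => hγ.differentiableAt
        (h.isCompact.isClosed.isOpen_compl.mem_nhds (hUK p
          (lt_of_lt_of_le (by positivity) (hseg p hp).2))))
      (fun p hp => (le_div_iff₀ hs).2 (hb p (hseg p hp).1 (hseg p hp).2))
      (x := y) (y := x) (by rwa [mem_ball, dist_eq_norm]) (mem_ball_self (by positivity))
    refine hconv.trans ?_
    rw [norm_sub_rev]
    calc V / s * ‖y - x‖ ≤ V / s * s := by
          gcongr
          nlinarith
      _ = V := by field_simp

end IsClosedQuasidisk

/-- The average of `γ` with respect to the weight `k`. -/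
noncomputable def wavg (k : ℂ → ℝ) (γ : ℂ → ℂ) : ℂ :=
  (∫ w, (k w : ℂ) * γ w) / ((∫ w, k w : ℝ) : ℂ)

theorem wavg_sub_eq {k : ℂ → ℝ} {γ : ℂ → ℂ} (hk : Integrable k)
    (hkγ : Integrable fun w => (k w : ℂ) * γ w) (hpos : 0 < ∫ w, k w) (c : ℂ) :
    wavg k γ - c = (∫ w, (k w : ℂ) * (γ w - c)) / ((∫ w, k w : ℝ) : ℂ) := by
  have h0 : ((∫ w, k w : ℝ) : ℂ) ≠ 0 := ofReal_ne_zero.2 hpos.ne'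
  have hkc : Integrable fun w => (k w : ℂ) := hk.ofReal
  simp only [mul_sub]
  rw [integral_sub hkγ (hkc.mul_const c), integral_mul_const, integral_complex_ofReal, wavg]
  field_simp

theorem norm_wavg_sub_le {k : ℂ → ℝ} {γ : ℂ → ℂ} (hk : Integrable k) (hk0 : ∀ w, 0 ≤ k w)
    (hkγ : Integrable fun w => (k w : ℂ) * γ w) (hpos : 0 < ∫ w, k w) {c : ℂ} {V : ℝ}
    (hV : ∀ w, k w ≠ 0 → ‖γ w - c‖ ≤ V) : ‖wavg k γ - c‖ ≤ V := by
  rw [wavg_sub_eq hk hkγ hpos, norm_div, Complex.norm_real, Real.norm_of_nonneg hpos.le,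
    div_le_iff₀ hpos, mul_comm V, ← integral_mul_const]
  refine norm_integral_le_of_norm_le (hk.mul_const V) (Eventually.of_forall fun w => ?_)
  rw [norm_mul, Complex.norm_real, Real.norm_of_nonneg (hk0 w)]
  by_cases hw : k w = 0
  · simp [hw]
  · exact mul_le_mul_of_nonneg_left (hV w hw) (hk0 w)

theorem norm_wavg_sub_wavg_le {k₁ k₂ : ℂ → ℝ} {γ : ℂ → ℂ} {S : Set ℂ} {z : ℂ} {R L V m : ℝ}
    (hk₁ : Integrable k₁) (hk₂ : Integrable k₂) (h0₁ : ∀ w, 0 ≤ k₁ w)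
    (hγ₁ : Integrable fun w => (k₁ w : ℂ) * γ w) (hγ₂ : Integrable fun w => (k₂ w : ℂ) * γ w)
    (hS₁ : ∀ w, k₁ w ≠ 0 → w ∈ S) (hS₂ : ∀ w, k₂ w ≠ 0 → w ∈ S)
    (hV : ∀ w ∈ S, ∀ w' ∈ S, ‖γ w - γ w'‖ ≤ V) (hV0 : 0 ≤ V) (hL0 : 0 ≤ L)
    (hL : ∀ w ∈ S, |k₂ w - k₁ w| ≤ L) (hSR : S ⊆ closedBall z R) (hR : 0 ≤ R) (hm : 0 < m)
    (hpos : 0 < ∫ w, k₁ w) (hm₂ : m ≤ ∫ w, k₂ w) :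
    ‖wavg k₂ γ - wavg k₁ γ‖ ≤ V * L * (Real.pi * R ^ 2) / m := by
  set A := wavg k₁ γ with hA
  have hpos₂ : 0 < ∫ w, k₂ w := hm.trans_le hm₂
  have hVA : ∀ w ∈ S, ‖γ w - A‖ ≤ V := fun w hw => by
    rw [norm_sub_rev]
    exact norm_wavg_sub_le hk₁ h0₁ hγ₁ hpos fun w' hw' => hV w' (hS₁ w' hw') w hw
  have hz : ∫ w, (k₁ w : ℂ) * (γ w - A) = 0 := by
    have h := wavg_sub_eq hk₁ hγ₁ hpos A
    rw [← hA, sub_self] at h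
    have h0 : ((∫ w, k₁ w : ℝ) : ℂ) ≠ 0 := ofReal_ne_zero.2 hpos.ne'
    exact ((div_eq_zero_iff.1 h.symm).resolve_right h0)
  have hi : ∀ {k : ℂ → ℝ}, Integrable k → (Integrable fun w => (k w : ℂ) * γ w) →
      Integrable fun w => (k w : ℂ) * (γ w - A) := fun h1 h2 => by
    simp only [mul_sub]; exact h2.sub (h1.ofReal.mul_const A)
  have hd : ∫ w, (k₂ w : ℂ) * (γ w - A) = ∫ w, ((k₂ w : ℂ) - k₁ w) * (γ w - A) := by
    simp only [sub_mul]
    rw [integral_sub (hi hk₂ hγ₂) (hi hk₁ hγ₁), hz, sub_zero]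
  have hn : ‖∫ w, ((k₂ w : ℂ) - k₁ w) * (γ w - A)‖ ≤ V * L * (Real.pi * R ^ 2) := by
    have hc : ∫ _w in closedBall z R, L * V = V * L * (Real.pi * R ^ 2) := by
      rw [setIntegral_const, smul_eq_mul, measureReal_def, volume_closedBall_eq_ofReal z hR,
        ENNReal.toReal_ofReal (by positivity)]
      ring
    rw [← hc, ← integral_indicator measurableSet_closedBall]
    refine norm_integral_le_of_norm_le ?_ (Eventually.of_forall fun w => ?_)
    · rw [integrable_indicator_iff measurableSet_closedBall]
      exact (continuousOn_const.integrableOn_compact (isCompact_closedBall z R))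
    · by_cases hw : w ∈ S
      · rw [indicator_of_mem (hSR hw), norm_mul, ← ofReal_sub, Complex.norm_real, Real.norm_eq_abs]
        exact mul_le_mul (hL w hw) (hVA w hw) (norm_nonneg _) hL0
      · have e1 : k₁ w = 0 := by by_contra hh; exact hw (hS₁ w hh)
        have e2 : k₂ w = 0 := by by_contra hh; exact hw (hS₂ w hh)
        rw [e1, e2]
        simp only [ofReal_zero, sub_self, zero_mul, norm_zero]
        exact indicator_nonneg (fun _ _ => by positivity) _
  rw [wavg_sub_eq hk₂ hγ₂ hpos₂, hd, norm_div, Complex.norm_real, Real.norm_of_nonneg hpos₂.le]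
  gcongr

/-- A continuous weight concentrated on the points near `z` whose distance to `K` is comparable
with `s`. -/
noncomputable def avgKer (K : Set ℂ) (c s : ℝ) (z w : ℂ) : ℝ :=
  max (4 * s - ‖w - z‖) 0 * max (infDist w K - c * s) 0

section avgKer

variable {K : Set ℂ} {c s : ℝ} {z : ℂ}

theorem avgKer_nonneg (w : ℂ) : 0 ≤ avgKer K c s z w :=
  mul_nonneg (le_max_right _ _) (le_max_right _ _)

theorem continuous_avgKer : Continuous (avgKer K c s z) := by
  unfold avgKer
  have := continuous_infDist_pt K
  fun_prop

theorem avgKer_ne_zero {w : ℂ} (h : avgKer K c s z w ≠ 0) : ‖w - z‖ < 4 * s ∧ c * s < infDist w K := by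
  constructor
  · by_contra hh
    exact h (by rw [avgKer, max_eq_right (by linarith), zero_mul])
  · by_contra hh
    exact h (by rw [avgKer, max_eq_right (b := (0 : ℝ)) (a := infDist w K - c * s) (by linarith), mul_zero])

theorem integrable_avgKer_mul {E : Type*} [NormedAddCommGroup E] [NormedSpace ℝ E] {γ : ℂ → E}
    (hγ : ContinuousOn γ Kᶜ) (hc : 0 < c) (hs : 0 < s) :
    Integrable fun w => avgKer K c s z w • γ w := by
  set S := closedBall z (4 * s) ∩ {w | c * s ≤ infDist w K} with hS
  have hSc : IsCompact S := (isCompact_closedBall z (4 * s)).inter_right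
    (isClosed_le continuous_const (continuous_infDist_pt K))
  have hSK : S ⊆ Kᶜ := fun w hw hwK => by
    have h1 : c * s ≤ infDist w K := hw.2
    rw [infDist_zero_of_mem hwK] at h1
    have : 0 < c * s := by positivity
    linarith
  rw [← integrableOn_iff_integrable_of_support_subset (s := S)]
  · exact (continuous_avgKer.continuousOn.smul (hγ.mono hSK)).integrableOn_compact hSc
  · intro w hw
    have h1 : avgKer K c s z w ≠ 0 := fun h0 => hw (by simp only [h0, zero_smul])
    obtain ⟨h2, h3⟩ := avgKer_ne_zero h1
    exact ⟨by rw [mem_closedBall, dist_eq_norm]; exact h2.le, h3.le⟩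

theorem le_integral_avgKer {η : ℝ} (hη : 0 < η) (hη1 : η ≤ 1) (hs : 0 < s) {x : ℂ}
    (hx : ‖x - z‖ ≤ 2 * s) (hd : η * s ≤ infDist x K) :
    Real.pi * η ^ 3 * s ^ 4 / 32 ≤ ∫ w, avgKer K (η / 4) s z w := by
  have hInt : Integrable (avgKer K (η / 4) s z) := by
    simpa using integrable_avgKer_mul (K := K) (z := z) (γ := fun _ => (1 : ℝ)) continuousOn_const
      (by positivity : 0 < η / 4) hs
  have hr : 0 ≤ η / 4 * s := by positivity
  have hc : ∫ _w in ball x (η / 4 * s), s * (η / 2 * s) = Real.pi * η ^ 3 * s ^ 4 / 32 := by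
    rw [setIntegral_const, smul_eq_mul, measureReal_def, volume_ball_eq_ofReal x hr,
      ENNReal.toReal_ofReal (by positivity)]
    ring
  rw [← hc]
  refine le_trans (setIntegral_mono_on ?_ hInt.integrableOn measurableSet_ball fun w hw => ?_)
    (setIntegral_le_integral hInt (Eventually.of_forall avgKer_nonneg))
  · exact integrableOn_const (measure_ball_lt_top.ne)
  · rw [mem_ball] at hw
    have h1 : infDist x K ≤ infDist w K + dist x w := infDist_le_infDist_add_dist
    rw [dist_comm] at h1
    rw [dist_eq_norm] at hw h1
    have h2 : ‖w - z‖ ≤ ‖w - x‖ + ‖x - z‖ := norm_sub_le_norm_sub_add_norm_sub _ _ _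
    have h3 : η / 4 * s ≤ 1 * s := by gcongr; linarith
    refine mul_le_mul ?_ ?_ (by positivity) (le_max_right _ _)
    · exact le_max_of_le_left (by linarith)
    · exact le_max_of_le_left (by linarith)

theorem abs_avgKer_sub_le {s' h : ℝ} {z' w : ℂ} (hc : 0 ≤ c) (hc1 : c ≤ 1) (hs : 0 < s)
    (hsh : |s' - s| ≤ h) (hzh : ‖z' - z‖ ≤ h) (hhs : h ≤ s) (hd : infDist w K ≤ 6 * s) :
    |avgKer K c s' z' w - avgKer K c s z w| ≤ 40 * s * h := by
  rw [avgKer, avgKer]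
  have hs' := abs_le.1 hsh
  have hh : 0 ≤ h := (abs_nonneg _).trans hsh
  have ha : |max (4 * s' - ‖w - z'‖) 0 - max (4 * s - ‖w - z‖) 0| ≤ 5 * h := by
    refine (abs_max_sub_max_le_abs _ _ _).trans ?_
    have h1 := abs_norm_sub_norm_le (w - z') (w - z)
    rw [sub_sub_sub_cancel_left, norm_sub_rev z] at h1
    have h2 := abs_le.1 (h1.trans hzh)
    rw [abs_le]; constructor <;> linarith
  have hb : |max (infDist w K - c * s') 0 - max (infDist w K - c * s) 0| ≤ h := by
    refine (abs_max_sub_max_le_abs _ _ _).trans ?_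
    have e : infDist w K - c * s' - (infDist w K - c * s) = -(c * (s' - s)) := by ring
    rw [e, abs_neg, abs_mul, abs_of_nonneg hc]
    calc c * |s' - s| ≤ 1 * |s' - s| := by gcongr
      _ ≤ h := by linarith
  have ha' : |max (4 * s' - ‖w - z'‖) 0| ≤ 8 * s := by
    rw [abs_of_nonneg (le_max_right _ _)]
    refine max_le ?_ (by linarith)
    linarith [norm_nonneg (w - z')]
  have hb' : |max (infDist w K - c * s) 0| ≤ 6 * s := by
    rw [abs_of_nonneg (le_max_right _ _)]
    refine max_le ?_ (by linarith)
    have : 0 ≤ c * s := by positivity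
    linarith
  generalize max (4 * s' - ‖w - z'‖) 0 = a' at *
  generalize max (4 * s - ‖w - z‖) 0 = a at *
  generalize max (infDist w K - c * s') 0 = b' at *
  generalize max (infDist w K - c * s) 0 = b at *
  have e : a' * b' - a * b = a' * (b' - b) + (a' - a) * b := by ring
  rw [e]
  refine (abs_add_le _ _).trans ?_
  rw [abs_mul, abs_mul]
  calc |a'| * |b' - b| + |a' - a| * |b| ≤ 8 * s * h + 5 * h * (6 * s) := by gcongr
    _ ≤ _ := by nlinarith [mul_nonneg hs.le hh]

/-- The weighted averages of `γ` at two nearby points are close. -/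
theorem norm_wavg_avgKer_sub_le {γ : ℂ → ℂ} (hγ : ContinuousOn γ Kᶜ) {η s' V : ℝ} {z' x x' : ℂ}
    (hη : 0 < η) (hη1 : η ≤ 1) (hs : 0 < s) (hss : |s' - s| ≤ ‖z' - z‖) (hzs : ‖z' - z‖ ≤ s / 8)
    (hx : ‖x - z‖ ≤ 2 * s) (hd : η * s ≤ infDist x K)
    (hx' : ‖x' - z'‖ ≤ 2 * s') (hd' : η * s' ≤ infDist x' K)
    (h6 : ∀ w, ‖w - z‖ ≤ 5 * s → infDist w K ≤ 6 * s) (hV0 : 0 ≤ V)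
    (hV : ∀ w w', ‖w - z‖ ≤ 5 * s → ‖w' - z‖ ≤ 5 * s → η / 8 * s ≤ infDist w K →
      η / 8 * s ≤ infDist w' K → ‖γ w - γ w'‖ ≤ V) :
    ‖wavg (avgKer K (η / 4) s' z') γ - wavg (avgKer K (η / 4) s z) γ‖ ≤
      64000 / η ^ 3 * V / s * ‖z' - z‖ := by
  have hs2 := abs_le.1 (hss.trans hzs)
  have hs'0 : 0 < s' := by linarith
  have hc : 0 < η / 4 := by positivity
  have hInt : ∀ {t : ℝ} {y : ℂ}, 0 < t → Integrable (avgKer K (η / 4) t y) := fun {t y} ht => by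
    simpa using integrable_avgKer_mul (K := K) (z := y) (γ := fun _ => (1 : ℝ)) continuousOn_const
      hc ht
  have hIntγ : ∀ {t : ℝ} {y : ℂ}, 0 < t →
      Integrable fun w => (avgKer K (η / 4) t y w : ℂ) * γ w := fun {t y} ht => by
    simpa only [Complex.real_smul] using integrable_avgKer_mul (K := K) (z := y) hγ hc ht
  have hm : Real.pi * η ^ 3 * s ^ 4 / 64 ≤ ∫ w, avgKer K (η / 4) s' z' w := by
    refine le_trans ?_ (le_integral_avgKer hη hη1 hs'0 hx' hd')
    have h4 : s ^ 4 / 2 ≤ s' ^ 4 := by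
      have : (7 / 8 * s) ^ 4 ≤ s' ^ 4 := by gcongr; linarith
      have : 0 ≤ s ^ 4 := by positivity
      nlinarith
    have : 0 ≤ Real.pi * η ^ 3 := by positivity
    nlinarith
  have hpos : 0 < ∫ w, avgKer K (η / 4) s z w :=
    lt_of_lt_of_le (by positivity) (le_integral_avgKer hη hη1 hs hx hd)
  have h := norm_wavg_sub_wavg_le (k₁ := avgKer K (η / 4) s z) (k₂ := avgKer K (η / 4) s' z')
    (γ := γ) (S := {w | ‖w - z‖ ≤ 5 * s ∧ η / 8 * s ≤ infDist w K}) (z := z) (R := 5 * s)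
    (L := 40 * s * ‖z' - z‖) (V := V) (m := Real.pi * η ^ 3 * s ^ 4 / 64)
    (hInt hs) (hInt hs'0) avgKer_nonneg (hIntγ hs) (hIntγ hs'0) (fun w hw => ?_) (fun w hw => ?_)
    (fun w hw w' hw' => hV w w' hw.1 hw'.1 hw.2 hw'.2) hV0 (by positivity)
    (fun w hw => abs_avgKer_sub_le hc.le (by linarith) hs hss le_rfl (by linarith) (h6 w hw.1))
    (fun w hw => by rw [mem_closedBall, dist_eq_norm]; exact hw.1) (by positivity) (by positivity)
    hpos hm
  · refine h.trans (le_of_eq ?_)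
    have := Real.pi_pos
    field_simp
    ring
  · obtain ⟨h1, h2⟩ := avgKer_ne_zero hw
    have : 0 < η * s := by positivity
    exact ⟨by linarith, by linarith⟩
  · obtain ⟨h1, h2⟩ := avgKer_ne_zero hw
    have h3 : ‖w - z‖ ≤ ‖w - z'‖ + ‖z' - z‖ := norm_sub_le_norm_sub_add_norm_sub _ _ _
    have : η * (7 / 8 * s) ≤ η * s' := by gcongr; linarith
    have : 0 < η * s := by positivity
    exact ⟨by linarith, by linarith⟩

end avgKer

/-- A piecewise linear cutoff, equal to `0` where `infDist z K ≤ δ` and to `1` where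
`2 * δ ≤ infDist z K`. -/
noncomputable def distCutoff (K : Set ℂ) (δ : ℝ) (z : ℂ) : ℝ := max (min (infDist z K / δ - 1) 1) 0

theorem distCutoff_nonneg (K : Set ℂ) (δ : ℝ) (z : ℂ) : 0 ≤ distCutoff K δ z := le_max_right _ _

theorem distCutoff_le_one (K : Set ℂ) (δ : ℝ) (z : ℂ) : distCutoff K δ z ≤ 1 :=
  max_le (min_le_right _ _) zero_le_one

theorem distCutoff_eq_zero {K : Set ℂ} {δ : ℝ} {z : ℂ} (hδ : 0 < δ) (h : infDist z K ≤ δ) :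
    distCutoff K δ z = 0 := by
  have : infDist z K / δ ≤ 1 := (div_le_one hδ).2 h
  exact max_eq_right ((min_le_left _ _).trans (by linarith))

theorem distCutoff_eq_one {K : Set ℂ} {δ : ℝ} {z : ℂ} (hδ : 0 < δ) (h : 2 * δ ≤ infDist z K) :
    distCutoff K δ z = 1 := by
  have : 2 ≤ infDist z K / δ := (le_div_iff₀ hδ).2 h
  rw [distCutoff, min_eq_right (by linarith), max_eq_left zero_le_one]

theorem abs_distCutoff_sub_le {K : Set ℂ} {δ : ℝ} (hδ : 0 < δ) (z z' : ℂ) :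
    |distCutoff K δ z' - distCutoff K δ z| ≤ ‖z' - z‖ / δ := by
  refine (abs_max_sub_max_le_abs _ _ _).trans ?_
  have h1 : |min (infDist z' K / δ - 1) 1 - min (infDist z K / δ - 1) 1| ≤
      |(infDist z' K / δ - 1) - (infDist z K / δ - 1)| := by
    refine (abs_min_sub_min_le_max _ _ _ _).trans ?_
    simp
  refine h1.trans ?_
  rw [sub_sub_sub_cancel_right, ← sub_div, abs_div, abs_of_pos hδ]
  gcongr
  rw [abs_le]
  have h2 : infDist z' K ≤ infDist z K + dist z' z := infDist_le_infDist_add_dist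
  have h3 : infDist z K ≤ infDist z' K + dist z z' := infDist_le_infDist_add_dist
  rw [dist_comm] at h3
  rw [dist_eq_norm] at h2 h3
  constructor <;> linarith

/-- The scale at which averages are taken at `z`. -/
noncomputable def extScale (J : Set ℂ) (δ : ℝ) (z : ℂ) : ℝ := δ + infDist z J

/-- An extension of `γ` from the points at distance at least `2 * δ` from `K` to the plane. -/
noncomputable def avgExt (J K : Set ℂ) (η δ : ℝ) (γ : ℂ → ℂ) (z : ℂ) : ℂ :=
  wavg (avgKer K (η / 4) (extScale J δ z) z) γ +
    distCutoff K δ z * (γ z - wavg (avgKer K (η / 4) (extScale J δ z) z) γ)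

theorem avgExt_eq_self {J K : Set ℂ} {η δ : ℝ} {γ : ℂ → ℂ} {z : ℂ} (hδ : 0 < δ)
    (h : 2 * δ ≤ infDist z K) : avgExt J K η δ γ z = γ z := by
  rw [avgExt, distCutoff_eq_one hδ h]; simp

theorem abs_extScale_sub_le (J : Set ℂ) (δ : ℝ) (z z' : ℂ) :
    |extScale J δ z' - extScale J δ z| ≤ ‖z' - z‖ := by
  rw [extScale, extScale, add_sub_add_left_eq_sub, abs_le]
  have h2 : infDist z' J ≤ infDist z J + dist z' z := infDist_le_infDist_add_dist
  have h3 : infDist z J ≤ infDist z' J + dist z z' := infDist_le_infDist_add_dist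
  rw [dist_comm] at h3
  rw [dist_eq_norm] at h2 h3
  constructor <;> linarith

theorem le_extScale (J : Set ℂ) (δ : ℝ) (z : ℂ) : δ ≤ extScale J δ z := by
  have : 0 ≤ infDist z J := infDist_nonneg
  rw [extScale]; linarith

namespace IsClosedQuasidisk

variable {J K : Set ℂ} {M : ℝ}

theorem infDist_le (h : IsClosedQuasidisk J K M) (z : ℂ) : infDist z K ≤ infDist z J :=
  infDist_le_infDist_of_subset h.subset h.jordan.nonempty

theorem infDist_eq (h : IsClosedQuasidisk J K M) {z : ℂ} (hz : 0 < infDist z K) :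
    infDist z J = infDist z K := by
  refine le_antisymm ?_ (h.infDist_le z)
  obtain ⟨j, hj⟩ := h.exists_nearest
  obtain ⟨-, h2, h3⟩ := hj z
  rw [← h2]
  refine infDist_le_dist_of_mem (h3 fun hzK => ?_)
  rw [infDist_zero_of_mem hzK] at hz
  exact lt_irrefl _ hz

theorem exists_corkscrew (h : IsClosedQuasidisk J K M) {z : ℂ} {s : ℝ} (hs : 0 < s)
    (hz : infDist z J ≤ s) : ∃ x, ‖x - z‖ ≤ 2 * s ∧ 1 / (16 * M) * s ≤ infDist x K := by
  obtain ⟨a, ha, haz⟩ := h.jordan.isCompact.exists_infDist_eq_dist h.jordan.nonempty z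
  obtain ⟨x, hx, hd⟩ := h.exists_mem_sphere ha hs
  refine ⟨x, ?_, hd⟩
  have : ‖x - z‖ ≤ ‖x - a‖ + ‖a - z‖ := norm_sub_le_norm_sub_add_norm_sub _ _ _
  rw [haz, dist_eq_norm, norm_sub_rev] at hz
  linarith

theorem exists_norm_avgExt_sub_le (h : IsClosedQuasidisk J K M) : ∃ C : ℝ, 0 < C ∧
    ∀ (γ : ℂ → ℂ) (δ : ℝ) (z z' : ℂ) (V : ℝ), DifferentiableOn ℂ γ Kᶜ → 0 < δ → 0 ≤ V →
    infDist z K ≤ 3 * δ → ‖z' - z‖ ≤ δ / 8 →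
    (∀ x, ‖x - z‖ ≤ 97 * M * extScale J δ z →
      (1 / (16 * M)) ^ 2 / 16 * extScale J δ z ≤ infDist x K →
      ‖deriv γ x‖ * extScale J δ z ≤ V) →
    ‖avgExt J K (1 / (16 * M)) δ γ z' - avgExt J K (1 / (16 * M)) δ γ z‖ ≤
      C * V / extScale J δ z * ‖z' - z‖ := by
  have hM := h.one_le
  obtain ⟨C₀, hC₀, hosc⟩ := h.exists_norm_sub_le
  set η := 1 / (16 * M) with hη
  have hη0 : 0 < η := by positivity
  have hMη : M * η = 1 / 16 := by rw [hη]; field_simp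
  have hη1 : η ≤ 1 / 16 := by nlinarith
  have hη2 : η ^ 2 ≤ 1 / 256 := by nlinarith
  refine ⟨64000 / η ^ 3 * C₀ + 1 + 4 * C₀, by positivity, fun γ δ z z' V hγ hδ hV hz hzz hb => ?_⟩
  have hδs := le_extScale J δ z
  have hss := abs_extScale_sub_le J δ z z'
  have hδs' := le_extScale J δ z'
  have hJs : infDist z J ≤ extScale J δ z := by rw [extScale]; linarith
  have hJs' : infDist z' J ≤ extScale J δ z' := by rw [extScale]; linarith
  have hs : 0 < extScale J δ z := hδ.trans_le hδs
  have hs' : 0 < extScale J δ z' := hδ.trans_le hδs'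
  have hseq : 0 < infDist z K → extScale J δ z = δ + infDist z K := fun h0 => by
    rw [extScale, h.infDist_eq h0]
  obtain ⟨x, hx, hxd⟩ := h.exists_corkscrew hs hJs
  obtain ⟨x', hx', hxd'⟩ := h.exists_corkscrew hs' hJs'
  rw [← hη] at hxd hxd'
  rw [avgExt, avgExt]
  generalize extScale J δ z = s at *
  generalize extScale J δ z' = s' at *
  have hV1 := hosc γ z s V hγ hs hV hb
  have hA := norm_wavg_avgKer_sub_le hγ.continuousOn hη0 (by linarith) hs hss (by linarith) hx hxd
    hx' hxd' (fun w hw => by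
      have h1 := h.infDist_le w
      have h2 : infDist w J ≤ infDist z J + dist w z := infDist_le_infDist_add_dist
      rw [dist_eq_norm] at h2
      linarith) (by positivity) hV1
  have hdd : |infDist z' K - infDist z K| ≤ ‖z' - z‖ := by
    have h2 : infDist z' K ≤ infDist z K + dist z' z := infDist_le_infDist_add_dist
    have h3 : infDist z K ≤ infDist z' K + dist z z' := infDist_le_infDist_add_dist
    rw [dist_comm] at h3
    rw [dist_eq_norm] at h2 h3
    rw [abs_le]
    constructor <;> linarith
  have hdd' := abs_le.1 hdd
  rcases lt_or_ge (infDist z K) (δ / 2) with hlt | hge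
  · rw [distCutoff_eq_zero hδ (by linarith), distCutoff_eq_zero hδ (by linarith)]
    simp only [ofReal_zero, zero_mul, add_zero]
    refine hA.trans ?_
    have : 64000 / η ^ 3 * (C₀ * V) = (64000 / η ^ 3 * C₀) * V := by ring
    rw [this]
    gcongr
    linarith
  · have hsd := hseq (by linarith)
    have hθ := abs_distCutoff_sub_le (K := K) hδ z z'
    have hθ0 := distCutoff_nonneg K δ z'
    have hθ1 := distCutoff_le_one K δ z'
    have hηs : η / 8 * s ≤ 1 / 8 * s := by gcongr; linarith
    have hηs' : 0 < η * s := by positivity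
    have hγA : ‖wavg (avgKer K (η / 4) s z) γ - γ z‖ ≤ C₀ * V := by
      have hInt : Integrable (avgKer K (η / 4) s z) := by
        simpa using integrable_avgKer_mul (K := K) (z := z) (γ := fun _ => (1 : ℝ))
          continuousOn_const (by positivity : 0 < η / 4) hs
      refine norm_wavg_sub_le hInt avgKer_nonneg ?_ (lt_of_lt_of_le (by positivity)
        (le_integral_avgKer hη0 (by linarith) hs hx hxd)) fun w hw => ?_
      · simpa only [Complex.real_smul] using integrable_avgKer_mul (K := K) (z := z)
          hγ.continuousOn (by positivity : 0 < η / 4) hs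
      · obtain ⟨h1, h2⟩ := avgKer_ne_zero hw
        exact hV1 w z (by linarith) (by rw [sub_self, norm_zero]; positivity) (by linarith)
          (by linarith)
    have hγγ : ‖γ z' - γ z‖ ≤ V / s * ‖z' - z‖ := by
      have hball : ∀ p ∈ ball z (δ / 4), ‖p - z‖ ≤ 97 * M * s ∧ η ^ 2 / 16 * s ≤ infDist p K := by
        intro p hp
        rw [mem_ball, dist_eq_norm] at hp
        constructor
        · have : 1 * s ≤ M * s := by gcongr
          linarith
        · have h3 : infDist z K ≤ infDist p K + dist z p := infDist_le_infDist_add_dist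
          rw [dist_eq_norm, norm_sub_rev] at h3
          have : η ^ 2 / 16 * s ≤ 1 / 16 * s := by gcongr; linarith
          linarith
      refine (convex_ball z (δ / 4)).norm_image_sub_le_of_norm_deriv_le
        (𝕜 := ℂ) (f := γ) (fun p hp => hγ.differentiableAt
          (h.isCompact.isClosed.isOpen_compl.mem_nhds fun hpK => ?_))
        (fun p hp => (le_div_iff₀ hs).2 (hb p (hball p hp).1 (hball p hp).2))
        (mem_ball_self (by positivity)) (by rw [mem_ball, dist_eq_norm]; linarith)
      have h1 := (hball p hp).2
      rw [infDist_zero_of_mem hpK] at h1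
      have : 0 < η ^ 2 / 16 * s := by positivity
      linarith
    have hθ' : |distCutoff K δ z' - distCutoff K δ z| ≤ 4 * ‖z' - z‖ / s := by
      refine hθ.trans ?_
      rw [div_le_div_iff₀ hδ hs]
      have : ‖z' - z‖ * s ≤ ‖z' - z‖ * (4 * δ) := by gcongr; linarith
      linarith
    generalize wavg (avgKer K (η / 4) s z) γ = A at *
    generalize wavg (avgKer K (η / 4) s' z') γ = A' at *
    generalize distCutoff K δ z = θ at *
    generalize distCutoff K δ z' = θ' at *
    have e : A' + θ' * (γ z' - A') - (A + θ * (γ z - A)) =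
        ((1 - θ' : ℝ) : ℂ) * (A' - A) + θ' * (γ z' - γ z) - ((θ' - θ : ℝ) : ℂ) * (A - γ z) := by
      push_cast; ring
    rw [e]
    refine (norm_sub_le _ _).trans ((add_le_add_left (norm_add_le _ _) _).trans ?_)
    rw [norm_mul, norm_mul, norm_mul, Complex.norm_real, Complex.norm_real, Complex.norm_real,
      Real.norm_of_nonneg hθ0, Real.norm_of_nonneg (by linarith : 0 ≤ 1 - θ'), Real.norm_eq_abs]
    calc (1 - θ') * ‖A' - A‖ + θ' * ‖γ z' - γ z‖ + |θ' - θ| * ‖A - γ z‖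
        ≤ 1 * (64000 / η ^ 3 * (C₀ * V) / s * ‖z' - z‖) + 1 * (V / s * ‖z' - z‖) +
          4 * ‖z' - z‖ / s * (C₀ * V) := by
          gcongr
          linarith
      _ = _ := by ring

end IsClosedQuasidisk

theorem ball_subset_compl_of_le_infDist {K : Set ℂ} {x : ℂ} {ρ : ℝ} (h : ρ ≤ infDist x K) :
    ball x ρ ⊆ Kᶜ := fun y hy hyK => by
  have := infDist_le_dist_of_mem (x := x) hyK
  rw [mem_ball, dist_comm] at hy
  linarith

/-- The Whitney-type region around `z` on which the derivative controls the averages. -/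
def whitneySet (J K : Set ℂ) (M δ : ℝ) (z : ℂ) : Set ℂ :=
  {p | ‖p - z‖ < 100 * M * extScale J δ z ∧ (1 / (16 * M)) ^ 2 / 32 * extScale J δ z < infDist p K}

theorem continuous_extScale (J : Set ℂ) (δ : ℝ) : Continuous (extScale J δ) :=
  continuous_const.add (continuous_infDist_pt J)

theorem measurableSet_whitneySet_prod (J K : Set ℂ) (M δ : ℝ) :
    MeasurableSet {q : ℂ × ℂ | q.2 ∈ whitneySet J K M δ q.1} := by
  have h1 := continuous_extScale J δ
  have h2 := continuous_infDist_pt K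
  have e : {q : ℂ × ℂ | q.2 ∈ whitneySet J K M δ q.1} =
      {q | ‖q.2 - q.1‖ < 100 * M * extScale J δ q.1} ∩
      {q | (1 / (16 * M)) ^ 2 / 32 * extScale J δ q.1 < infDist q.2 K} := by
    ext q; exact Iff.rfl
  rw [e]
  refine IsOpen.measurableSet ((isOpen_lt ?_ ?_).inter (isOpen_lt ?_ ?_)) <;> fun_prop

theorem measurableSet_whitneySet (J K : Set ℂ) (M δ : ℝ) (z : ℂ) :
    MeasurableSet (whitneySet J K M δ z) :=
  (measurableSet_whitneySet_prod J K M δ).preimage measurable_prodMk_left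

namespace IsClosedQuasidisk

variable {J K : Set ℂ} {M : ℝ}

theorem whitneySet_subset (h : IsClosedQuasidisk J K M) {δ : ℝ} (hδ : 0 < δ) (z : ℂ) :
    whitneySet J K M δ z ⊆ Kᶜ := fun p hp hpK => by
  have hM := h.one_le
  have h1 := hp.2
  rw [infDist_zero_of_mem hpK] at h1
  have h2 := hδ.trans_le (le_extScale J δ z)
  have : 0 < (1 / (16 * M)) ^ 2 / 32 * extScale J δ z := by positivity
  linarith

theorem exists_norm_avgExt_sub_le_sqrt (h : IsClosedQuasidisk J K M) : ∃ C : ℝ, 0 < C ∧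
    ∀ (γ : ℂ → ℂ) (δ : ℝ) (z z' : ℂ), DifferentiableOn ℂ γ Kᶜ → 0 < δ →
    infDist z K ≤ 3 * δ → ‖z' - z‖ ≤ δ / 8 →
    ∫⁻ p in whitneySet J K M δ z, ‖deriv γ p‖ₑ ^ 2 ≠ ⊤ →
    ‖avgExt J K (1 / (16 * M)) δ γ z' - avgExt J K (1 / (16 * M)) δ γ z‖ ≤
      C * √(∫⁻ p in whitneySet J K M δ z, ‖deriv γ p‖ₑ ^ 2).toReal / extScale J δ z *
        ‖z' - z‖ := by
  have hM := h.one_le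
  obtain ⟨C, hC, hb⟩ := h.exists_norm_avgExt_sub_le
  have hη0 : 0 < 1 / (16 * M) := by positivity
  have hη1 : 1 / (16 * M) ≤ 1 / 16 := by gcongr; linarith
  refine ⟨C * (32 / (1 / (16 * M)) ^ 2), by positivity, fun γ δ z z' hγ hδ hz hzz hW => ?_⟩
  set V := √(∫⁻ p in whitneySet J K M δ z, ‖deriv γ p‖ₑ ^ 2).toReal with hV
  have hs := hδ.trans_le (le_extScale J δ z)
  have := hb γ δ z z' (32 / (1 / (16 * M)) ^ 2 * V) hγ hδ (by positivity) hz hzz fun x hx hxd => ?_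
  · refine this.trans (le_of_eq ?_)
    ring
  · have hin : ∫⁻ p in ball x ((1 / (16 * M)) ^ 2 / 32 * extScale J δ z), ‖deriv γ p‖ₑ ^ 2 ≤
        ENNReal.ofReal (V ^ 2) := by
      rw [hV, Real.sq_sqrt ENNReal.toReal_nonneg, ENNReal.ofReal_toReal hW]
      refine lintegral_mono_set fun p hp => ?_
      rw [mem_ball, dist_eq_norm] at hp
      change ‖p - z‖ < 100 * M * extScale J δ z ∧
        (1 / (16 * M)) ^ 2 / 32 * extScale J δ z < infDist p K
      generalize extScale J δ z = s at *
      generalize 1 / (16 * M) = η at *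
      have h1 : η ^ 2 / 32 * s ≤ 1 * s := by gcongr; nlinarith
      have h2 : 1 * s ≤ M * s := by gcongr
      constructor
      · have h3 : ‖p - z‖ ≤ ‖p - x‖ + ‖x - z‖ := norm_sub_le_norm_sub_add_norm_sub _ _ _
        linarith
      · have h3 : infDist x K ≤ infDist p K + dist x p := infDist_le_infDist_add_dist
        rw [dist_eq_norm, norm_sub_rev] at h3
        linarith
    have hle := norm_le_of_lintegral (by positivity) (Real.sqrt_nonneg _)
      ((hγ.deriv h.isCompact.isClosed.isOpen_compl).mono (ball_subset_compl_of_le_infDist (by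
        refine le_trans ?_ hxd
        gcongr
        norm_num))) hin
    rw [div_mul_eq_mul_div, le_div_iff₀ (by positivity)]
    linarith

theorem exists_enorm_dbar_avgExt_le (h : IsClosedQuasidisk J K M) : ∃ C : ℝ, 0 < C ∧
    ∀ (γ : ℂ → ℂ) (δ : ℝ) (z : ℂ), DifferentiableOn ℂ γ Kᶜ → 0 < δ → infDist z K ≤ 3 * δ →
    ∫⁻ p in Kᶜ, ‖deriv γ p‖ₑ ^ 2 ≠ ⊤ →
    ‖dbar (avgExt J K (1 / (16 * M)) δ γ) z‖ₑ ^ 2 ≤ ENNReal.ofReal C *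
      ∫⁻ p in whitneySet J K M δ z, ENNReal.ofReal ((extScale J δ z ^ 2)⁻¹) * ‖deriv γ p‖ₑ ^ 2 := by
  obtain ⟨C, hC, hb⟩ := h.exists_norm_avgExt_sub_le_sqrt
  refine ⟨(2 * C) ^ 2, by positivity, fun γ δ z hγ hδ hz hfin => ?_⟩
  have hs := hδ.trans_le (le_extScale J δ z)
  have hW : ∫⁻ p in whitneySet J K M δ z, ‖deriv γ p‖ₑ ^ 2 ≠ ⊤ :=
    ne_top_of_le_ne_top hfin (lintegral_mono_set (h.whitneySet_subset hδ z))
  rw [lintegral_const_mul' _ _ ENNReal.ofReal_ne_top]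
  have h1 := norm_dbar_le (F := avgExt J K (1 / (16 * M)) δ γ) (z := z)
    (B := C * √(∫⁻ p in whitneySet J K M δ z, ‖deriv γ p‖ₑ ^ 2).toReal / extScale J δ z)
    (by positivity) (by
      filter_upwards [closedBall_mem_nhds z (show 0 < δ / 8 by positivity)] with z' hz'
      rw [mem_closedBall, dist_eq_norm] at hz'
      exact hb γ δ z z' hγ hδ hz hz' hW)
  have h2 := pow_le_pow_left₀ (norm_nonneg _) h1 2
  rw [mul_pow, div_pow, mul_pow, Real.sq_sqrt ENNReal.toReal_nonneg] at h2
  rw [← ofReal_norm, ← ENNReal.ofReal_pow (norm_nonneg _)]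
  refine (ENNReal.ofReal_le_ofReal h2).trans (le_of_eq ?_)
  nth_rewrite 2 [← ENNReal.ofReal_toReal hW]
  rw [← ENNReal.ofReal_mul (by positivity), ← ENNReal.ofReal_mul (by positivity)]
  congr 1
  ring

theorem exists_lintegral_whitney_le (h : IsClosedQuasidisk J K M) : ∃ C : ℝ, 0 < C ∧
    ∀ (γ : ℂ → ℂ) (δ : ℝ), 0 < δ →
    ∫⁻ z, ∫⁻ p in whitneySet J K M δ z, ENNReal.ofReal ((extScale J δ z ^ 2)⁻¹) * ‖deriv γ p‖ₑ ^ 2 ≤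
      ENNReal.ofReal C * ∫⁻ p in Kᶜ, ‖deriv γ p‖ₑ ^ 2 := by
  have hM := h.one_le
  set η := 1 / (16 * M) with hη
  have hη0 : 0 < η := by positivity
  refine ⟨(101 * M) ^ 2 * (Real.pi * (3200 * M / η ^ 2) ^ 2), by positivity, fun γ δ hδ => ?_⟩
  have hsc := continuous_extScale J δ
  have hm : Measurable fun q : ℂ × ℂ => {q : ℂ × ℂ | q.2 ∈ whitneySet J K M δ q.1}.indicator
      (fun q => ENNReal.ofReal ((extScale J δ q.1 ^ 2)⁻¹) * ‖deriv γ q.2‖ₑ ^ 2) q := by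
    refine Measurable.indicator ?_ (measurableSet_whitneySet_prod J K M δ)
    have h1 := (measurable_deriv γ).enorm.pow_const 2
    have h2 : Measurable fun z => ENNReal.ofReal ((extScale J δ z ^ 2)⁻¹) :=
      ((hsc.measurable.pow_const 2).inv).ennreal_ofReal
    exact (h2.comp measurable_fst).mul (h1.comp measurable_snd)
  have e : ∀ z, ∫⁻ p in whitneySet J K M δ z,
      ENNReal.ofReal ((extScale J δ z ^ 2)⁻¹) * ‖deriv γ p‖ₑ ^ 2 =
      ∫⁻ p, {q : ℂ × ℂ | q.2 ∈ whitneySet J K M δ q.1}.indicator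
      (fun q => ENNReal.ofReal ((extScale J δ q.1 ^ 2)⁻¹) * ‖deriv γ q.2‖ₑ ^ 2) (z, p) := fun z => by
    rw [← lintegral_indicator (measurableSet_whitneySet J K M δ z)]
    rfl
  simp only [e]
  rw [lintegral_lintegral_swap hm.aemeasurable, ← lintegral_const_mul' _ _ ENNReal.ofReal_ne_top,
    ← lintegral_indicator h.isCompact.isClosed.isOpen_compl.measurableSet]
  refine lintegral_mono fun p => ?_
  by_cases hp : p ∈ Kᶜ
  · rw [indicator_of_mem hp]
    have hd := h.infDist_pos hp
    have hle : ∀ z, {q : ℂ × ℂ | q.2 ∈ whitneySet J K M δ q.1}.indicator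
        (fun q => ENNReal.ofReal ((extScale J δ q.1 ^ 2)⁻¹) * ‖deriv γ q.2‖ₑ ^ 2) (z, p) ≤
        (ball p (3200 * M / η ^ 2 * infDist p K)).indicator (fun _ =>
          ENNReal.ofReal ((101 * M) ^ 2 / infDist p K ^ 2) * ‖deriv γ p‖ₑ ^ 2) z := fun z => by
      by_cases hz : p ∈ whitneySet J K M δ z
      · have hz' : (z, p) ∈ {q : ℂ × ℂ | q.2 ∈ whitneySet J K M δ q.1} := hz
        have hs := hδ.trans_le (le_extScale J δ z)
        obtain ⟨h1, h2⟩ := hz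
        rw [← hη] at h2
        have h3 : infDist p K ≤ 101 * M * extScale J δ z := by
          have h4 : infDist p J ≤ infDist z J + dist p z := infDist_le_infDist_add_dist
          have h5 := h.infDist_le p
          rw [dist_eq_norm] at h4
          have h6 : infDist z J ≤ extScale J δ z := by rw [extScale]; linarith
          have h7 : 1 * extScale J δ z ≤ M * extScale J δ z := by gcongr
          linarith
        have hzb : z ∈ ball p (3200 * M / η ^ 2 * infDist p K) := by
          rw [mem_ball, dist_eq_norm, norm_sub_rev]
          refine h1.trans_le ?_
          have h8 : extScale J δ z ≤ 32 / η ^ 2 * infDist p K := by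
            rw [div_mul_eq_mul_div, le_div_iff₀ (by positivity)]
            linarith
          calc 100 * M * extScale J δ z ≤ 100 * M * (32 / η ^ 2 * infDist p K) := by gcongr
            _ = _ := by ring
        rw [indicator_of_mem hz', indicator_of_mem hzb]
        gcongr
        rw [inv_eq_one_div, div_le_div_iff₀ (by positivity) (by positivity), one_mul, ← mul_pow]
        gcongr
      · have hz' : (z, p) ∉ {q : ℂ × ℂ | q.2 ∈ whitneySet J K M δ q.1} := hz
        rw [indicator_of_notMem hz']
        exact zero_le
    refine (lintegral_mono hle).trans (le_of_eq ?_)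
    rw [lintegral_indicator measurableSet_ball, setLIntegral_const,
      volume_ball_eq_ofReal _ (by positivity), mul_right_comm, ← ENNReal.ofReal_mul (by positivity)]
    congr 2
    field_simp
  · rw [indicator_of_notMem hp]
    refine le_of_eq ((lintegral_congr fun z => indicator_of_notMem (fun hz => hp ?_) _).trans
      lintegral_zero)
    exact h.whitneySet_subset hδ z hz

end IsClosedQuasidisk

theorem exists_lipschitzWith_of_local {H : ℂ → ℂ} {B L ρ : ℝ} (hρ : 0 < ρ) (hB : ∀ z, ‖H z‖ ≤ B)
    (hL : ∀ z z', ‖z' - z‖ ≤ ρ → ‖H z' - H z‖ ≤ L * ‖z' - z‖) : ∃ C, LipschitzWith C H := by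
  have hB0 : 0 ≤ B := (norm_nonneg _).trans (hB 0)
  refine ⟨Real.toNNReal (max L (2 * B / ρ)), LipschitzWith.of_dist_le_mul fun z' z => ?_⟩
  rw [Real.coe_toNNReal _ (le_max_of_le_right (by positivity)), dist_eq_norm, dist_eq_norm]
  rcases le_or_gt ‖z' - z‖ ρ with hle | hlt
  · refine (hL z z' hle).trans ?_
    gcongr
    exact le_max_left _ _
  · calc ‖H z' - H z‖ ≤ ‖H z'‖ + ‖H z‖ := norm_sub_le _ _
      _ ≤ 2 * B / ρ * ρ := by
        rw [div_mul_cancel₀ _ hρ.ne']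
        linarith [hB z', hB z]
      _ ≤ max L (2 * B / ρ) * ‖z' - z‖ := by
        gcongr
        exact le_max_right _ _

/-- A piecewise linear cutoff, equal to `1` on the disc of radius `R` and to `0` off the disc of
radius `2 * R`. -/
noncomputable def radialCutoff (R : ℝ) (z : ℂ) : ℝ := max (min (2 - ‖z‖ / R) 1) 0

theorem radialCutoff_nonneg (R : ℝ) (z : ℂ) : 0 ≤ radialCutoff R z := le_max_right _ _

theorem radialCutoff_le_one (R : ℝ) (z : ℂ) : radialCutoff R z ≤ 1 :=
  max_le (min_le_right _ _) zero_le_one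

theorem radialCutoff_eq_zero {R : ℝ} {z : ℂ} (hR : 0 < R) (h : 2 * R ≤ ‖z‖) :
    radialCutoff R z = 0 := by
  have : 2 ≤ ‖z‖ / R := (le_div_iff₀ hR).2 h
  exact max_eq_right ((min_le_left _ _).trans (by linarith))

theorem radialCutoff_eq_one {R : ℝ} {z : ℂ} (hR : 0 < R) (h : ‖z‖ ≤ R) :
    radialCutoff R z = 1 := by
  have : ‖z‖ / R ≤ 1 := (div_le_one hR).2 h
  rw [radialCutoff, min_eq_right (by linarith), max_eq_left zero_le_one]

theorem abs_radialCutoff_sub_le {R : ℝ} (hR : 0 < R) (z z' : ℂ) :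
    |radialCutoff R z' - radialCutoff R z| ≤ ‖z' - z‖ / R := by
  refine (abs_max_sub_max_le_abs _ _ _).trans ?_
  refine (abs_min_sub_min_le_max _ _ _ _).trans ?_
  rw [sub_self, abs_zero, max_eq_left (abs_nonneg _), sub_sub_sub_cancel_left, ← sub_div, abs_div,
    abs_of_pos hR]
  gcongr
  rw [norm_sub_rev]
  exact abs_norm_sub_norm_le _ _

theorem norm_radialCutoff_mul_sub_le {R : ℝ} (hR : 0 < R) (F : ℂ → ℂ) (z z' : ℂ) :
    ‖radialCutoff R z' * F z' - radialCutoff R z * F z‖ ≤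
      ‖F z' - F z‖ + ‖z' - z‖ / R * ‖F z‖ := by
  have e : (radialCutoff R z' : ℂ) * F z' - radialCutoff R z * F z =
      radialCutoff R z' * (F z' - F z) + ((radialCutoff R z' - radialCutoff R z : ℝ) : ℂ) * F z := by
    push_cast; ring
  rw [e]
  refine (norm_add_le _ _).trans ?_
  rw [norm_mul, norm_mul, Complex.norm_real, Complex.norm_real,
    Real.norm_of_nonneg (radialCutoff_nonneg _ _), Real.norm_eq_abs]
  have h1 := radialCutoff_le_one R z'
  have h2 := abs_radialCutoff_sub_le hR z z'
  calc radialCutoff R z' * ‖F z' - F z‖ + |radialCutoff R z' - radialCutoff R z| * ‖F z‖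
      ≤ 1 * ‖F z' - F z‖ + ‖z' - z‖ / R * ‖F z‖ := by gcongr
    _ = _ := by rw [one_mul]

theorem exists_lipschitzWith_radialCutoff_mul {F : ℂ → ℂ} {L ρ R : ℝ} (hρ : 0 < ρ) (hL0 : 0 ≤ L)
    (hR : 0 < R) (hL : ∀ z z', ‖z' - z‖ ≤ ρ → ‖F z' - F z‖ ≤ L * ‖z' - z‖) (hF : Continuous F) :
    ∃ C, LipschitzWith C fun z => (radialCutoff R z : ℂ) * F z := by
  obtain ⟨B, hB⟩ := (isCompact_closedBall (0 : ℂ) (2 * R + ρ)).exists_bound_of_continuousOn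
    hF.continuousOn
  simp only [mem_closedBall_zero_iff] at hB
  have hB0 : 0 ≤ B := (norm_nonneg _).trans (hB 0 (by rw [norm_zero]; positivity))
  refine exists_lipschitzWith_of_local (B := B) (L := L + B / R) hρ (fun z => ?_)
    (fun z z' hz => ?_)
  · by_cases hz : ‖z‖ ≤ 2 * R
    · rw [norm_mul, Complex.norm_real, Real.norm_of_nonneg (radialCutoff_nonneg _ _)]
      calc radialCutoff R z * ‖F z‖ ≤ 1 * B := by
            gcongr
            · exact radialCutoff_le_one _ _
            · exact hB z (by linarith)
        _ = B := one_mul _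
    · rw [radialCutoff_eq_zero hR (by linarith)]
      simpa using hB0
  · by_cases hz2 : ‖z‖ ≤ 2 * R + ρ
    · refine (norm_radialCutoff_mul_sub_le hR F z z').trans ?_
      calc _ ≤ L * ‖z' - z‖ + ‖z' - z‖ / R * B := by
            gcongr
            · exact hL z z' hz
            · exact hB z hz2
        _ = _ := by ring
    · have h1 : ‖z‖ - ‖z'‖ ≤ ‖z - z'‖ := norm_sub_norm_le _ _
      rw [norm_sub_rev] at h1
      rw [radialCutoff_eq_zero hR (by linarith), radialCutoff_eq_zero hR (by linarith)]
      simp only [ofReal_zero, zero_mul, sub_zero, norm_zero]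
      positivity

theorem norm_dbar_radialCutoff_mul_le {γ F : ℂ → ℂ} {R ε : ℝ} (hR : 0 < R) (hε : 0 ≤ ε)
    (hγ : ∀ z, R / 2 ≤ ‖z‖ → DifferentiableAt ℂ γ z) (hb : ∀ z, R / 2 ≤ ‖z‖ → ‖γ z‖ ≤ ε)
    (hF : ∀ z, R / 2 ≤ ‖z‖ → F z = γ z) {z : ℂ} (hz : R ≤ ‖z‖) :
    ‖dbar (fun z => (radialCutoff R z : ℂ) * F z) z‖ ≤ 10 * ε / R := by
  have hnorm : ∀ p ∈ closedBall z (R / 2), R / 2 ≤ ‖p‖ := fun p hp => by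
    rw [mem_closedBall, dist_eq_norm, norm_sub_rev] at hp
    have : ‖z‖ - ‖p‖ ≤ ‖z - p‖ := norm_sub_norm_le _ _
    linarith
  have hder : ∀ p ∈ ball z (R / 4), ‖deriv γ p‖ ≤ ε / (R / 4) := fun p hp => by
    have hsub : closedBall p (R / 4) ⊆ closedBall z (R / 2) :=
      closedBall_subset_closedBall' (by rw [mem_ball] at hp; linarith)
    refine norm_deriv_le_of_forall_mem_sphere_norm_le (by positivity) ?_ fun q hq =>
      hb q (hnorm q (hsub (sphere_subset_closedBall hq)))
    refine DifferentiableOn.diffContOnCl ?_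
    rw [closure_ball p (by positivity)]
    exact fun q hq => (hγ q (hnorm q (hsub hq))).differentiableWithinAt
  have h := norm_dbar_le (F := fun z => (radialCutoff R z : ℂ) * F z) (z := z) (B := 5 * ε / R)
    (by positivity) (by
      filter_upwards [ball_mem_nhds z (show 0 < R / 4 by positivity)] with z' hz'
      refine (norm_radialCutoff_mul_sub_le hR F z z').trans ?_
      have hzR := hnorm z (mem_closedBall_self (by positivity))
      rw [hF z hzR, hF z' (hnorm z' (ball_subset_closedBall (ball_subset_ball (by linarith) hz')))]
      have h1 := (convex_ball z (R / 4)).norm_image_sub_le_of_norm_deriv_le (𝕜 := ℂ) (f := γ)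
        (fun p hp => hγ p (hnorm p (ball_subset_closedBall (ball_subset_ball (by linarith) hp))))
        hder (mem_ball_self (by positivity)) hz'
      calc _ ≤ ε / (R / 4) * ‖z' - z‖ + ‖z' - z‖ / R * ε := by
            gcongr
            exact hb z hzR
        _ = _ := by field_simp; ring)
  refine h.trans (le_of_eq ?_)
  ring

theorem norm_deriv_mul_infDist_le {K : Set ℂ} {γ : ℂ → ℂ} (hK : IsClosed K)
    (hγ : DifferentiableOn ℂ γ Kᶜ) (hfin : ∫⁻ p in Kᶜ, ‖deriv γ p‖ₑ ^ 2 ≠ ⊤) {x : ℂ} {δ : ℝ}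
    (hδ : 0 < δ) (hx : δ ≤ infDist x K) :
    ‖deriv γ x‖ * δ ≤ √(∫⁻ p in Kᶜ, ‖deriv γ p‖ₑ ^ 2).toReal := by
  have hsub := ball_subset_compl_of_le_infDist hx
  refine norm_le_of_lintegral hδ (Real.sqrt_nonneg _)
    ((hγ.deriv hK.isOpen_compl).mono hsub) ?_
  rw [Real.sq_sqrt ENNReal.toReal_nonneg, ENNReal.ofReal_toReal hfin]
  exact lintegral_mono_set hsub

namespace IsClosedQuasidisk

variable {J K : Set ℂ} {M : ℝ}

theorem exists_norm_avgExt_sub_le_const (h : IsClosedQuasidisk J K M) {γ : ℂ → ℂ} {δ : ℝ}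
    (hγ : DifferentiableOn ℂ γ Kᶜ) (hδ : 0 < δ) (hfin : ∫⁻ p in Kᶜ, ‖deriv γ p‖ₑ ^ 2 ≠ ⊤) :
    ∃ L : ℝ, 0 ≤ L ∧ ∀ z z', ‖z' - z‖ ≤ δ / 8 →
      ‖avgExt J K (1 / (16 * M)) δ γ z' - avgExt J K (1 / (16 * M)) δ γ z‖ ≤ L * ‖z' - z‖ := by
  obtain ⟨C, hC, hb⟩ := h.exists_norm_avgExt_sub_le_sqrt
  have hK := h.isCompact.isClosed
  refine ⟨(C + 1) * √(∫⁻ p in Kᶜ, ‖deriv γ p‖ₑ ^ 2).toReal / δ, by positivity,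
    fun z z' hz => ?_⟩
  rcases le_or_gt (infDist z K) (3 * δ) with hd | hd
  · have hle : ∫⁻ p in whitneySet J K M δ z, ‖deriv γ p‖ₑ ^ 2 ≤ ∫⁻ p in Kᶜ, ‖deriv γ p‖ₑ ^ 2 :=
      lintegral_mono_set (h.whitneySet_subset hδ z)
    refine (hb γ δ z z' hγ hδ hd hz (ne_top_of_le_ne_top hfin hle)).trans ?_
    gcongr
    · linarith
    · exact le_extScale J δ z
  · have hball : ∀ x ∈ closedBall z (δ / 8), 2 * δ ≤ infDist x K := fun x hx => by
      have := infDist_le_infDist_add_dist (s := K) (x := z) (y := x)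
      rw [mem_closedBall, dist_comm] at hx
      linarith
    have hz' : z' ∈ closedBall z (δ / 8) := by rwa [mem_closedBall, dist_eq_norm]
    have hz0 : z ∈ closedBall z (δ / 8) := mem_closedBall_self (by positivity)
    rw [avgExt_eq_self hδ (hball z' hz'), avgExt_eq_self hδ (hball z hz0)]
    refine (convex_closedBall z (δ / 8)).norm_image_sub_le_of_norm_deriv_le (fun x hx => ?_)
      (fun x hx => ?_) hz0 hz'
    · refine hγ.differentiableAt (hK.isOpen_compl.mem_nhds fun hxK => ?_)
      have := hball x hx
      rw [infDist_zero_of_mem hxK] at this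
      linarith
    · rw [le_div_iff₀ hδ]
      refine (norm_deriv_mul_infDist_le hK hγ hfin hδ (by linarith [hball x hx])).trans ?_
      have := Real.sqrt_nonneg (∫⁻ p in Kᶜ, ‖deriv γ p‖ₑ ^ 2).toReal
      nlinarith

end IsClosedQuasidisk

theorem continuous_of_local_lipschitz {F : ℂ → ℂ} {L ρ : ℝ} (hρ : 0 < ρ)
    (hL : ∀ z z', ‖z' - z‖ ≤ ρ → ‖F z' - F z‖ ≤ L * ‖z' - z‖) : Continuous F := by
  refine continuous_iff_continuousAt.2 fun z => ?_
  rw [ContinuousAt, tendsto_iff_norm_sub_tendsto_zero]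
  refine squeeze_zero' (Eventually.of_forall fun _ => norm_nonneg _)
    (g := fun z' => L * ‖z' - z‖) ?_ ?_
  · filter_upwards [closedBall_mem_nhds z hρ] with z' hz'
    exact hL z z' (by rwa [← dist_eq_norm])
  · have : Continuous fun z' => L * ‖z' - z‖ := by fun_prop
    simpa using this.tendsto z

/-- The Cauchy-Pompeiu formula for a locally Lipschitz function on the plane which is holomorphic
off a compact set and vanishes at infinity. -/
theorem cauchy_pompeiu_of_tendsto_zero {F : ℂ → ℂ} {L ρ : ℝ} (hρ : 0 < ρ) (hL0 : 0 ≤ L)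
    (hL : ∀ z z', ‖z' - z‖ ≤ ρ → ‖F z' - F z‖ ≤ L * ‖z' - z‖) {S : Set ℂ} (hS : IsCompact S)
    (hFS : DifferentiableOn ℂ F Sᶜ) (hlim : Tendsto F (cobounded ℂ) (nhds 0)) {ζ : ℂ}
    (hζ : ζ ∉ S) :
    Integrable (fun z => dbar F z / (z - ζ)) ∧
      ((∫ z, bumpKer 1 z : ℝ) : ℂ) * F ζ = -∫ z, dbar F z / (z - ζ) := by
  have hF := continuous_of_local_lipschitz hρ hL
  have hdiff : ∀ z ∉ S, DifferentiableAt ℂ F z := fun z hz =>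
    hFS.differentiableAt (hS.isClosed.isOpen_compl.mem_nhds hz)
  have h0 : ∀ z ∉ S, dbar F z = 0 := fun z hz => dbar_eq_zero_of_differentiableAt (hdiff z hz)
  have hbd : ∀ z, ‖dbar F z‖ ≤ 2 * L := fun z => norm_dbar_le hL0 (by
    filter_upwards [closedBall_mem_nhds z hρ] with z' hz'
    exact hL z z' (by rwa [← dist_eq_norm]))
  obtain ⟨r, hr, hrS⟩ : ∃ r > 0, ∀ z ∈ S, r ≤ ‖z - ζ‖ := by
    obtain ⟨r, hr, hb⟩ := Metric.isOpen_iff.1 hS.isClosed.isOpen_compl ζ hζ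
    refine ⟨r, hr, fun z hz => ?_⟩
    by_contra hlt
    exact hb (show z ∈ ball ζ r by rw [mem_ball, dist_eq_norm]; linarith) hz
  have hmeas : Measurable fun z => dbar F z / (z - ζ) :=
    (measurable_dbar hF).div (measurable_id.sub_const ζ)
  have hInt : Integrable fun z => dbar F z / (z - ζ) := by
    refine integrable_of_bound_of_compact hmeas.aestronglyMeasurable hS (B := 2 * L / r)
      (fun z hz => ?_) (fun z hz => by rw [h0 z hz, zero_div])
    rw [norm_div]
    exact div_le_div₀ (by positivity) (hbd z) hr (hrS z hz)
  refine ⟨hInt, ?_⟩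
  rw [← sub_eq_zero, sub_neg_eq_add, ← norm_le_zero_iff]
  refine le_of_forall_pos_le_add fun ε hε => ?_
  rw [zero_add]
  obtain ⟨R₀, hR₀⟩ := hS.isBounded.subset_closedBall 0
  obtain ⟨R₁, hR₁⟩ : ∃ R₁ : ℝ, ∀ z, R₁ ≤ ‖z‖ → ‖F z‖ ≤ ε / (80 * Real.pi) := by
    have := hlim.norm.eventually (ge_mem_nhds (a := ε / (80 * Real.pi)) (by
      rw [norm_zero]; positivity))
    rw [← comap_norm_atTop, eventually_comap] at this
    obtain ⟨R₁, h1⟩ := eventually_atTop.1 this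
    exact ⟨R₁, fun z hz => h1 _ hz z rfl⟩
  obtain ⟨R, hR, hRR₀, hRR₁, hRζ⟩ : ∃ R : ℝ, 0 < R ∧ R₀ < R / 2 ∧ R₁ ≤ R / 2 ∧ ‖ζ‖ < R / 2 := by
    refine ⟨2 * (|R₀| + |R₁| + ‖ζ‖ + 1), ?_, ?_, ?_, ?_⟩ <;>
      linarith [abs_nonneg R₀, abs_nonneg R₁, norm_nonneg ζ, le_abs_self R₀, le_abs_self R₁]
  set H : ℂ → ℂ := fun z => (radialCutoff R z : ℂ) * F z with hH
  have hSR : ∀ z, R / 2 ≤ ‖z‖ → z ∉ S := fun z hz hzS => by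
    have := mem_closedBall_zero_iff.1 (hR₀ hzS)
    linarith
  have hHF : ∀ z, ‖z‖ < R → H =ᶠ[nhds z] F := fun z hz => by
    filter_upwards [(isOpen_lt continuous_norm continuous_const).mem_nhds hz] with z' hz'
    rw [hH]
    change ((radialCutoff R z' : ℝ) : ℂ) * F z' = F z'
    rw [radialCutoff_eq_one hR (le_of_lt hz'), Complex.ofReal_one, one_mul]
  obtain ⟨C, hC⟩ := exists_lipschitzWith_radialCutoff_mul hρ hL0 hR hL hF
  have hHc : HasCompactSupport H :=
    HasCompactSupport.intro (isCompact_closedBall 0 (2 * R)) fun z hz => by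
      rw [mem_closedBall_zero_iff, not_le] at hz
      change ((radialCutoff R z : ℝ) : ℂ) * F z = 0
      rw [radialCutoff_eq_zero hR hz.le, Complex.ofReal_zero, zero_mul]
  have hζR : ‖ζ‖ < R := by linarith
  have hCP := cauchy_pompeiu hC hHc (ζ := ζ) (by
    filter_upwards [hS.isClosed.isOpen_compl.mem_nhds hζ,
      (isOpen_lt continuous_norm continuous_const).mem_nhds hζR] with z hz hzR
    rw [dbar_congr (hHF z hzR), h0 z hz])
  change _ * H ζ = -∫ z, dbar H z / (z - ζ) at hCP
  rw [(hHF ζ hζR).eq_of_nhds] at hCP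
  have hHm : Measurable fun z => dbar H z / (z - ζ) :=
    (measurable_dbar hC.continuous).div (measurable_id.sub_const ζ)
  have hdiffbd : ∀ z, ‖dbar F z / (z - ζ) - dbar H z / (z - ζ)‖ ≤
      (closedBall (0 : ℂ) (2 * R)).indicator (fun _ => ε / (4 * Real.pi * R ^ 2)) z := fun z => by
    rcases lt_or_ge ‖z‖ R with hz | hz
    · rw [dbar_congr (hHF z hz), sub_self, norm_zero]
      exact indicator_nonneg (fun _ _ => by positivity) _
    · by_cases hz2 : z ∈ closedBall (0 : ℂ) (2 * R)
      · rw [indicator_of_mem hz2, h0 z (hSR z (by linarith)), zero_div, zero_sub, norm_neg, norm_div]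
        have h1 := norm_dbar_radialCutoff_mul_le (F := F) (γ := F) (z := z) hR
          (ε := ε / (80 * Real.pi)) (by positivity) (fun z hz => hdiff z (hSR z hz))
          (fun z hz => hR₁ z (hRR₁.trans hz)) (fun _ _ => rfl) hz
        have h2 : R / 2 ≤ ‖z - ζ‖ := by
          have := norm_sub_norm_le z ζ
          linarith
        refine (div_le_div₀ (by positivity) h1 (by positivity) h2).trans (le_of_eq ?_)
        field_simp
        norm_num
      · rw [indicator_of_notMem hz2, h0 z (hSR z (by linarith)), zero_div, zero_sub, norm_neg,
          dbar_eq_zero_of_notMem_tsupport, zero_div, norm_zero]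
        refine fun hmem => hz2 ?_
        refine closure_minimal (fun x hx => ?_) isClosed_closedBall hmem
        by_contra hx2
        rw [mem_closedBall_zero_iff, not_le] at hx2
        refine hx ?_
        change ((radialCutoff R x : ℝ) : ℂ) * F x = 0
        rw [radialCutoff_eq_zero hR hx2.le, Complex.ofReal_zero, zero_mul]
  have hindint : Integrable ((closedBall (0 : ℂ) (2 * R)).indicator
      (fun _ => ε / (4 * Real.pi * R ^ 2))) := by
    rw [integrable_indicator_iff measurableSet_closedBall]
    exact integrableOn_const measure_closedBall_lt_top.ne
  have hdint : Integrable fun z => dbar F z / (z - ζ) - dbar H z / (z - ζ) :=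
    hindint.mono' (hmeas.sub hHm).aestronglyMeasurable (Eventually.of_forall hdiffbd)
  have hHint : Integrable fun z => dbar H z / (z - ζ) := by
    have := hInt.sub hdint
    simpa [Pi.sub_def] using this
  rw [hCP, neg_add_eq_sub, ← integral_sub hInt hHint]
  refine (norm_integral_le_of_norm_le hindint (Eventually.of_forall hdiffbd)).trans ?_
  rw [integral_indicator_const _ measurableSet_closedBall, Measure.real,
    volume_closedBall_eq_ofReal _ (by positivity), ENNReal.toReal_ofReal (by positivity), smul_eq_mul]
  refine le_of_eq ?_
  field_simp
  norm_num

namespace IsClosedQuasidisk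

variable {J K : Set ℂ} {M : ℝ}

/-- A function with finite Dirichlet integral off a closed quasidisk `K` is the Cauchy integral of
densities supported arbitrarily close to `K`, with uniformly bounded norms. -/
theorem exists_density (h : IsClosedQuasidisk J K M) {γ : ℂ → ℂ}
    (hγ : DifferentiableOn ℂ γ Kᶜ) (hlim : Tendsto γ (cobounded ℂ) (nhds 0))
    (hfin : ∫⁻ p in Kᶜ, ‖deriv γ p‖ₑ ^ 2 ≠ ⊤) :
    ∃ C : ℝ, 0 ≤ C ∧ ∀ δ : ℝ, 0 < δ → ∃ u : ℂ → ℂ, Measurable u ∧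
      (∀ z, 2 * δ < infDist z K → u z = 0) ∧ ∫⁻ z, ‖u z‖ₑ ^ 2 ≤ ENNReal.ofReal C ∧
      ∀ ζ, 2 * δ < infDist ζ K → Integrable (fun z => u z / (z - ζ)) ∧
        ((∫ z, bumpKer 1 z : ℝ) : ℂ) * γ ζ = -∫ z, u z / (z - ζ) := by
  obtain ⟨C₁, hC₁, hb₁⟩ := h.exists_enorm_dbar_avgExt_le
  obtain ⟨C₂, hC₂, hb₂⟩ := h.exists_lintegral_whitney_le
  have hK := h.isCompact.isClosed
  refine ⟨C₁ * (C₂ * (∫⁻ p in Kᶜ, ‖deriv γ p‖ₑ ^ 2).toReal), by positivity, fun δ hδ => ?_⟩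
  obtain ⟨L, hL0, hL⟩ := h.exists_norm_avgExt_sub_le_const hγ hδ hfin
  have hFc := continuous_of_local_lipschitz (by positivity) hL
  set F := avgExt J K (1 / (16 * M)) δ γ with hF
  have hopen : IsOpen {z | 2 * δ < infDist z K} :=
    isOpen_lt continuous_const (continuous_infDist_pt K)
  have hFγ : ∀ z, 2 * δ < infDist z K → F =ᶠ[nhds z] γ := fun z hz => by
    filter_upwards [hopen.mem_nhds hz] with z' hz'
    exact avgExt_eq_self hδ (le_of_lt hz')
  have hFd : ∀ z, 2 * δ < infDist z K → DifferentiableAt ℂ F z := fun z hz => by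
    refine (hFγ z hz).symm.differentiableAt_iff.1 (hγ.differentiableAt
      (hK.isOpen_compl.mem_nhds fun hzK => ?_))
    rw [infDist_zero_of_mem hzK] at hz
    linarith
  have h0 : ∀ z, 2 * δ < infDist z K → dbar F z = 0 := fun z hz =>
    dbar_eq_zero_of_differentiableAt (hFd z hz)
  have hcpt : IsCompact {z | 2 * δ < infDist z K}ᶜ := by
    refine h.isCompact.cthickening (r := 2 * δ) |>.of_isClosed_subset hopen.isClosed_compl
      fun z hz => ?_
    rw [mem_cthickening_iff]
    change ¬ (2 * δ < infDist z K) at hz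
    rw [not_lt, infDist] at hz
    exact (ENNReal.le_ofReal_iff_toReal_le (infEDist_ne_top h.nonempty) (by positivity)).2 hz
  refine ⟨dbar F, measurable_dbar hFc, h0, ?_, fun ζ hζ => ?_⟩
  · calc ∫⁻ z, ‖dbar F z‖ₑ ^ 2
        ≤ ∫⁻ z, ENNReal.ofReal C₁ * ∫⁻ p in whitneySet J K M δ z,
            ENNReal.ofReal ((extScale J δ z ^ 2)⁻¹) * ‖deriv γ p‖ₑ ^ 2 := by
          refine lintegral_mono fun z => ?_
          rcases le_or_gt (infDist z K) (3 * δ) with hd | hd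
          · exact hb₁ γ δ z hγ hδ hd hfin
          · rw [h0 z (by linarith)]
            simp
      _ = ENNReal.ofReal C₁ * ∫⁻ z, ∫⁻ p in whitneySet J K M δ z,
            ENNReal.ofReal ((extScale J δ z ^ 2)⁻¹) * ‖deriv γ p‖ₑ ^ 2 :=
          lintegral_const_mul' _ _ ENNReal.ofReal_ne_top
      _ ≤ ENNReal.ofReal C₁ * (ENNReal.ofReal C₂ * ∫⁻ p in Kᶜ, ‖deriv γ p‖ₑ ^ 2) :=
          mul_le_mul_right (hb₂ γ δ hδ) _
      _ = _ := by
          rw [ENNReal.ofReal_mul hC₁.le, ENNReal.ofReal_mul hC₂.le, ENNReal.ofReal_toReal hfin]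
  · have hlimF : Tendsto F (cobounded ℂ) (nhds 0) := by
      refine hlim.congr' ?_
      filter_upwards [isBounded_def.1 hcpt.isBounded] with z hz
      rw [compl_compl] at hz
      exact (hFγ z hz).eq_of_nhds.symm
    have := cauchy_pompeiu_of_tendsto_zero (by positivity) hL0 hL hcpt
      (fun z hz => (hFd z (by rwa [compl_compl] at hz)).differentiableWithinAt) hlimF (ζ := ζ)
      (fun hmem => hmem hζ)
    rwa [(hFγ ζ hζ).eq_of_nhds] at this

end IsClosedQuasidisk

theorem sq_lintegral_mul_le {α : Type*} [MeasurableSpace α] (μ : Measure α) {f g : α → ENNReal}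
    (hf : AEMeasurable f μ) (hg : AEMeasurable g μ) :
    (∫⁻ x, f x * g x ∂μ) ^ 2 ≤ (∫⁻ x, f x ^ 2 ∂μ) * ∫⁻ x, g x ^ 2 ∂μ := by
  have h := ENNReal.lintegral_mul_le_Lp_mul_Lq μ Real.HolderConjugate.two_two hf hg
  simp only [Pi.mul_apply, ENNReal.rpow_two] at h
  calc (∫⁻ x, f x * g x ∂μ) ^ 2
      ≤ ((∫⁻ x, f x ^ 2 ∂μ) ^ (1 / 2 : ℝ) * (∫⁻ x, g x ^ 2 ∂μ) ^ (1 / 2 : ℝ)) ^ 2 := by gcongr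
    _ = _ := by
      rw [mul_pow, ← ENNReal.rpow_two, ← ENNReal.rpow_two, ← ENNReal.rpow_mul, ← ENNReal.rpow_mul]
      norm_num

theorem enorm_sq_eq_lintegral {α : Type*} [MeasurableSpace α] {μ : Measure α} (x : Lp ℂ 2 μ) :
    ‖x‖ₑ ^ 2 = ∫⁻ z, ‖x z‖ₑ ^ 2 ∂μ := by
  rw [Lp.enorm_def, eLpNorm_eq_lintegral_rpow_enorm_toReal two_ne_zero ENNReal.ofNat_ne_top,
    ← ENNReal.rpow_two, ← ENNReal.rpow_mul]
  simp

/-- A functional on `W` bounded by the norm of `T f` is represented by a vector in the closed range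
of `T`. -/
theorem exists_mem_closure_range_inner_eq {V W : Type*} [NormedAddCommGroup V]
    [InnerProductSpace ℂ V] [CompleteSpace V] [AddCommGroup W] [Module ℂ W] (T : W →ₗ[ℂ] V)
    (Λ : W →ₗ[ℂ] ℂ) (D : ℝ) (hb : ∀ f, ‖Λ f‖ ≤ D * ‖T f‖) :
    ∃ h ∈ closure (Set.range T), ∀ f, inner ℂ h (T f) = Λ f := by
  have hker : LinearMap.ker T ≤ LinearMap.ker Λ := fun f hf => by
    rw [LinearMap.mem_ker] at hf ⊢
    have := hb f
    rwa [hf, norm_zero, mul_zero, norm_le_zero_iff] at this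
  set ℓ : LinearMap.range T →ₗ[ℂ] ℂ :=
    ((LinearMap.ker T).liftQ Λ hker) ∘ₗ T.quotKerEquivRange.symm.toLinearMap with hℓ
  have hℓT : ∀ f, ℓ ⟨T f, LinearMap.mem_range_self T f⟩ = Λ f := fun f => by
    have : T.quotKerEquivRange.symm ⟨T f, LinearMap.mem_range_self T f⟩ =
        (LinearMap.ker T).mkQ f := by
      rw [LinearEquiv.symm_apply_eq]; rfl
    rw [hℓ, LinearMap.comp_apply, LinearEquiv.coe_coe, this]
    rfl
  have hℓb : ∀ x, ‖ℓ x‖ ≤ D * ‖x‖ := by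
    rintro ⟨_, f, rfl⟩
    rw [hℓT]
    exact hb f
  obtain ⟨g, hg, -⟩ := exists_extension_norm_eq (LinearMap.range T) (ℓ.mkContinuous D hℓb)
  set S := (LinearMap.range T).topologicalClosure with hS
  have : CompleteSpace S := (Submodule.isClosed_topologicalClosure _).completeSpace_coe
  set h₀ := (InnerProductSpace.toDual ℂ V).symm g
  refine ⟨S.starProjection h₀, ?_, fun f => ?_⟩
  · have e : (S : Set V) = closure (Set.range T) := by
      rw [hS, Submodule.topologicalClosure_coe, LinearMap.coe_range]
    exact (Set.ext_iff.1 e _).1 (S.starProjection_apply_mem h₀)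
  · have hmem : T f ∈ S := Submodule.le_topologicalClosure _ (LinearMap.mem_range_self T f)
    rw [Submodule.inner_starProjection_left_eq_right, Submodule.starProjection_eq_self_iff.2 hmem,
      InnerProductSpace.toDual_symm_apply]
    have := hg ⟨T f, LinearMap.mem_range_self T f⟩
    rw [LinearMap.mkContinuous_apply, hℓT] at this
    exact this

theorem norm_mul_le_of_ae_eq {G : Set ℂ} {k : ℂ → ℂ} (hk : DifferentiableOn ℂ k G)
    {x : Lp ℂ 2 (volume.restrict G)} (hx : x =ᵐ[volume.restrict G] k) {p : ℂ} {ρ : ℝ} (hρ : 0 < ρ)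
    (hp : ball p ρ ⊆ G) : ‖k p‖ * ρ ≤ ‖x‖ := by
  refine norm_le_of_lintegral hρ (norm_nonneg _) (hk.mono hp) ?_
  rw [ENNReal.ofReal_pow (norm_nonneg _), ofReal_norm, enorm_sq_eq_lintegral]
  refine (lintegral_mono_set hp).trans (le_of_eq (lintegral_congr_ae ?_))
  filter_upwards [hx] with z hz
  rw [hz]

/-- The Bergman space is closed in `L²`. -/
theorem exists_differentiableOn_of_mem_closure {G : Set ℂ} (hG : IsOpen G)
    {S : Set (Lp ℂ 2 (volume.restrict G))}
    (hS : ∀ x ∈ S, ∃ k : ℂ → ℂ, DifferentiableOn ℂ k G ∧ x =ᵐ[volume.restrict G] k)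
    {h : Lp ℂ 2 (volume.restrict G)} (hh : h ∈ closure S) :
    ∃ g : ℂ → ℂ, DifferentiableOn ℂ g G ∧ h =ᵐ[volume.restrict G] g := by
  obtain ⟨x, hxS, hx⟩ := mem_closure_iff_seq_limit.1 hh
  choose k hk hxk using fun n => hS (x n) (hxS n)
  have hsub : ∀ n m p ρ, 0 < ρ → ball p ρ ⊆ G → ‖k n p - k m p‖ * ρ ≤ ‖x n - x m‖ :=
    fun n m p ρ hρ hp => norm_mul_le_of_ae_eq (k := k n - k m) ((hk n).sub (hk m))
      (by filter_upwards [hxk n, hxk m, Lp.coeFn_sub (x n) (x m)] with z h1 h2 h3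
          rw [h3, Pi.sub_apply, Pi.sub_apply, h1, h2]) hρ hp
  have hlim : ∀ p ∈ G, ∃ l, Tendsto (fun n => k n p) atTop (nhds l) := fun p hp => by
    obtain ⟨ρ, hρ, hb⟩ := Metric.isOpen_iff.1 hG p hp
    refine cauchySeq_tendsto_of_complete ?_
    rw [Metric.cauchySeq_iff]
    intro ε hε
    obtain ⟨N, hN⟩ := Metric.cauchySeq_iff.1 hx.cauchySeq (ε * ρ) (by positivity)
    refine ⟨N, fun m hm n hn => ?_⟩
    have h1 := hsub m n p ρ hρ hb
    have h2 := hN m hm n hn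
    rw [dist_eq_norm] at h2 ⊢
    exact lt_of_mul_lt_mul_right (h1.trans_lt h2) hρ.le
  choose! g hg using hlim
  have hest : ∀ n p ρ, 0 < ρ → ball p ρ ⊆ G → ‖k n p - g p‖ * ρ ≤ ‖x n - h‖ :=
    fun n p ρ hρ hp => by
      have hpG := hp (mem_ball_self hρ)
      refine le_of_tendsto_of_tendsto (((tendsto_const_nhds.sub (hg p hpG)).norm).mul_const ρ)
        ((tendsto_const_nhds.sub hx).norm) (Eventually.of_forall fun m => hsub n m p ρ hρ hp)
  have hunif : TendstoLocallyUniformlyOn k g atTop G := by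
    rw [Metric.tendstoLocallyUniformlyOn_iff]
    intro ε hε p hp
    obtain ⟨ρ, hρ, hb⟩ := Metric.isOpen_iff.1 hG p hp
    refine ⟨ball p (ρ / 2), mem_nhdsWithin_of_mem_nhds (ball_mem_nhds _ (by positivity)), ?_⟩
    obtain ⟨N, hN⟩ := Metric.tendsto_atTop.1 hx (ε * (ρ / 2)) (by positivity)
    filter_upwards [eventually_ge_atTop N] with n hn q hq
    have h1 := hest n q (ρ / 2) (by positivity) ((ball_subset_ball' (by
      rw [mem_ball] at hq; linarith)).trans hb)
    have h2 := hN n hn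
    rw [dist_eq_norm] at h2
    rw [dist_comm, dist_eq_norm]
    exact lt_of_mul_lt_mul_right (h1.trans_lt h2) (by positivity)
  refine ⟨g, hunif.differentiableOn (Eventually.of_forall hk) hG, ?_⟩
  obtain ⟨φ, hφ, hae⟩ := (tendstoInMeasure_of_tendsto_Lp hx).exists_seq_tendsto_ae
  filter_upwards [hae, ae_all_iff.2 hxk, ae_restrict_mem hG.measurableSet] with z h1 h2 hz
  refine tendsto_nhds_unique h1 ?_
  simp only [h2]
  exact (hg z hz).comp hφ.tendsto_atTop

theorem mem_cthickening_iff_infDist {K : Set ℂ} (hK : K.Nonempty) {r : ℝ} (hr : 0 ≤ r) {z : ℂ} :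
    z ∈ cthickening r K ↔ infDist z K ≤ r := by
  rw [mem_cthickening_iff, infDist]
  exact ENNReal.le_ofReal_iff_toReal_le (infEDist_ne_top hK) hr

/-- The rational function `∑ f ζ / (z - ζ)` attached to a finitely supported `f`. -/
noncomputable def poleSum (K : Set ℂ) : ((Kᶜ : Set ℂ) →₀ ℂ) →ₗ[ℂ] (ℂ → ℂ) :=
  Finsupp.linearCombination ℂ fun ζ z => (z - (ζ : ℂ))⁻¹

theorem poleSum_apply {K : Set ℂ} (f : (Kᶜ : Set ℂ) →₀ ℂ) (z : ℂ) :
    poleSum K f z = ∑ ζ ∈ f.support, f ζ * (z - (ζ : ℂ))⁻¹ := by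
  rw [poleSum, Finsupp.linearCombination_apply, Finsupp.sum, Finset.sum_apply]
  rfl

theorem differentiableAt_poleSum {K : Set ℂ} (f : (Kᶜ : Set ℂ) →₀ ℂ) {z : ℂ}
    (hz : ∀ ζ ∈ f.support, z ≠ ζ) : DifferentiableAt ℂ (poleSum K f) z := by
  have e : poleSum K f = fun z => ∑ ζ ∈ f.support, f ζ * (z - (ζ : ℂ))⁻¹ :=
    funext fun z => poleSum_apply f z
  rw [e]
  refine DifferentiableAt.fun_sum fun ζ hζ => ?_
  exact (DifferentiableAt.fun_inv (differentiableAt_id.sub_const (ζ : ℂ)) (sub_ne_zero.2 (hz ζ hζ))).const_mul _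

theorem differentiableOn_poleSum {K : Set ℂ} (f : (Kᶜ : Set ℂ) →₀ ℂ) :
    DifferentiableOn ℂ (poleSum K f) K := fun z hz =>
  (differentiableAt_poleSum f fun ζ _ => by rintro rfl; exact ζ.2 hz).differentiableWithinAt

theorem measurable_poleSum {K : Set ℂ} (f : (Kᶜ : Set ℂ) →₀ ℂ) : Measurable (poleSum K f) := by
  have e : poleSum K f = fun z => ∑ ζ ∈ f.support, f ζ * (z - (ζ : ℂ))⁻¹ :=
    funext fun z => poleSum_apply f z
  rw [e]
  fun_prop

theorem exists_poleSum_bound {K : Set ℂ} (hK : IsCompact K) (hKn : K.Nonempty)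
    (f : (Kᶜ : Set ℂ) →₀ ℂ) :
    ∃ r > 0, (∀ ζ ∈ f.support, r < infDist (ζ : ℂ) K) ∧
      ∃ B, ∀ z ∈ cthickening r K, ‖poleSum K f z‖ ≤ B := by
  set P : Set ℂ := (fun ζ : (Kᶜ : Set ℂ) => (ζ : ℂ)) '' f.support with hP
  have hPf : P.Finite := f.support.finite_toSet.image _
  have hKP : K ⊆ Pᶜ := by
    rintro z hz ⟨ζ, -, rfl⟩
    exact ζ.2 hz
  obtain ⟨r, hr, hsub⟩ := hK.exists_cthickening_subset_open hPf.isClosed.isOpen_compl hKP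
  have hne : ∀ ζ ∈ f.support, (ζ : ℂ) ∉ cthickening r K := fun ζ hζ hm =>
    hsub hm ⟨ζ, hζ, rfl⟩
  refine ⟨r, hr, fun ζ hζ => ?_, ?_⟩
  · by_contra hle
    rw [not_lt] at hle
    exact hne ζ hζ ((mem_cthickening_iff_infDist hKn hr.le).2 hle)
  · refine hK.cthickening.exists_bound_of_continuousOn fun z hz => ?_
    refine (differentiableAt_poleSum f fun ζ hζ => ?_).continuousAt.continuousWithinAt
    rintro rfl
    exact hne ζ hζ hz

theorem memLp_poleSum {K G : Set ℂ} (hK : IsCompact K) (hKn : K.Nonempty) (hGK : G ⊆ K) (hG : MeasurableSet G)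
    (f : (Kᶜ : Set ℂ) →₀ ℂ) : MemLp (poleSum K f) 2 (volume.restrict G) := by
  obtain ⟨r, hr, -, B, hB⟩ := exists_poleSum_bound hK hKn f
  have : IsFiniteMeasure (volume.restrict G) :=
    ⟨by rw [Measure.restrict_apply_univ]; exact (measure_mono hGK).trans_lt hK.measure_lt_top⟩
  refine MemLp.of_bound (measurable_poleSum f).aestronglyMeasurable B ?_
  filter_upwards [ae_restrict_mem hG] with z hz
  exact hB z (self_subset_cthickening K (hGK hz))

/-- The map `poleSum` with values in `L²`. -/
noncomputable def poleSumLp {K G : Set ℂ} (hK : IsCompact K) (hKn : K.Nonempty) (hGK : G ⊆ K) (hG : MeasurableSet G) :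
    ((Kᶜ : Set ℂ) →₀ ℂ) →ₗ[ℂ] Lp ℂ 2 (volume.restrict G) where
  toFun f := (memLp_poleSum hK hKn hGK hG f).toLp _
  map_add' f g := by
    rw [← MemLp.toLp_add]
    congr 1
    exact map_add _ _ _
  map_smul' c f := by
    rw [RingHom.id_apply, ← MemLp.toLp_const_smul]
    congr 1
    exact map_smul _ _ _

theorem coeFn_poleSumLp {K G : Set ℂ} (hK : IsCompact K) (hKn : K.Nonempty) (hGK : G ⊆ K) (hG : MeasurableSet G)
    (f : (Kᶜ : Set ℂ) →₀ ℂ) : poleSumLp hK hKn hGK hG f =ᵐ[volume.restrict G] poleSum K f :=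
  MemLp.coeFn_toLp (memLp_poleSum hK hKn hGK hG f)

namespace IsClosedQuasidisk

variable {J K : Set ℂ} {M : ℝ}

theorem exists_norm_linearCombination_le (h : IsClosedQuasidisk J K M) {γ : ℂ → ℂ}
    (hγ : DifferentiableOn ℂ γ Kᶜ) (hlim : Tendsto γ (cobounded ℂ) (nhds 0))
    (hfin : ∫⁻ p in Kᶜ, ‖deriv γ p‖ₑ ^ 2 ≠ ⊤) :
    ∃ D : ℝ, 0 ≤ D ∧ ∀ f : (Kᶜ : Set ℂ) →₀ ℂ,
      ‖Finsupp.linearCombination ℂ (fun ζ : (Kᶜ : Set ℂ) => γ ζ) f‖ₑ ^ 2 ≤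
        ENNReal.ofReal D * ∫⁻ z in K, ‖poleSum K f z‖ₑ ^ 2 := by
  obtain ⟨C, hC, hu⟩ := h.exists_density hγ hlim hfin
  have hκ := integral_bumpKer_one_pos
  generalize hκe : ∫ z, bumpKer 1 z = κ at hu hκ
  refine ⟨(κ⁻¹) ^ 2 * C, by positivity, fun f => ?_⟩
  obtain ⟨r, hr, hrf, B, hB⟩ := exists_poleSum_bound h.isCompact h.nonempty f
  set k := poleSum K f with hk
  set s := Finsupp.linearCombination ℂ (fun ζ : (Kᶜ : Set ℂ) => γ ζ) f with hs
  have key : ∀ t, 0 < t → t ≤ r → ‖s‖ₑ ^ 2 ≤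
      ENNReal.ofReal (κ⁻¹ ^ 2 * C) * ∫⁻ z in cthickening t K, ‖k z‖ₑ ^ 2 := fun t ht htr => by
    obtain ⟨u, hum, hu0, huC, hrep⟩ := hu (t / 2) (by positivity)
    rw [mul_div_cancel₀ t (two_ne_zero)] at hu0 hrep
    have hsu : (κ : ℂ) * s = -∫ z, u z * k z := by
      have h1 : ∀ ζ ∈ f.support, (κ : ℂ) * (f ζ * γ ζ) = -∫ z, f ζ * (u z / (z - ζ)) :=
        fun ζ hζ => by
          rw [integral_const_mul, ← mul_neg, ← (hrep ζ (htr.trans_lt (hrf ζ hζ))).2]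
          ring
      rw [hs, Finsupp.linearCombination_apply, Finsupp.sum, Finset.mul_sum]
      simp only [smul_eq_mul]
      rw [Finset.sum_congr rfl h1, Finset.sum_neg_distrib, ← integral_finsetSum]
      · congr 2
        funext z
        rw [hk, poleSum_apply, Finset.mul_sum]
        refine Finset.sum_congr rfl fun ζ _ => ?_
        rw [div_eq_mul_inv]
        ring
      · exact fun ζ hζ => (hrep ζ (htr.trans_lt (hrf ζ hζ))).1.const_mul _
    have hs2 : s = -((κ : ℂ)⁻¹ * ∫ z, u z * k z) := by
      rw [← mul_neg, ← hsu, inv_mul_cancel_left₀ (ofReal_ne_zero.2 hκ.ne')]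
    have hE : ∫⁻ z, ‖u z‖ₑ * ‖k z‖ₑ = ∫⁻ z in cthickening t K, ‖u z‖ₑ * ‖k z‖ₑ := by
      refine (setLIntegral_eq_of_support_subset ?_).symm
      intro z hz
      rw [mem_cthickening_iff_infDist h.nonempty ht.le]
      by_contra hlt
      rw [Function.mem_support, hu0 z (by linarith)] at hz
      simp at hz
    calc ‖s‖ₑ ^ 2 = ‖(κ : ℂ)⁻¹‖ₑ ^ 2 * ‖∫ z, u z * k z‖ₑ ^ 2 := by
          rw [hs2, enorm_neg, enorm_mul, mul_pow]
      _ ≤ ‖(κ : ℂ)⁻¹‖ₑ ^ 2 * (∫⁻ z in cthickening t K, ‖u z‖ₑ * ‖k z‖ₑ) ^ 2 := by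
          rw [← hE]
          refine mul_le_mul_right ?_ _
          gcongr
          refine (enorm_integral_le_lintegral_enorm _).trans (le_of_eq ?_)
          simp only [enorm_mul]
      _ ≤ ‖(κ : ℂ)⁻¹‖ₑ ^ 2 * ((∫⁻ z in cthickening t K, ‖u z‖ₑ ^ 2) *
            ∫⁻ z in cthickening t K, ‖k z‖ₑ ^ 2) :=
          mul_le_mul_right (sq_lintegral_mul_le _ hum.enorm.aemeasurable
            (measurable_poleSum f).enorm.aemeasurable) _
      _ ≤ ‖(κ : ℂ)⁻¹‖ₑ ^ 2 * (ENNReal.ofReal C * ∫⁻ z in cthickening t K, ‖k z‖ₑ ^ 2) := by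
          refine mul_le_mul_right ?_ _
          gcongr
          exact (setLIntegral_le_lintegral _ _).trans huC
      _ = _ := by
          rw [ENNReal.ofReal_mul (by positivity), ENNReal.ofReal_pow (by positivity), mul_assoc,
            ← ofReal_inv, ← ofReal_norm, Complex.norm_real,
            Real.norm_of_nonneg (by positivity)]
  have hmeas : Measurable fun z => ‖k z‖ₑ ^ 2 := (measurable_poleSum f).enorm.pow_const 2
  have hν : ∀ t, volume.withDensity (fun z => ‖k z‖ₑ ^ 2) (cthickening t K) =
      ∫⁻ z in cthickening t K, ‖k z‖ₑ ^ 2 := fun t =>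
    withDensity_apply _ isClosed_cthickening.measurableSet
  have hlimν := tendsto_measure_cthickening_of_isClosed (s := K)
    (μ := volume.withDensity fun z => ‖k z‖ₑ ^ 2) ⟨r, hr, by
      rw [hν]
      refine ((setLIntegral_mono measurable_const (g := fun _ => ENNReal.ofReal B ^ 2)
        fun z hz => ?_).trans_lt ?_).ne
      · gcongr
        rw [← ofReal_norm]
        exact ENNReal.ofReal_le_ofReal (hB z hz)
      · rw [setLIntegral_const]
        exact ENNReal.mul_lt_top (ENNReal.pow_lt_top ENNReal.ofReal_lt_top)
          h.isCompact.cthickening.measure_lt_top⟩ h.isCompact.isClosed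
  rw [withDensity_apply _ h.isCompact.isClosed.measurableSet] at hlimν
  simp only [hν] at hlimν
  refine ge_of_tendsto (ENNReal.Tendsto.const_mul
    (hlimν.mono_left (nhdsWithin_le_nhds (s := Ioi 0))) (Or.inr ENNReal.ofReal_ne_top)) ?_
  filter_upwards [Ioc_mem_nhdsGT hr] with t ht
  exact key t ht.1 ht.2

/-- Every function with finite Dirichlet integral off the closed quasidisk is a Cauchy transform. -/
theorem exists_eq_cauchyTransform (h : IsClosedQuasidisk J K M) {G : Set ℂ} (hG : IsOpen G)
    (hGK : G ⊆ K) (hKG : K ⊆ G ∪ J) {γ : ℂ → ℂ}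
    (hγ : DifferentiableOn ℂ γ Kᶜ) (hlim : Tendsto γ (cobounded ℂ) (nhds 0))
    (hfin : ∫⁻ p in Kᶜ, ‖deriv γ p‖ₑ ^ 2 ≠ ⊤) :
    ∃ g : ℂ → ℂ, MemB2 G g ∧ ∀ ζ ∉ K, γ ζ = cauchyTransform G g ζ := by
  obtain ⟨D, hD, hb⟩ := h.exists_norm_linearCombination_le hγ hlim hfin
  have hGm := hG.measurableSet
  have hae : volume.restrict K = volume.restrict G := by
    refine Measure.restrict_congr_set (ae_eq_set.2 ⟨measure_mono_null (fun z hz => ?_) h.volume_eq_zero, ?_⟩)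
    · exact (hKG hz.1).resolve_left hz.2
    · rw [sdiff_eq_empty.2 hGK, measure_empty]
  set T := poleSumLp h.isCompact h.nonempty hGK hGm with hT
  obtain ⟨x, hx, hxT⟩ := exists_mem_closure_range_inner_eq T
    (Finsupp.linearCombination ℂ fun ζ : (Kᶜ : Set ℂ) => γ ζ) (√D) fun f => by
      have h1 := hb f
      have h2 : ‖T f‖ₑ ^ 2 = ∫⁻ z in K, ‖poleSum K f z‖ₑ ^ 2 := by
        rw [enorm_sq_eq_lintegral, hae]
        refine lintegral_congr_ae ?_
        filter_upwards [coeFn_poleSumLp h.isCompact h.nonempty hGK hGm f] with z hz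
        rw [hT, hz]
      rw [← h2, ← ofReal_norm, ← ofReal_norm, ← ENNReal.ofReal_pow (norm_nonneg _),
        ← ENNReal.ofReal_pow (norm_nonneg _), ← ENNReal.ofReal_mul hD,
        ENNReal.ofReal_le_ofReal_iff (by positivity)] at h1
      refine (pow_le_pow_iff_left₀ (norm_nonneg _) (by positivity) two_ne_zero).1 ?_
      rwa [mul_pow, Real.sq_sqrt hD]
  obtain ⟨g, hg, hxg⟩ := exists_differentiableOn_of_mem_closure hG (S := Set.range T) (by
    rintro _ ⟨f, rfl⟩
    exact ⟨_, (differentiableOn_poleSum f).mono hGK, coeFn_poleSumLp h.isCompact h.nonempty hGK hGm f⟩) hx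
  refine ⟨fun z => Real.pi * g z, ⟨hg.const_mul _, ?_⟩, fun ζ hζ => ?_⟩
  · have h1 := ((memLp_congr_ae hxg).1 (Lp.memLp x)).const_mul (Real.pi : ℂ)
    have h2 := (memLp_two_iff_integrable_sq_norm h1.1).1 h1
    exact h2
  · have h1 := hxT (Finsupp.single ⟨ζ, hζ⟩ 1)
    rw [Finsupp.linearCombination_single, one_smul, L2.inner_def] at h1
    rw [← h1, cauchyTransform, ← integral_const_mul]
    refine integral_congr_ae ?_
    filter_upwards [hxg, coeFn_poleSumLp h.isCompact h.nonempty hGK hGm (Finsupp.single ⟨ζ, hζ⟩ 1)] with z h2 h3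
    rw [hT, h2, h3, poleSum, Finsupp.linearCombination_single, one_smul, RCLike.inner_apply,
      map_mul, conj_ofReal]
    have := Real.pi_ne_zero
    have h4 : (Real.pi : ℂ) ≠ 0 := ofReal_ne_zero.2 this
    field_simp

end IsClosedQuasidisk

/-- `u` is continuous and `O((1 + ‖z‖) ^ (-k))`. -/
def HasDecay (u : ℂ → ℂ) (k : ℕ) : Prop :=
  Continuous u ∧ ∃ B, ∀ z, ‖u z‖ * (1 + ‖z‖) ^ k ≤ B

namespace HasDecay

variable {u v : ℂ → ℂ} {k l : ℕ}

theorem const_mul (hu : HasDecay u k) (a : ℂ) : HasDecay (fun z => a * u z) k := by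
  obtain ⟨hc, B, hB⟩ := hu
  refine ⟨by fun_prop, ‖a‖ * B, fun z => ?_⟩
  rw [norm_mul, mul_assoc]
  gcongr
  exact hB z

theorem mul (hu : HasDecay u k) (hv : HasDecay v l) : HasDecay (fun z => u z * v z) (k + l) := by
  obtain ⟨hc, B, hB⟩ := hu
  obtain ⟨hd, D, hD⟩ := hv
  refine ⟨by fun_prop, B * D, fun z => ?_⟩
  rw [norm_mul, pow_add, mul_mul_mul_comm]
  exact mul_le_mul (hB z) (hD z) (by positivity) ((by positivity : (0 : ℝ) ≤ _).trans (hB z))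

theorem mono (hu : HasDecay u k) (hl : l ≤ k) : HasDecay u l := by
  obtain ⟨hc, B, hB⟩ := hu
  refine ⟨hc, B, fun z => le_trans ?_ (hB z)⟩
  gcongr
  exact le_add_of_nonneg_right (norm_nonneg z)

theorem star (hu : HasDecay u k) : HasDecay (fun z => (starRingEnd ℂ) (u z)) k := by
  obtain ⟨hc, B, hB⟩ := hu
  exact ⟨continuous_conj.comp hc, B, fun z => by rw [RCLike.norm_conj]; exact hB z⟩

theorem self_mul (hu : HasDecay u (k + 1)) : HasDecay (fun z => z * u z) k := by
  obtain ⟨hc, B, hB⟩ := hu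
  refine ⟨by fun_prop, B, fun z => le_trans ?_ (hB z)⟩
  have : 0 ≤ ‖u z‖ * (1 + ‖z‖) ^ k := by positivity
  rw [norm_mul, pow_succ']
  nlinarith

theorem conj_mul (hu : HasDecay u (k + 1)) : HasDecay (fun z => (starRingEnd ℂ) z * u z) k := by
  simpa using hu.star.self_mul.star

theorem comp_add (hu : HasDecay u k) (h : ℂ) : HasDecay (fun z => u (z + h)) k := by
  obtain ⟨hc, B, hB⟩ := hu
  refine ⟨by fun_prop, B * (1 + ‖h‖) ^ k, fun z => ?_⟩
  have h1 : 1 + ‖z‖ ≤ (1 + ‖z + h‖) * (1 + ‖h‖) := by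
    have := norm_sub_le (z + h) h
    rw [add_sub_cancel_right] at this
    nlinarith [norm_nonneg h, norm_nonneg (z + h)]
  calc ‖u (z + h)‖ * (1 + ‖z‖) ^ k ≤ ‖u (z + h)‖ * ((1 + ‖z + h‖) * (1 + ‖h‖)) ^ k := by gcongr
    _ = ‖u (z + h)‖ * (1 + ‖z + h‖) ^ k * (1 + ‖h‖) ^ k := by rw [mul_pow]; ring
    _ ≤ _ := by
      gcongr
      exact hB _

theorem integrable (hu : HasDecay u k) (hk : 3 ≤ k) : Integrable u := by
  obtain ⟨hc, B, hB⟩ := hu.mono hk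
  have h := integrable_one_add_norm (E := ℂ) (r := 3) (μ := volume)
    (by rw [Complex.finrank_real_complex]; norm_num)
  refine (h.const_mul B).mono' hc.aestronglyMeasurable (Eventually.of_forall fun z => ?_)
  have e : (-3 : ℝ) = -((3 : ℕ) : ℝ) := by norm_num
  rw [e, Real.rpow_neg (by positivity), Real.rpow_natCast, ← div_eq_mul_inv,
    le_div_iff₀ (by positivity)]
  exact hB z

end HasDecay

/-- `a` and `b` are the Wirtinger derivatives `∂u/∂z` and `∂u/∂z̄`. -/
def HasWirtinger (u a b : ℂ → ℂ) : Prop :=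
  ∀ z w, HasLineDerivAt ℝ u (a z * w + b z * (starRingEnd ℂ) w) z w

namespace HasWirtinger

variable {u v a b a' b' : ℂ → ℂ}

theorem congr (hu : HasWirtinger u a b) (ha : ∀ z, a z = a' z) (hb : ∀ z, b z = b' z) :
    HasWirtinger u a' b' := by
  rwa [← funext ha, ← funext hb]

theorem id : HasWirtinger (fun z => z) (fun _ => 1) (fun _ => 0) := fun z w => by
  change HasDerivAt (fun t : ℝ => z + t • w) _ 0
  simpa using ((hasDerivAt_id (0 : ℝ)).smul_const w).const_add z

theorem star (hu : HasWirtinger u a b) : HasWirtinger (fun z => (starRingEnd ℂ) (u z))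
    (fun z => (starRingEnd ℂ) (b z)) (fun z => (starRingEnd ℂ) (a z)) := fun z w => by
  have h : HasDerivAt (fun t : ℝ => u (z + t • w)) _ 0 := hu z w
  change HasDerivAt (fun t : ℝ => (starRingEnd ℂ) (u (z + t • w))) _ 0
  have := h.star
  simp only [RCLike.star_def, map_add, map_mul, conj_conj] at this
  rwa [add_comm] at this

theorem const_mul (hu : HasWirtinger u a b) (k : ℂ) :
    HasWirtinger (fun z => k * u z) (fun z => k * a z) (fun z => k * b z) := fun z w => by
  have h : HasDerivAt (fun t : ℝ => u (z + t • w)) _ 0 := hu z w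
  change HasDerivAt (fun t : ℝ => k * u (z + t • w)) _ 0
  exact (h.const_mul k).congr_deriv (by ring)

theorem mul (hu : HasWirtinger u a b) (hv : HasWirtinger v a' b') :
    HasWirtinger (fun z => u z * v z) (fun z => a z * v z + u z * a' z)
      (fun z => b z * v z + u z * b' z) := fun z w => by
  have h : HasDerivAt (fun t : ℝ => u (z + t • w)) _ 0 := hu z w
  have h' : HasDerivAt (fun t : ℝ => v (z + t • w)) _ 0 := hv z w
  change HasDerivAt (fun t : ℝ => u (z + t • w) * v (z + t • w)) _ 0
  refine (h.fun_mul h').congr_deriv ?_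
  simp only [zero_smul, add_zero]
  ring

theorem add_const (hu : HasWirtinger u a b) (k : ℂ) : HasWirtinger (fun z => u z + k) a b :=
  fun z w => by
  have h : HasDerivAt (fun t : ℝ => u (z + t • w)) _ 0 := hu z w
  exact h.add_const k

theorem inv (hu : HasWirtinger u a b) (h0 : ∀ z, u z ≠ 0) :
    HasWirtinger (fun z => (u z)⁻¹) (fun z => -a z * (u z)⁻¹ ^ 2)
      (fun z => -b z * (u z)⁻¹ ^ 2) := fun z w => by
  have h : HasDerivAt (fun t : ℝ => u (z + t • w)) _ 0 := hu z w
  change HasDerivAt (fun t : ℝ => (u (z + t • w))⁻¹) _ 0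
  refine (h.fun_inv (by simpa using h0 z)).congr_deriv ?_
  simp only [zero_smul, add_zero]
  have := h0 z
  field_simp
  ring

theorem comp_add (hu : HasWirtinger u a b) (h : ℂ) :
    HasWirtinger (fun z => u (z + h)) (fun z => a (z + h)) (fun z => b (z + h)) := fun z w => by
  have := hu (z + h) w
  change HasDerivAt (fun t : ℝ => u (z + t • w + h)) _ 0
  simpa only [HasLineDerivAt, add_right_comm] using this

/-- Integration by parts for the Wirtinger derivatives. -/
theorem integral_mul (hu : HasWirtinger u a b) (hv : HasWirtinger v a' b') (du : HasDecay u 2)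
    (da : HasDecay a 3) (db : HasDecay b 3) (dv : HasDecay v 1) (da' : HasDecay a' 1)
    (db' : HasDecay b' 1) :
    ∫ z, u z * a' z = -∫ z, a z * v z ∧ ∫ z, u z * b' z = -∫ z, b z * v z := by
  have i1 := (du.mul da').integrable (by norm_num)
  have i2 := (du.mul db').integrable (by norm_num)
  have i3 := (da.mul dv).integrable (by norm_num)
  have i4 := (db.mul dv).integrable (by norm_num)
  have i5 := (du.mul dv).integrable (by norm_num)
  have key : ∀ w : ℂ, (∫ z, u z * a' z) * w + (∫ z, u z * b' z) * (starRingEnd ℂ) w =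
      -((∫ z, a z * v z) * w + (∫ z, b z * v z) * (starRingEnd ℂ) w) := fun w => by
    have e1 : (fun z => u z * (a' z * w + b' z * (starRingEnd ℂ) w)) =
        fun z => u z * a' z * w + u z * b' z * (starRingEnd ℂ) w := by funext z; ring
    have e2 : (fun z => (a z * w + b z * (starRingEnd ℂ) w) * v z) =
        fun z => a z * v z * w + b z * v z * (starRingEnd ℂ) w := by funext z; ring
    have h := integral_bilinear_hasLineDerivAt_right_eq_neg_left_of_integrable
      (μ := (volume : Measure ℂ)) (B := ContinuousLinearMap.mul ℝ ℂ) (f := u) (g := v) (v := w)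
      (f' := fun z => a z * w + b z * (starRingEnd ℂ) w)
      (g' := fun z => a' z * w + b' z * (starRingEnd ℂ) w)
      (by simp only [ContinuousLinearMap.mul_apply']
          rw [e2]; exact (i3.mul_const _).add (i4.mul_const _))
      (by simp only [ContinuousLinearMap.mul_apply']
          rw [e1]; exact (i1.mul_const _).add (i2.mul_const _))
      (by simpa only [ContinuousLinearMap.mul_apply'] using i5)
      (fun z _ => hu z w) (fun z _ => hv z w)
    simp only [ContinuousLinearMap.mul_apply'] at h
    rwa [e1, e2, integral_add (i1.mul_const _) (i2.mul_const _),
      integral_add (i3.mul_const _) (i4.mul_const _), integral_mul_const, integral_mul_const,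
      integral_mul_const, integral_mul_const] at h
  have h1 := key 1
  have h2 := key I
  simp only [map_one, conj_I, mul_one] at h1 h2
  constructor
  · linear_combination h1 / 2 - I * h2 / 2 + ((∫ z, u z * a' z) - (∫ z, u z * b' z)
      + (∫ z, a z * v z) - (∫ z, b z * v z)) / 2 * I_sq
  · linear_combination h1 / 2 + I * h2 / 2 - ((∫ z, u z * a' z) - (∫ z, u z * b' z)
      + (∫ z, a z * v z) - (∫ z, b z * v z)) / 2 * I_sq

end HasWirtinger

/-- The `∂`-derivative of `regKer c`. -/
noncomputable def beurlingKer (c : ℝ) (z : ℂ) : ℂ :=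
  -(c : ℂ) ^ 4 * ((starRingEnd ℂ) z * (((c ^ 2 * ‖z‖ ^ 2 + 1 : ℝ) : ℂ))⁻¹) ^ 2

theorem ofReal_den_eq (c : ℝ) (z : ℂ) : ((c ^ 2 * ‖z‖ ^ 2 + 1 : ℝ) : ℂ) =
    (c : ℂ) ^ 2 * (z * (starRingEnd ℂ) z) + 1 := by
  rw [Complex.mul_conj, Complex.normSq_eq_norm_sq]
  push_cast
  ring

theorem ofReal_den_ne_zero (c : ℝ) (z : ℂ) : ((c ^ 2 * ‖z‖ ^ 2 + 1 : ℝ) : ℂ) ≠ 0 :=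
  ofReal_ne_zero.2 (regKer_den_pos c z).ne'

theorem hasDecay_inv_den {c : ℝ} (hc : 0 < c) :
    HasDecay (fun z => (((c ^ 2 * ‖z‖ ^ 2 + 1 : ℝ) : ℂ))⁻¹) 2 := by
  refine ⟨Continuous.inv₀ (by fun_prop) (ofReal_den_ne_zero c), 2 * ((c ^ 2)⁻¹ + 1), fun z => ?_⟩
  have h := regKer_den_pos c z
  rw [norm_inv, Complex.norm_real, Real.norm_of_nonneg h.le, inv_mul_le_iff₀ h]
  have h2 : c ^ 2 * (c ^ 2)⁻¹ = 1 := mul_inv_cancel₀ (by positivity)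
  have h3 : 0 < (c ^ 2)⁻¹ := by positivity
  have e : (c ^ 2 * ‖z‖ ^ 2 + 1) * (2 * ((c ^ 2)⁻¹ + 1)) =
    2 * (c ^ 2 * (c ^ 2)⁻¹) * ‖z‖ ^ 2 + 2 * c ^ 2 * ‖z‖ ^ 2 + 2 * (c ^ 2)⁻¹ + 2 := by ring
  rw [e, h2]
  have : 0 ≤ c ^ 2 * ‖z‖ ^ 2 := by positivity
  nlinarith [sq_nonneg (‖z‖ - 1)]

theorem hasWirtinger_inv_den (c : ℝ) : HasWirtinger (fun z => (((c ^ 2 * ‖z‖ ^ 2 + 1 : ℝ) : ℂ))⁻¹)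
    (fun z => -(c : ℂ) ^ 2 * (starRingEnd ℂ) z * (((c ^ 2 * ‖z‖ ^ 2 + 1 : ℝ) : ℂ))⁻¹ ^ 2)
    (fun z => -(c : ℂ) ^ 2 * z * (((c ^ 2 * ‖z‖ ^ 2 + 1 : ℝ) : ℂ))⁻¹ ^ 2) := by
  have h := ((((HasWirtinger.id.mul HasWirtinger.id.star).const_mul ((c : ℂ) ^ 2)).add_const 1).inv
    fun z => (ofReal_den_eq c z) ▸ ofReal_den_ne_zero c z)
  simp only [← ofReal_den_eq] at h
  refine h.congr (fun z => ?_) fun z => ?_ <;> simp only [map_zero, map_one] <;> ring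

theorem bumpKer_eq_inv (c : ℝ) (z : ℂ) : (bumpKer c z : ℂ) =
    (c : ℂ) ^ 2 * ((((c ^ 2 * ‖z‖ ^ 2 + 1 : ℝ) : ℂ))⁻¹ * (((c ^ 2 * ‖z‖ ^ 2 + 1 : ℝ) : ℂ))⁻¹) := by
  rw [bumpKer, ofReal_div, ofReal_pow, ofReal_pow (c ^ 2 * ‖z‖ ^ 2 + 1), div_eq_mul_inv, ← inv_pow,
    sq (((c ^ 2 * ‖z‖ ^ 2 + 1 : ℝ) : ℂ))⁻¹]

theorem hasDecay_beurlingKer {c : ℝ} (hc : 0 < c) : HasDecay (beurlingKer c) 2 := by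
  have h := HasDecay.conj_mul (k := 1) (hasDecay_inv_den hc)
  have := (h.mul h).const_mul (-(c : ℂ) ^ 4)
  simp only [← sq] at this
  exact this

theorem hasDecay_bumpKer {c : ℝ} (hc : 0 < c) : HasDecay (fun z => (bumpKer c z : ℂ)) 4 := by
  have := ((hasDecay_inv_den hc).mul (hasDecay_inv_den hc)).const_mul ((c : ℂ) ^ 2)
  simpa only [bumpKer_eq_inv] using this

/-- The kernels `beurlingKer c` and `bumpKer c` have the same autocorrelation. -/
theorem integral_beurlingKer_mul_conj {c : ℝ} (hc : 0 < c) (h : ℂ) :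
    ∫ z, beurlingKer c z * (starRingEnd ℂ) (beurlingKer c (z + h)) =
      ∫ z, (bumpKer c z : ℂ) * (starRingEnd ℂ) (bumpKer c (z + h) : ℂ) := by
  set e : ℂ → ℂ := fun z => (((c ^ 2 * ‖z‖ ^ 2 + 1 : ℝ) : ℂ))⁻¹ with he
  have hez : ∀ z, (c : ℂ) ^ 2 * (z * (starRingEnd ℂ) z) * e z = 1 - e z := fun z => by
    have := mul_inv_cancel₀ (ofReal_den_ne_zero c z)
    rw [ofReal_den_eq] at this
    change _ = 1 - (((c ^ 2 * ‖z‖ ^ 2 + 1 : ℝ) : ℂ))⁻¹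
    simp only [he, ofReal_den_eq]
    linear_combination this
  have de := hasDecay_inv_den hc
  have we := hasWirtinger_inv_den c
  have wr := ((HasWirtinger.id.star.mul we).const_mul ((c : ℂ) ^ 2))
  have dr : HasDecay (fun z => (c : ℂ) ^ 2 * ((starRingEnd ℂ) z * e z)) 1 :=
    (HasDecay.conj_mul (k := 1) de).const_mul _
  have wr' : HasWirtinger (fun z => (c : ℂ) ^ 2 * ((starRingEnd ℂ) z * e z)) (beurlingKer c)
      (fun z => (bumpKer c z : ℂ)) := wr.congr
    (fun z => by rw [beurlingKer]; simp only [map_zero]; ring)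
    (fun z => by
      rw [bumpKer_eq_inv]
      change (c : ℂ) ^ 2 * ((starRingEnd ℂ) 1 * e z + _ * (-(c : ℂ) ^ 2 * z * e z ^ 2)) =
        (c : ℂ) ^ 2 * (e z * e z)
      rw [map_one]
      linear_combination -(c : ℂ) ^ 2 * e z * hez z)
  have dp := hasDecay_beurlingKer hc
  have dq := hasDecay_bumpKer hc
  have d3 := de.mul (de.mul de)
  have wp : HasWirtinger (beurlingKer c)
      (fun z => 2 * (c : ℂ) ^ 6 * ((starRingEnd ℂ) z * ((starRingEnd ℂ) z * ((starRingEnd ℂ) z *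
        (e z * (e z * e z))))))
      (fun z => -2 * (c : ℂ) ^ 4 * ((starRingEnd ℂ) z * (e z * (e z * e z)))) := by
    have w1 := HasWirtinger.id.star.mul we
    have w2 := (w1.mul w1).const_mul (-(c : ℂ) ^ 4)
    simp only [← sq] at w2
    refine HasWirtinger.congr w2 (fun z => ?_) fun z => ?_
    · simp only [map_zero]
      change -(c : ℂ) ^ 4 * ((0 * e z + (starRingEnd ℂ) z * (-(c : ℂ) ^ 2 * (starRingEnd ℂ) z *
        e z ^ 2)) * ((starRingEnd ℂ) z * e z) + (starRingEnd ℂ) z * e z * (0 * e z +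
        (starRingEnd ℂ) z * (-(c : ℂ) ^ 2 * (starRingEnd ℂ) z * e z ^ 2))) = _
      ring
    · simp only [map_one]
      change -(c : ℂ) ^ 4 * ((1 * e z + (starRingEnd ℂ) z * (-(c : ℂ) ^ 2 * z * e z ^ 2)) *
        ((starRingEnd ℂ) z * e z) + (starRingEnd ℂ) z * e z * (1 * e z +
        (starRingEnd ℂ) z * (-(c : ℂ) ^ 2 * z * e z ^ 2))) = _
      linear_combination 2 * (c : ℂ) ^ 4 * (starRingEnd ℂ) z * e z ^ 2 * hez z
  have wq : HasWirtinger (fun z => (bumpKer c z : ℂ))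
      (fun z => -2 * (c : ℂ) ^ 4 * ((starRingEnd ℂ) z * (e z * (e z * e z))))
      (fun z => -2 * (c : ℂ) ^ 4 * (z * (e z * (e z * e z)))) := by
    have w2 := (we.mul we).const_mul ((c : ℂ) ^ 2)
    simp only [bumpKer_eq_inv]
    refine HasWirtinger.congr w2 (fun z => ?_) fun z => ?_ <;> simp only [he] <;> ring
  have wR := (wr'.comp_add h).star
  have dR := (dr.comp_add h).star
  have dp' := ((dp.comp_add h).star).mono (l := 1) (by norm_num)
  have dq' := ((dq.comp_add h).star).mono (l := 1) (by norm_num)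
  have i1 := (wp.integral_mul wR dp
    ((HasDecay.conj_mul (HasDecay.conj_mul (HasDecay.conj_mul (k := 5) d3))).const_mul _)
    (((HasDecay.conj_mul (k := 5) d3).const_mul _).mono (by norm_num)) dR dq' dp').2
  have i2 := (wq.integral_mul wR (dq.mono (by norm_num))
    (((HasDecay.conj_mul (k := 5) d3).const_mul _).mono (by norm_num))
    (((HasDecay.self_mul (k := 5) d3).const_mul _).mono (by norm_num)) dR dq' dp').1
  rw [i1, i2]

section Convolution

variable {φ k l : ℂ → ℂ}

theorem integrable_autocorrelation_integrand (hφ : Integrable φ) (hk : HasDecay k 2) :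
    Integrable (fun x : (ℂ × ℂ) × ℂ => φ x.1.1 * (starRingEnd ℂ) (φ x.1.2) *
      (k (x.2 - x.1.1) * (starRingEnd ℂ) (k (x.2 - x.1.2))))
      ((volume.prod volume).prod volume) := by
  have hc := hk.1
  have hφ' : Integrable fun w => (starRingEnd ℂ) (φ w) :=
    Complex.conjLIE.toContinuousLinearEquiv.integrable_comp_iff.2 hφ
  have hP : Integrable (fun x : ℂ × ℂ => φ x.1 * (starRingEnd ℂ) (φ x.2))
      (volume.prod volume) := hφ.mul_prod hφ'
  have hm : AEStronglyMeasurable (fun x : (ℂ × ℂ) × ℂ => φ x.1.1 * (starRingEnd ℂ) (φ x.1.2) *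
      (k (x.2 - x.1.1) * (starRingEnd ℂ) (k (x.2 - x.1.2))))
      ((volume.prod volume).prod volume) := by
    refine hP.aestronglyMeasurable.comp_fst.mul (Continuous.aestronglyMeasurable ?_)
    exact (by fun_prop : Continuous fun x : (ℂ × ℂ) × ℂ => k (x.2 - x.1.1)).mul
      (continuous_conj.comp (by fun_prop : Continuous fun x : (ℂ × ℂ) × ℂ => k (x.2 - x.1.2)))
  have hk2 : Integrable fun z => ‖k z‖ ^ 2 := by
    have := ((hk.mul hk).integrable (by norm_num)).norm
    simpa only [norm_mul, ← sq, norm_pow] using this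
  have hi : ∀ w w' : ℂ, Integrable fun z => k (z - w) * (starRingEnd ℂ) (k (z - w')) :=
    fun w w' => by
      have := ((hk.comp_add (-w)).mul (hk.comp_add (-w')).star).integrable (by norm_num)
      simpa only [← sub_eq_add_neg] using this
  rw [integrable_prod_iff hm]
  refine ⟨Eventually.of_forall fun x => (hi x.1 x.2).const_mul (φ x.1 * (starRingEnd ℂ) (φ x.2)), ?_⟩
  refine (hP.norm.mul_const (∫ z, ‖k z‖ ^ 2)).mono' hm.norm.integral_prod_right'
    (Eventually.of_forall fun x => ?_)
  simp only [norm_mul, RCLike.norm_conj]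
  rw [Real.norm_of_nonneg (integral_nonneg fun z => by positivity), integral_const_mul]
  refine mul_le_mul_of_nonneg_left ?_ (by positivity)
  have h1 := hk2.comp_sub_right x.1
  have h2 := hk2.comp_sub_right x.2
  calc ∫ z, ‖k (z - x.1)‖ * ‖k (z - x.2)‖
      ≤ ∫ z, 2⁻¹ * (‖k (z - x.1)‖ ^ 2 + ‖k (z - x.2)‖ ^ 2) := by
        refine integral_mono ?_ ((h1.add h2).const_mul _) fun z => ?_
        · simpa only [norm_mul, RCLike.norm_conj] using (hi x.1 x.2).norm
        · change ‖k (z - x.1)‖ * ‖k (z - x.2)‖ ≤ 2⁻¹ * (‖k (z - x.1)‖ ^ 2 + ‖k (z - x.2)‖ ^ 2)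
          nlinarith [sq_nonneg (‖k (z - x.1)‖ - ‖k (z - x.2)‖)]
    _ = ∫ z, ‖k z‖ ^ 2 := by
        rw [integral_const_mul, integral_add h1 h2,
          integral_sub_right_eq_self (fun z => ‖k z‖ ^ 2) x.1,
          integral_sub_right_eq_self (fun z => ‖k z‖ ^ 2) x.2]
        ring

theorem norm_sq_convolution_eq (z : ℂ) :
    ((‖∫ w, φ w * k (z - w)‖ ^ 2 : ℝ) : ℂ) = ∫ x : ℂ × ℂ, φ x.1 * (starRingEnd ℂ) (φ x.2) *
      (k (z - x.1) * (starRingEnd ℂ) (k (z - x.2))) ∂(volume.prod volume) := by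
  rw [ofReal_pow, ← Complex.mul_conj', ← integral_conj, ← integral_prod_mul]
  refine integral_congr_ae (Eventually.of_forall fun x => ?_)
  simp only [map_mul]
  ring

theorem integrable_norm_sq_convolution (hφ : Integrable φ) (hk : HasDecay k 2) :
    Integrable fun z => ‖∫ w, φ w * k (z - w)‖ ^ 2 := by
  have h := (integrable_autocorrelation_integrand hφ hk).integral_prod_right
  simp only [← norm_sq_convolution_eq] at h
  exact h.re

/-- The `L²` norm of a convolution depends on the kernel only through its autocorrelation. -/
theorem integral_norm_sq_convolution_eq (hφ : Integrable φ) (hk : HasDecay k 2)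
    (hl : HasDecay l 2) (hkl : ∀ h, ∫ z, k z * (starRingEnd ℂ) (k (z + h)) =
      ∫ z, l z * (starRingEnd ℂ) (l (z + h))) :
    ∫ z, ‖∫ w, φ w * k (z - w)‖ ^ 2 = ∫ z, ‖∫ w, φ w * l (z - w)‖ ^ 2 := by
  have key : ∀ {m : ℂ → ℂ}, HasDecay m 2 → ((∫ z, ‖∫ w, φ w * m (z - w)‖ ^ 2 : ℝ) : ℂ) =
      ∫ x : ℂ × ℂ, φ x.1 * (starRingEnd ℂ) (φ x.2) *
        ∫ z, m z * (starRingEnd ℂ) (m (z + (x.1 - x.2))) := fun {m} hm => by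
    have hF := integrable_autocorrelation_integrand hφ hm
    rw [← integral_complex_ofReal]
    simp only [norm_sq_convolution_eq]
    rw [← integral_prod_symm _ hF, integral_prod _ hF]
    refine integral_congr_ae (Eventually.of_forall fun x => ?_)
    simp only
    rw [integral_const_mul,
      ← integral_add_right_eq_self (fun z => m (z - x.1) * (starRingEnd ℂ) (m (z - x.2))) x.1]
    simp only [add_sub_cancel_right, add_sub_assoc]
  have := (key hk).trans ((integral_congr_ae (Eventually.of_forall fun x => ?_)).trans (key hl).symm)
  · exact_mod_cast this
  · rw [hkl]

theorem lintegral_enorm_sq_convolution_eq (hφ : Integrable φ) (hk : HasDecay k 2)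
    (hl : HasDecay l 2) (hkl : ∀ h, ∫ z, k z * (starRingEnd ℂ) (k (z + h)) =
      ∫ z, l z * (starRingEnd ℂ) (l (z + h))) :
    ∫⁻ z, ‖∫ w, φ w * k (z - w)‖ₑ ^ 2 = ∫⁻ z, ‖∫ w, φ w * l (z - w)‖ₑ ^ 2 := by
  have key : ∀ {m : ℂ → ℂ}, HasDecay m 2 → ∫⁻ z, ‖∫ w, φ w * m (z - w)‖ₑ ^ 2 =
      ENNReal.ofReal (∫ z, ‖∫ w, φ w * m (z - w)‖ ^ 2) := fun {m} hm => by
    rw [ofReal_integral_eq_lintegral_ofReal (integrable_norm_sq_convolution hφ hm)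
      (Eventually.of_forall fun z => by positivity)]
    simp only [ENNReal.ofReal_pow (norm_nonneg _), ofReal_norm]
  rw [key hk, key hl, integral_norm_sq_convolution_eq hφ hk hl hkl]

/-- Young's inequality for the convolution of an `L²` function with a square. -/
theorem lintegral_enorm_sq_convolution_le (hφ : Measurable φ) {s : ℂ → ℂ} (hs : Continuous s) :
    ∫⁻ z, ‖∫ w, φ w * s (z - w) ^ 2‖ₑ ^ 2 ≤
      (∫⁻ z, ‖s z‖ₑ ^ 2) ^ 2 * ∫⁻ w, ‖φ w‖ₑ ^ 2 := by
  calc ∫⁻ z, ‖∫ w, φ w * s (z - w) ^ 2‖ₑ ^ 2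
      ≤ ∫⁻ z, (∫⁻ w, ‖φ w‖ₑ ^ 2 * ‖s (z - w)‖ₑ ^ 2) * ∫⁻ z, ‖s z‖ₑ ^ 2 := by
        refine lintegral_mono fun z => ?_
        calc ‖∫ w, φ w * s (z - w) ^ 2‖ₑ ^ 2
            ≤ (∫⁻ w, ‖φ w * s (z - w) ^ 2‖ₑ) ^ 2 := by
              gcongr
              exact enorm_integral_le_lintegral_enorm _
          _ = (∫⁻ w, (‖φ w‖ₑ * ‖s (z - w)‖ₑ) * ‖s (z - w)‖ₑ) ^ 2 := by
              simp only [enorm_mul, sq, mul_assoc]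
          _ ≤ (∫⁻ w, (‖φ w‖ₑ * ‖s (z - w)‖ₑ) ^ 2) * ∫⁻ w, ‖s (z - w)‖ₑ ^ 2 :=
              sq_lintegral_mul_le _ (by fun_prop) (by fun_prop)
          _ = _ := by
              simp only [mul_pow]
              rw [lintegral_sub_left_eq_self (fun w => ‖s w‖ₑ ^ 2) z]
    _ = (∫⁻ z, ∫⁻ w, ‖φ w‖ₑ ^ 2 * ‖s (z - w)‖ₑ ^ 2) * ∫⁻ z, ‖s z‖ₑ ^ 2 := by
        rw [lintegral_mul_const]
        exact Measurable.lintegral_prod_right' (f := fun x : ℂ × ℂ =>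
          ‖φ x.2‖ₑ ^ 2 * ‖s (x.1 - x.2)‖ₑ ^ 2)
          (by have := hs.measurable; fun_prop)
    _ = (∫⁻ w, ‖φ w‖ₑ ^ 2 * ∫⁻ z, ‖s z‖ₑ ^ 2) * ∫⁻ z, ‖s z‖ₑ ^ 2 := by
        congr 1
        rw [lintegral_lintegral_swap (by fun_prop)]
        refine lintegral_congr fun w => ?_
        rw [lintegral_const_mul _ (by have := hs.measurable; fun_prop),
          lintegral_sub_right_eq_self (fun z => ‖s z‖ₑ ^ 2) w]
    _ = _ := by
        rw [lintegral_mul_const _ (by fun_prop)]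
        ring

end Convolution

theorem integral_bumpKer {c : ℝ} (hc : 0 < c) : ∫ z, bumpKer c z = ∫ z, bumpKer 1 z := by
  simp only [bumpKer_eq c]
  rw [integral_const_mul, Measure.integral_comp_smul_of_nonneg _ _ _ (hR := hc.le),
    Complex.finrank_real_complex, smul_eq_mul, mul_inv_cancel_left₀ (by positivity)]

theorem integrable_bumpKer {c : ℝ} (hc : 0 < c) : Integrable (bumpKer c) := by
  exact ((hasDecay_bumpKer hc).integrable (by norm_num)).re

/-- The `L²` bound for the regularised Beurling transform. -/
theorem lintegral_enorm_sq_beurling_le {φ : ℂ → ℂ} (hm : Measurable φ) (hφ : Integrable φ) {c : ℝ}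
    (hc : 0 < c) : ∫⁻ z, ‖∫ w, φ w * beurlingKer c (z - w)‖ₑ ^ 2 ≤
      ENNReal.ofReal (∫ z, bumpKer 1 z) ^ 2 * ∫⁻ w, ‖φ w‖ₑ ^ 2 := by
  rw [lintegral_enorm_sq_convolution_eq hφ (hasDecay_beurlingKer hc)
    ((hasDecay_bumpKer hc).mono (by norm_num)) (integral_beurlingKer_mul_conj hc)]
  have hs : Continuous fun z => (c : ℂ) * (((c ^ 2 * ‖z‖ ^ 2 + 1 : ℝ) : ℂ))⁻¹ :=
    continuous_const.mul (hasDecay_inv_den hc).1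
  have h := lintegral_enorm_sq_convolution_le hm hs
  have e : ∀ z, (bumpKer c z : ℂ) = ((c : ℂ) * (((c ^ 2 * ‖z‖ ^ 2 + 1 : ℝ) : ℂ))⁻¹) ^ 2 :=
    fun z => by rw [bumpKer_eq_inv]; ring
  simp only [← e, ← enorm_pow] at h ⊢
  refine h.trans_eq ?_
  rw [← integral_bumpKer hc, ofReal_integral_eq_lintegral_ofReal (integrable_bumpKer hc)
    (Eventually.of_forall (bumpKer_nonneg c))]
  congr 2
  refine lintegral_congr fun z => ?_
  rw [← ofReal_norm, Complex.norm_real, Real.norm_of_nonneg (bumpKer_nonneg c z)]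

theorem norm_beurlingKer_le (c : ℝ) (z : ℂ) : ‖beurlingKer c z‖ ≤ (‖z‖ ^ 2)⁻¹ := by
  rcases eq_or_ne z 0 with rfl | hz
  · simp [beurlingKer]
  have hz : 0 < ‖z‖ := norm_pos_iff.2 hz
  have hd := regKer_den_pos c z
  rw [beurlingKer, norm_mul, norm_neg, norm_pow, norm_pow, norm_mul, norm_inv, RCLike.norm_conj,
    Complex.norm_real, Complex.norm_real, Real.norm_of_nonneg hd.le, Real.norm_eq_abs,
    (by rw [← sq_abs (c ^ 2), abs_pow]; ring : |c| ^ 4 = (c ^ 2) ^ 2), ← mul_pow, ← inv_pow]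
  refine pow_le_pow_left₀ (by positivity) ?_ 2
  rw [← mul_assoc, ← div_eq_mul_inv, div_le_iff₀ hd, inv_mul_eq_div, le_div_iff₀ hz]
  nlinarith

theorem tendsto_beurlingKer {z : ℂ} (hz : z ≠ 0) :
    Tendsto (fun c => beurlingKer c z) atTop (nhds (-(z ^ 2)⁻¹)) := by
  have hp : 0 < ‖z‖ ^ 2 := by positivity
  have h := ((((continuous_ofReal.tendsto _).comp (tendsto_den hp)).mul_const
    ((starRingEnd ℂ) z)).pow 2).neg
  have e : ((((‖z‖ ^ 2)⁻¹ : ℝ) : ℂ)) * (starRingEnd ℂ) z = z⁻¹ := by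
    rw [Complex.inv_def, Complex.normSq_eq_norm_sq, mul_comm]
  rw [e, inv_pow] at h
  refine h.congr fun c => ?_
  simp only [Function.comp_apply, beurlingKer]
  push_cast
  ring

section CauchyIntegral

variable {φ : ℂ → ℂ} {K : Set ℂ}

theorem exists_pos_le_norm_sub (hK : IsClosed K) {ζ : ℂ} (hζ : ζ ∉ K) :
    ∃ δ > 0, ∀ ξ ∈ ball ζ δ, ∀ z ∈ K, δ ≤ ‖z - ξ‖ := by
  obtain ⟨ε, hε, hb⟩ := Metric.isOpen_iff.1 hK.isOpen_compl ζ hζ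
  refine ⟨ε / 2, by positivity, fun ξ hξ z hz => ?_⟩
  by_contra! h
  refine hb ?_ hz
  rw [← dist_eq_norm] at h
  rw [mem_ball] at *
  linarith [dist_triangle z ξ ζ]

theorem hasDerivAt_cauchyIntegral (hφ : Integrable φ) (hK : IsClosed K) (h0 : ∀ z ∉ K, φ z = 0)
    {ζ : ℂ} (hζ : ζ ∉ K) :
    HasDerivAt (fun ζ => ∫ z, φ z / (z - ζ)) (∫ z, φ z / (z - ζ) ^ 2) ζ := by
  obtain ⟨δ, hδ, hδK⟩ := exists_pos_le_norm_sub hK hζ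
  have hm : ∀ (ξ : ℂ) (n : ℕ), AEStronglyMeasurable (fun z => φ z / (z - ξ) ^ n) := fun ξ n => by
    have : Measurable fun z : ℂ => ((z - ξ) ^ n)⁻¹ := by fun_prop
    simp only [div_eq_mul_inv]
    exact hφ.aestronglyMeasurable.mul this.aestronglyMeasurable
  have hb : ∀ ξ ∈ ball ζ δ, ∀ (n : ℕ) (z : ℂ), ‖φ z / (z - ξ) ^ n‖ ≤ ‖φ z‖ * (δ ^ n)⁻¹ :=
    fun ξ hξ n z => by
    by_cases hz : z ∈ K
    · rw [norm_div, norm_pow, div_eq_mul_inv]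
      have := hδK ξ hξ z hz
      gcongr
    · simp [h0 z hz]
  refine (hasDerivAt_integral_of_dominated_loc_of_deriv_le (F := fun ζ z => φ z / (z - ζ))
    (F' := fun ζ z => φ z / (z - ζ) ^ 2) (bound := fun z => ‖φ z‖ * (δ ^ 2)⁻¹)
    (ball_mem_nhds ζ hδ) ?_ ?_ (hm ζ 2) ?_ (hφ.norm.mul_const _) ?_).2
  · exact Eventually.of_forall fun ξ => by simpa only [pow_one] using hm ξ 1
  · refine (hφ.norm.mul_const (δ ^ 1)⁻¹).mono' (by simpa only [pow_one] using hm ζ 1)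
      (Eventually.of_forall fun z => ?_)
    simpa only [pow_one] using hb ζ (mem_ball_self hδ) 1 z
  · exact Eventually.of_forall fun z ξ hξ => hb ξ hξ 2 z
  · refine Eventually.of_forall fun z ξ hξ => ?_
    by_cases hz : z ∈ K
    · have hne : z - ξ ≠ 0 := norm_pos_iff.1 (hδ.trans_le (hδK ξ hξ z hz))
      refine (((hasDerivAt_id ξ).const_sub z).fun_inv hne).const_mul (φ z) |>.congr_deriv ?_
      simp only [id]
      field_simp
    · simp only [h0 z hz, zero_div]
      exact hasDerivAt_const _ _

theorem tendsto_integral_beurlingKer (hφ : Integrable φ) (hK : IsClosed K)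
    (h0 : ∀ z ∉ K, φ z = 0) {ζ : ℂ} (hζ : ζ ∉ K) :
    Tendsto (fun c => ∫ z, φ z * beurlingKer c (ζ - z)) atTop
      (nhds (-∫ z, φ z / (z - ζ) ^ 2)) := by
  obtain ⟨δ, hδ, hδK⟩ := exists_pos_le_norm_sub hK hζ
  rw [← integral_neg]
  refine tendsto_integral_filter_of_dominated_convergence (fun z => ‖φ z‖ * (δ ^ 2)⁻¹)
    ?_ ?_ (hφ.norm.mul_const _) ?_
  · filter_upwards [eventually_gt_atTop 0] with c hc
    have := (hasDecay_beurlingKer hc).1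
    exact hφ.aestronglyMeasurable.mul (by fun_prop : Continuous fun z =>
      beurlingKer c (ζ - z)).aestronglyMeasurable
  · refine Eventually.of_forall fun c => Eventually.of_forall fun z => ?_
    by_cases hz : z ∈ K
    · rw [norm_mul]
      have := hδK ζ (mem_ball_self hδ) z hz
      rw [norm_sub_rev] at this
      refine mul_le_mul_of_nonneg_left ((norm_beurlingKer_le c _).trans ?_) (norm_nonneg _)
      gcongr
    · simp [h0 z hz]
  · refine Eventually.of_forall fun z => ?_
    by_cases hz : z ∈ K
    · have h := (tendsto_beurlingKer (sub_ne_zero.2 (ne_of_mem_of_not_mem hz hζ).symm)).const_mul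
        (φ z)
      rwa [← neg_sub z ζ, neg_sq, mul_neg, ← div_eq_mul_inv, neg_sub] at h
    · simp [h0 z hz]

theorem lintegral_enorm_sq_cauchyIntegral_le (hm : Measurable φ) (hφ : Integrable φ)
    (hK : IsClosed K) (h0 : ∀ z ∉ K, φ z = 0) :
    ∫⁻ ζ in Kᶜ, ‖∫ z, φ z / (z - ζ) ^ 2‖ₑ ^ 2 ≤
      ENNReal.ofReal (∫ z, bumpKer 1 z) ^ 2 * ∫⁻ w, ‖φ w‖ₑ ^ 2 := by
  have hc : ∀ n : ℕ, (0 : ℝ) < n + 1 := fun n => by positivity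
  have hmeas : ∀ n : ℕ, Measurable fun ζ =>
      ‖∫ z, φ z * beurlingKer (n + 1) (ζ - z)‖ₑ ^ 2 := fun n => by
    have h1 := (hasDecay_beurlingKer (hc n)).1.measurable
    have h2 : StronglyMeasurable fun x : ℂ × ℂ => φ x.2 * beurlingKer (n + 1) (x.1 - x.2) :=
      Measurable.stronglyMeasurable (by fun_prop)
    exact h2.integral_prod_right'.measurable.enorm.pow_const 2
  have ht : Tendsto (fun n : ℕ => (n + 1 : ℝ)) atTop atTop :=
    tendsto_natCast_atTop_atTop.atTop_add tendsto_const_nhds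
  calc ∫⁻ ζ in Kᶜ, ‖∫ z, φ z / (z - ζ) ^ 2‖ₑ ^ 2
      = ∫⁻ ζ in Kᶜ, liminf (fun n : ℕ =>
          ‖∫ z, φ z * beurlingKer (n + 1) (ζ - z)‖ₑ ^ 2) atTop := by
        refine setLIntegral_congr_fun hK.measurableSet.compl fun ζ hζ => ?_
        have h := ((tendsto_integral_beurlingKer hφ hK h0 hζ).comp ht).enorm
        rw [enorm_neg] at h
        exact ((ENNReal.continuous_pow 2).tendsto _ |>.comp h).liminf_eq.symm
    _ ≤ liminf (fun n : ℕ => ∫⁻ ζ in Kᶜ,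
          ‖∫ z, φ z * beurlingKer (n + 1) (ζ - z)‖ₑ ^ 2) atTop := lintegral_liminf_le hmeas
    _ ≤ _ := liminf_le_of_le (by isBoundedDefault) fun b hb => by
        obtain ⟨n, hn⟩ := hb.exists
        exact hn.trans ((setLIntegral_le_lintegral _ _).trans
          (lintegral_enorm_sq_beurling_le hm hφ (hc n)))

theorem tendsto_cauchyIntegral_cobounded (hφ : Integrable φ) (hK : IsBounded K)
    (h0 : ∀ z ∉ K, φ z = 0) :
    Tendsto (fun ζ => ∫ z, φ z / (z - ζ)) (cobounded ℂ) (nhds 0) := by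
  obtain ⟨R, hR⟩ := hK.exists_norm_le
  have ht : Tendsto (fun ζ : ℂ => ‖ζ‖ - R) (cobounded ℂ) atTop :=
    tendsto_atTop_add_const_right _ _ tendsto_norm_cobounded_atTop
  refine squeeze_zero_norm' ?_ (ht.const_div_atTop (∫ z, ‖φ z‖))
  filter_upwards [ht.eventually_gt_atTop 0] with ζ hζ
  rw [← integral_div]
  refine norm_integral_le_of_norm_le (hφ.norm.div_const _) (Eventually.of_forall fun z => ?_)
  by_cases hz : z ∈ K
  · rw [norm_div]
    have h1 := norm_sub_norm_le ζ z
    rw [norm_sub_rev] at h1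
    have h2 := hR z hz
    gcongr
    linarith
  · simp [h0 z hz]

end CauchyIntegral

/-- The Cauchy transform of a Bergman function is in `B₂¹` of the exterior. -/
theorem MemB2.memB21_cauchyTransform {G : Set ℂ} {g : ℂ → ℂ} (hg : MemB2 G g) (hG : IsOpen G)
    (hb : IsBounded G) : MemB21 (closure G)ᶜ (cauchyTransform G g) := by
  set φ : ℂ → ℂ := G.indicator fun z => (starRingEnd ℂ) (g z) with hφdef
  have hcont : ContinuousOn (fun z => (starRingEnd ℂ) (g z)) G :=
    continuous_conj.comp_continuousOn hg.1.continuousOn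
  have hm : Measurable φ := by
    classical
    rw [hφdef, ← Set.piecewise_eq_indicator]
    exact hcont.measurable_piecewise continuousOn_const hG.measurableSet
  have hfin : ∫⁻ z, ‖φ z‖ₑ ^ 2 ≠ ⊤ := by
    have e : ∫⁻ z, ‖φ z‖ₑ ^ 2 = ∫⁻ z in G, ‖(‖g z‖ ^ 2 : ℝ)‖ₑ := by
      rw [← lintegral_indicator hG.measurableSet]
      refine lintegral_congr fun z => ?_
      by_cases hz : z ∈ G
      · simp [hφdef, hz]
      · simp [hφdef, hz]
    rw [e]
    exact hg.2.hasFiniteIntegral.ne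
  have hφ : Integrable φ := by
    rw [hφdef, integrable_indicator_iff hG.measurableSet]
    have : IsFiniteMeasure (volume.restrict G) := ⟨by simpa using hb.measure_lt_top⟩
    have h2 : MemLp (fun z => (starRingEnd ℂ) (g z)) 2 (volume.restrict G) := by
      rw [memLp_two_iff_integrable_sq_norm (hcont.aestronglyMeasurable hG.measurableSet)]
      simp only [RCLike.norm_conj]
      exact hg.2
    exact h2.integrable one_le_two
  have h0 : ∀ z ∉ closure G, φ z = 0 := fun z hz =>
    indicator_of_notMem (fun h => hz (subset_closure h)) _
  have e : cauchyTransform G g = fun ζ => (1 / Real.pi : ℂ) * ∫ z, φ z / (z - ζ) := by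
    funext ζ
    rw [cauchyTransform, ← integral_indicator hG.measurableSet]
    congr 2
    funext z
    by_cases hz : z ∈ G <;> simp [hφdef, hz]
  have hd : ∀ ζ ∉ closure G, HasDerivAt (cauchyTransform G g)
      ((1 / Real.pi : ℂ) * ∫ z, φ z / (z - ζ) ^ 2) ζ := fun ζ hζ => by
    rw [e]
    exact (hasDerivAt_cauchyIntegral hφ isClosed_closure h0 hζ).const_mul _
  refine ⟨fun ζ hζ => (hd ζ hζ).differentiableAt.differentiableWithinAt, ?_, ?_⟩
  · rw [e]
    simpa using (tendsto_cauchyIntegral_cobounded hφ hb.closure h0).const_mul (1 / Real.pi : ℂ)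
  · refine ⟨((measurable_deriv _).norm.pow_const 2).aestronglyMeasurable, ?_⟩
    have hle := lintegral_enorm_sq_cauchyIntegral_le hm hφ isClosed_closure h0
    have e2 : ∫⁻ ζ in (closure G)ᶜ, ‖(‖deriv (cauchyTransform G g) ζ‖ ^ 2 : ℝ)‖ₑ =
        ∫⁻ ζ in (closure G)ᶜ, ‖(1 / Real.pi : ℂ)‖ₑ ^ 2 * ‖∫ z, φ z / (z - ζ) ^ 2‖ₑ ^ 2 := by
      refine setLIntegral_congr_fun isClosed_closure.measurableSet.compl fun ζ hζ => ?_
      rw [(hd ζ hζ).deriv, enorm_pow, enorm_norm, enorm_mul, mul_pow]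
    rw [hasFiniteIntegral_iff_enorm, e2, lintegral_const_mul' _ _ (by simp)]
    exact ENNReal.mul_lt_top (by simp) (hle.trans_lt
      (ENNReal.mul_lt_top (by simp) hfin.lt_top))

/-- Theorem 2: for a quasidisk `G` (the bounded component of the complement of a
quasicircle), the Cauchy transform maps `B₂(G)` onto `B₂¹(ℂ ∖ cl(G))`:
`K(B₂*(G)) = B₂¹(ℂ ∖ cl(G))`. -/
theorem cauchyTransform_surjective_of_quasidisk (J G : Set ℂ)
    (hJ : IsQuasicircle J) (hGb : Bornology.IsBounded G)
    (hG : ∃ z ∈ Jᶜ, G = connectedComponentIn Jᶜ z) :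
    (∀ γ : ℂ → ℂ, MemB21 ((closure G)ᶜ) γ →
      ∃ g : ℂ → ℂ, MemB2 G g ∧ ∀ ζ ∉ closure G, γ ζ = cauchyTransform G g ζ) ∧
    (∀ g : ℂ → ℂ, MemB2 G g → MemB21 ((closure G)ᶜ) (cauchyTransform G g)) := by
  obtain ⟨z, hz, rfl⟩ := hG
  have hopen := hJ.1.isOpen_connectedComponentIn (z₀ := z)
  obtain ⟨M, h⟩ := hJ.exists_isClosedQuasidisk hz hGb
  refine ⟨fun γ hγ => h.exists_eq_cauchyTransform hopen subset_closure
    (hJ.1.closure_component hz hGb).subset hγ.1 hγ.2.1 ?_, fun g hg => ?_⟩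
  · have := hγ.2.2.hasFiniteIntegral.ne
    simpa only [enorm_pow, enorm_norm] using this
  · exact hg.memB21_cauchyTransform hopen hGb
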